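/- Let n ≤ d be positive integers and let A : ℝ^n → ℝ^{d−n} be a compactly supported Lipschitz function with graph Γ. There exists ε₀ > 0 such that if ‖∇A‖_∞ ≤ ε₀ and μ₀ is the measure supported on Γ with Π_♯μ₀ equal to Lebesgue measure on ℝ^n (i.e., μ₀ = Ã_♯(Lebesgue)), then ‖S^⊥μ₀‖²_{L²(μ₀)} ≈ Σ_{j∈ℤ} ‖Π^⊥(R^j μ₀)‖²_{L²(μ₀)} ≈ ‖∇A‖²_{L²}, with comparability constants depending only on n and d. -/

import Mathlib

open MeasureTheory Metric Set
open scoped ENNReal NNReal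

noncomputable section

/-- The `s`-Riesz kernel in `ℝ^d`. -/
def rieszKernel (d : ℕ) (s : ℝ) (x y : EuclideanSpace ℝ (Fin d)) : EuclideanSpace ℝ (Fin d) :=
  ‖x - y‖ ^ (-(s + 1)) • (x - y)

/-- Doubly truncated Riesz transform `R^s_{t,u} μ (x)`. -/
def truncRiesz (d : ℕ) (s : ℝ) (μ : Measure (EuclideanSpace ℝ (Fin d)))
    (x : EuclideanSpace ℝ (Fin d)) (t u : ℝ) : EuclideanSpace ℝ (Fin d) :=
  ∫ y in {y | t < dist x y ∧ dist x y ≤ u}, rieszKernel d s x y ∂μ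

/-- The square function `Sμ(x)`, as a value in `ℝ≥0∞`. -/
def sqFn (d : ℕ) (s : ℝ) (μ : Measure (EuclideanSpace ℝ (Fin d)))
    (x : EuclideanSpace ℝ (Fin d)) : ℝ≥0∞ :=
  (∫⁻ t in Ioi (0:ℝ), ENNReal.ofReal (‖truncRiesz d s μ x t (2*t)‖^2 / t)) ^ (1/2 : ℝ)

/-- The map `Ã : x ↦ (x, A(x))` from `ℝ^n` to `ℝ^d`. -/
def graphMap (n d : ℕ) (hnd : n ≤ d)
    (A : EuclideanSpace ℝ (Fin n) → EuclideanSpace ℝ (Fin (d - n)))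
    (x : EuclideanSpace ℝ (Fin n)) : EuclideanSpace ℝ (Fin d) :=
  (WithLp.equiv 2 (Fin d → ℝ)).symm fun i =>
    if h : (i : ℕ) < n then x ⟨i, h⟩
    else A x ⟨(i : ℕ) - n, by have := i.isLt; omega⟩

/-- The graph `Γ = {(x, A(x)) : x ∈ ℝ^n} ⊂ ℝ^d`. -/
def graphSet (n d : ℕ) (hnd : n ≤ d)
    (A : EuclideanSpace ℝ (Fin n) → EuclideanSpace ℝ (Fin (d - n)))
    : Set (EuclideanSpace ℝ (Fin d)) :=
  Set.range (graphMap n d hnd A)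

/-- Orthogonal projection `Π^⊥` of `ℝ^d` onto the last `d - n` coordinates. -/
def projPerp (n d : ℕ) (x : EuclideanSpace ℝ (Fin d)) : EuclideanSpace ℝ (Fin d) :=
  (WithLp.equiv 2 (Fin d → ℝ)).symm fun i => if (i : ℕ) < n then 0 else x i

/-- The transversal square function `S^⊥μ(x)`. -/
def sqFnPerp (n d : ℕ) (μ : Measure (EuclideanSpace ℝ (Fin d)))
    (x : EuclideanSpace ℝ (Fin d)) : ℝ≥0∞ :=
  (∫⁻ t in Ioi (0:ℝ),
    ENNReal.ofReal (‖projPerp n d (truncRiesz d n μ x t (2*t))‖^2 / t)) ^ (1/2 : ℝ)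

/-- `L²(μ)`-norm of an `ℝ≥0∞`-valued function. -/
def l2Norm {α : Type*} [MeasurableSpace α] (μ : Measure α) (F : α → ℝ≥0∞) : ℝ≥0∞ :=
  (∫⁻ x, (F x) ^ 2 ∂μ) ^ (1/2 : ℝ)

/-- `‖∇A‖_{L²}` for a Lipschitz map `A : ℝ^n → ℝ^m` (the gradient is defined a.e.). -/
def gradL2 (n m : ℕ) (A : EuclideanSpace ℝ (Fin n) → EuclideanSpace ℝ (Fin m)) : ℝ≥0∞ :=
  eLpNorm (fun x => fderiv ℝ A x) 2 volume

/-- The measure `g dH^n|_Γ`. -/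
def graphMeasure (n d : ℕ) (hnd : n ≤ d)
    (A : EuclideanSpace ℝ (Fin n) → EuclideanSpace ℝ (Fin (d - n)))
    (g : EuclideanSpace ℝ (Fin d) → ℝ) : Measure (EuclideanSpace ℝ (Fin d)) :=
  (μH[(n:ℝ)].restrict (graphSet n d hnd A)).withDensity fun z => ENNReal.ofReal (g z)

/-- The smoothly truncated Riesz transform `R^j ν (x)` built from a bump `ψ0`. -/
def smoothTrunc (n d : ℕ) (ψ0 : EuclideanSpace ℝ (Fin d) → ℝ) (j : ℤ)
    (ν : Measure (EuclideanSpace ℝ (Fin d))) (x : EuclideanSpace ℝ (Fin d)) :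
    EuclideanSpace ℝ (Fin d) :=
  ∫ y, (ψ0 ((2:ℝ) ^ j • (x - y)) - ψ0 ((2:ℝ) ^ (j + 1) • (x - y))) • rieszKernel d n x y ∂ν

abbrev Eu (n : ℕ) := EuclideanSpace ℝ (Fin n)

/-- Distance in the graph between the points over `x` and `x + h`. -/
def rho {n m : ℕ} (A : Eu n → Eu m) (x h : Eu n) : ℝ := √(‖h‖ ^ 2 + ‖A (x + h) - A x‖ ^ 2)

/-- Transversal part of a truncated transform with radial weight. -/
def TT {n m : ℕ} (φ : ℝ → ℝ) (A : Eu n → Eu m) (x : Eu n) : Eu m :=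
  ∫ h, φ (rho A x h) • (A (x + h) - A x)

/-- Second difference. -/
def DD {n m : ℕ} (A : Eu n → Eu m) (x h : Eu n) : Eu m := A (x + h) + A (x - h) - (2 : ℝ) • A x

/-- Squared L2 modulus of continuity. -/
def gg {n m : ℕ} (A : Eu n → Eu m) (h : Eu n) : ℝ≥0∞ := ∫⁻ x, ‖A (x + h) - A x‖ₑ ^ 2

/-- The weight. -/
def ww {n : ℕ} (h : Eu n) : ℝ≥0∞ := ENNReal.ofReal ((‖h‖ ^ (n + 2))⁻¹)

/-- Squared L2 norm of second differences. -/
def q2 {n m : ℕ} (A : Eu n → Eu m) (h : Eu n) : ℝ≥0∞ := ∫⁻ x, ‖DD A x h‖ₑ ^ 2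

/-- Second difference energy. -/
def QQ {n m : ℕ} (A : Eu n → Eu m) : ℝ≥0∞ := ∫⁻ h, q2 A h * ww h


section P1
open Filter Topology

variable {n m : ℕ}

lemma enorm_sq_ofReal {m : ℕ} (v : Eu m) : ‖v‖ₑ ^ 2 = ENNReal.ofReal (‖v‖ ^ 2) := by
  rw [← ofReal_norm, ENNReal.ofReal_pow (norm_nonneg _)]

lemma gg_measurable {A : Eu n → Eu m} (hA : Continuous A) : Measurable (gg A) := by
  unfold gg
  apply Measurable.lintegral_prod_right' (f := fun p : Eu n × Eu n => ‖A (p.2 + p.1) - A p.2‖ₑ ^ 2)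
  have : Continuous fun p : Eu n × Eu n => A (p.2 + p.1) - A p.2 := by fun_prop
  exact (this.enorm.measurable).pow_const 2

lemma q2_measurable {A : Eu n → Eu m} (hA : Continuous A) : Measurable (q2 A) := by
  unfold q2
  apply Measurable.lintegral_prod_right' (f := fun p : Eu n × Eu n => ‖DD A p.2 p.1‖ₑ ^ 2)
  have : Continuous fun p : Eu n × Eu n => DD A p.2 p.1 := by unfold DD; fun_prop
  exact (this.enorm.measurable).pow_const 2

lemma ww_measurable : Measurable (ww (n := n)) := by
  unfold ww; fun_prop

lemma q2_add {A : Eu n → Eu m} (hA : Continuous A) (h : Eu n) :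
    q2 A h + gg A ((2 : ℝ) • h) = 4 * gg A h := by
  have e1 : gg A ((2 : ℝ) • h) = ∫⁻ x, ‖A (x + h) - A (x - h)‖ₑ ^ 2 := by
    unfold gg
    rw [← lintegral_add_right_eq_self _ (-h)]
    congr 1; ext x; congr 4; module
  have e2 : gg A h = ∫⁻ x, ‖A x - A (x - h)‖ₑ ^ 2 := by
    unfold gg
    rw [← lintegral_add_right_eq_self _ (-h)]
    congr 1; ext x; congr 4; module
  have m1 : Measurable fun x => ‖DD A x h‖ₑ ^ 2 := by
    have : Continuous fun x => DD A x h := by unfold DD; fun_prop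
    exact (this.enorm.measurable).pow_const 2
  have m2 : Measurable fun x => ‖A (x + h) - A x‖ₑ ^ 2 := by
    have : Continuous fun x => A (x + h) - A x := by fun_prop
    exact (this.enorm.measurable).pow_const 2
  have e3 : (4 : ℝ≥0∞) * gg A h = 2 * gg A h + 2 * gg A h := by
    rw [← add_mul]; norm_num
  rw [e3, e1]
  conv_rhs => rw [e2]
  conv_rhs => enter [1]; rw [← e2]
  unfold q2 gg
  rw [← lintegral_add_left m1, ← lintegral_const_mul' _ _ (by simp), ← lintegral_const_mul' _ _ (by simp),
    ← lintegral_add_left (m2.const_mul 2)]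
  congr 1; ext x
  simp only [enorm_sq_ofReal]
  have two : ∀ y : ℝ≥0∞, 2 * y = ENNReal.ofReal 2 * y := by intro y; simp
  rw [two, two, ← ENNReal.ofReal_mul (by norm_num),
    ← ENNReal.ofReal_mul (by norm_num), ← ENNReal.ofReal_add (by positivity) (by positivity),
    ← ENNReal.ofReal_add (by positivity) (by positivity)]
  congr 1
  have := parallelogram_law_with_norm ℝ (A (x + h) - A x) (A x - A (x - h))
  have a1 : A (x + h) - A x + (A x - A (x - h)) = A (x + h) - A (x - h) := by abel
  have a2 : A (x + h) - A x - (A x - A (x - h)) = DD A x h := by unfold DD; module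
  rw [a1, a2] at this
  linarith

lemma gg_eq {A : Eu n → Eu m} (h : Eu n) :
    gg A h = (eLpNorm (fun x => A (x + h) - A x) 2 volume) ^ 2 := by
  rw [eLpNorm_eq_lintegral_rpow_enorm_toReal (by norm_num) (by norm_num)]
  unfold gg
  simp only [ENNReal.toReal_ofNat, one_div]
  rw [← ENNReal.rpow_natCast, ← ENNReal.rpow_mul]
  simp

lemma gg_nsmul {A : Eu n → Eu m} (hA : Continuous A) (h : Eu n) (N : ℕ) :
    gg A ((N : ℝ) • h) ≤ (N : ℝ≥0∞) ^ 2 * gg A h := by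
  rw [gg_eq, gg_eq, ← mul_pow]
  gcongr
  induction N with
  | zero => simp
  | succ k ih =>
    have : (fun x => A (x + ((k + 1 : ℕ) : ℝ) • h) - A x) =
      (fun x => A (x + (k : ℝ) • h) - A x) +
        ((fun x => A (x + h) - A x) ∘ (fun x => x + (k : ℝ) • h)) := by
      ext1 x
      simp only [Pi.add_apply, Function.comp]
      rw [show x + ((k + 1 : ℕ) : ℝ) • h = x + (k : ℝ) • h + h by push_cast; module]
      abel
    rw [this]
    have c1 : Continuous (fun x => A (x + (k : ℝ) • h) - A x) := by fun_prop
    have c2 : Continuous (fun x => A (x + h) - A x) := by fun_prop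
    refine (eLpNorm_add_le c1.aestronglyMeasurable
      (c2.comp (by fun_prop : Continuous fun x => x + (k : ℝ) • h)).aestronglyMeasurable
        (by norm_num)).trans ?_
    rw [eLpNorm_comp_measurePreserving c2.aestronglyMeasurable
      (measurePreserving_add_right volume _)]
    push_cast
    rw [add_mul, one_mul]
    gcongr

lemma supp_diff {A : Eu n → Eu m} (hc : HasCompactSupport A) :
    ∃ R : ℝ, 0 < R ∧ ∀ x, R < ‖x‖ → A x = 0 := by
  obtain ⟨R, hR⟩ := hc.isCompact.isBounded.subset_closedBall 0
  refine ⟨max R 1, by positivity, fun x hx => ?_⟩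
  by_contra hne
  have : x ∈ closedBall (0 : Eu n) R := hR (subset_tsupport _ hne)
  simp at this
  have := le_max_left R 1
  linarith

lemma gg_tendsto {A : Eu n → Eu m} {K : ℝ≥0} (hA : LipschitzWith K A) (hc : HasCompactSupport A)
    (h : Eu n) : Tendsto (fun N : ℕ => ((N + 1 : ℕ) : ℝ≥0∞) ^ 2 * gg A (((N + 1 : ℕ) : ℝ)⁻¹ • h))
      atTop (𝓝 (∫⁻ x, ‖fderiv ℝ A x h‖ₑ ^ 2)) := by
  obtain ⟨R, hR, hsupp⟩ := supp_diff hc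
  have hcont := hA.continuous
  have key : ∀ N : ℕ, ((N + 1 : ℕ) : ℝ≥0∞) ^ 2 * gg A (((N + 1 : ℕ) : ℝ)⁻¹ • h)
     = ∫⁻ x, ‖((N + 1 : ℕ) : ℝ) • (A (x + ((N + 1 : ℕ) : ℝ)⁻¹ • h) - A x)‖ₑ ^ 2 := by
    intro N
    unfold gg
    rw [← lintegral_const_mul' _ _ (by finiteness)]
    congr 1; ext x
    rw [enorm_smul, mul_pow]
    congr 2
    rw [Real.enorm_eq_ofReal (by positivity), ENNReal.ofReal_natCast]
  simp_rw [key]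
  refine tendsto_lintegral_of_dominated_convergence
    ((closedBall (0 : Eu n) (R + ‖h‖)).indicator fun _ => ENNReal.ofReal ((K * ‖h‖) ^ 2)) ?_ ?_ ?_ ?_
  · intro N
    have : Continuous fun x => ((N + 1 : ℕ) : ℝ) • (A (x + ((N + 1 : ℕ) : ℝ)⁻¹ • h) - A x) := by
      fun_prop
    exact (this.enorm.measurable).pow_const 2
  · intro N
    refine ae_of_all _ fun x => ?_
    have hN : (0 : ℝ) < ((N + 1 : ℕ) : ℝ) := by positivity
    have hN1 : ((N + 1 : ℕ) : ℝ)⁻¹ ≤ 1 := by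
      apply inv_le_one_of_one_le₀; push_cast; linarith [(Nat.cast_nonneg N : (0 : ℝ) ≤ N)]
    beta_reduce
    by_cases hx : x ∈ closedBall (0 : Eu n) (R + ‖h‖)
    · rw [indicator_of_mem hx, enorm_sq_ofReal]
      apply ENNReal.ofReal_le_ofReal
      gcongr
      rw [norm_smul, Real.norm_of_nonneg hN.le]
      have := hA.norm_sub_le (x + ((N + 1 : ℕ) : ℝ)⁻¹ • h) x
      rw [add_sub_cancel_left, norm_smul, Real.norm_of_nonneg (by positivity)] at this
      calc ((N + 1 : ℕ) : ℝ) * ‖A (x + ((N + 1 : ℕ) : ℝ)⁻¹ • h) - A x‖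
          ≤ ((N + 1 : ℕ) : ℝ) * (K * (((N + 1 : ℕ) : ℝ)⁻¹ * ‖h‖)) := by gcongr
        _ = K * ‖h‖ := by field_simp
    · rw [indicator_of_notMem hx]
      have hx' : R + ‖h‖ < ‖x‖ := by simpa using hx
      rw [hsupp x (by linarith [norm_nonneg h]), hsupp]
      · simp
      have h1 : ‖x‖ - ‖((N + 1 : ℕ) : ℝ)⁻¹ • h‖ ≤ ‖x + ((N + 1 : ℕ) : ℝ)⁻¹ • h‖ := by
        have := norm_sub_norm_le x (-(((N + 1 : ℕ) : ℝ)⁻¹ • h))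
        rwa [norm_neg, sub_neg_eq_add] at this
      have h2 : ‖((N + 1 : ℕ) : ℝ)⁻¹ • h‖ ≤ ‖h‖ := by
        rw [norm_smul, Real.norm_of_nonneg (by positivity)]
        nlinarith [norm_nonneg h]
      linarith
  · rw [lintegral_indicator (by measurability)]
    simp only [lintegral_const, Measure.restrict_apply, MeasurableSet.univ, univ_inter]
    exact ENNReal.mul_ne_top (by simp) (measure_closedBall_lt_top.ne)
  · filter_upwards [hA.ae_differentiableAt] with x hx
    have h1 := hx.hasFDerivAt.lim_real h
    have h2 : Tendsto (fun N : ℕ => ((N + 1 : ℕ) : ℝ)) atTop atTop :=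
      (tendsto_natCast_atTop_atTop).comp (tendsto_add_atTop_nat 1)
    have h3 := h1.comp h2
    have h4 := ((continuous_enorm.tendsto _).comp h3)
    exact (ENNReal.continuous_pow 2).tendsto _ |>.comp h4

lemma gg_le_fderiv {A : Eu n → Eu m} {K : ℝ≥0} (hA : LipschitzWith K A) (hc : HasCompactSupport A)
    (h : Eu n) : gg A h ≤ ∫⁻ x, ‖fderiv ℝ A x h‖ₑ ^ 2 := by
  refine ge_of_tendsto' (gg_tendsto hA hc h) fun N => ?_
  have := gg_nsmul hA.continuous (((N + 1 : ℕ) : ℝ)⁻¹ • h) (N + 1)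
  rwa [smul_smul, mul_inv_cancel₀ (by positivity), one_smul] at this

lemma gradL2_sq (A : Eu n → Eu m) :
    gradL2 n m A ^ 2 = ∫⁻ x, ‖fderiv ℝ A x‖ₑ ^ 2 := by
  unfold gradL2
  rw [eLpNorm_eq_lintegral_rpow_enorm_toReal (by norm_num) (by norm_num)]
  simp only [ENNReal.toReal_ofNat, one_div]
  rw [← ENNReal.rpow_natCast, ← ENNReal.rpow_mul]
  simp

lemma gg_le {A : Eu n → Eu m} {K : ℝ≥0} (hA : LipschitzWith K A) (hc : HasCompactSupport A)
    (h : Eu n) : gg A h ≤ ENNReal.ofReal (‖h‖ ^ 2) * gradL2 n m A ^ 2 := by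
  refine (gg_le_fderiv hA hc h).trans ?_
  rw [gradL2_sq, ← lintegral_const_mul' _ _ (by simp)]
  apply lintegral_mono fun x => ?_
  have := (fderiv ℝ A x).le_opENorm h
  calc ‖fderiv ℝ A x h‖ₑ ^ 2 ≤ (‖fderiv ℝ A x‖ₑ * ‖h‖ₑ) ^ 2 := by gcongr
    _ = _ := by rw [mul_pow, enorm_sq_ofReal, mul_comm]

lemma gradL2_lt_top {A : Eu n → Eu m} {K : ℝ≥0} (hA : LipschitzWith K A) (hc : HasCompactSupport A) :
    gradL2 n m A ^ 2 < ∞ := by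
  rw [gradL2_sq]
  have hK := (hc.fderiv (𝕜 := ℝ)).isCompact
  calc ∫⁻ x, ‖fderiv ℝ A x‖ₑ ^ 2 ≤ ∫⁻ x, (tsupport (fderiv ℝ A)).indicator (fun _ => (K : ℝ≥0∞) ^ 2) x := by
        apply lintegral_mono fun x => ?_
        by_cases hx : x ∈ tsupport (fderiv ℝ A)
        · rw [indicator_of_mem hx]
          gcongr
          have := norm_fderiv_le_of_lipschitz ℝ hA (x₀ := x)
          exact_mod_cast this
        · rw [← ofReal_norm, image_eq_zero_of_notMem_tsupport hx, norm_zero]; simp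
    _ < ∞ := by
        rw [lintegral_indicator hK.measurableSet]
        simp only [lintegral_const, Measure.restrict_apply, MeasurableSet.univ, univ_inter]
        exact ENNReal.mul_lt_top (by finiteness) hK.measure_lt_top

end P1

section P2
open Filter Topology

variable {n m : ℕ}

lemma lint_smul {f : Eu n → ℝ≥0∞} (hf : Measurable f) {c : ℝ} (hc : 0 < c) :
    ENNReal.ofReal (c ^ n) * ∫⁻ h, f (c • h) = ∫⁻ h, f h := by
  have h1 := Measure.map_addHaar_smul (volume : Measure (Eu n)) hc.ne'
  have h2 : ∫⁻ h, f (c • h) = ∫⁻ h, f h ∂(Measure.map (fun x => c • x) volume) :=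
    (lintegral_map hf (measurable_const_smul c)).symm
  rw [h2, h1, lintegral_smul_measure, smul_eq_mul, ← mul_assoc, ← ENNReal.ofReal_mul (by positivity)]
  rw [finrank_euclideanSpace_fin, abs_of_pos (by positivity), mul_inv_cancel₀ (by positivity)]
  simp

/-- annulus -/
def ann (n : ℕ) (a b : ℝ) : Set (Eu n) := {h | a < ‖h‖ ∧ ‖h‖ ≤ b}

lemma ann_meas (a b : ℝ) : MeasurableSet (ann n a b) := by
  unfold ann
  exact (measurableSet_lt measurable_const measurable_norm).inter
    (measurableSet_le measurable_norm measurable_const)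

lemma ww_smul {c : ℝ} (hc : 0 < c) (h : Eu n) :
    ENNReal.ofReal (c ^ (n + 2)) * ww (c • h) = ww h := by
  unfold ww
  rw [← ENNReal.ofReal_mul (by positivity), norm_smul, Real.norm_of_nonneg hc.le, mul_pow, mul_inv,
    ← mul_assoc, mul_inv_cancel₀ (by positivity), one_mul]

lemma ann_scale {A : Eu n → Eu m} (hA : Continuous A) (a b : ℝ) :
    ∫⁻ h in ann n a b, gg A ((2 : ℝ) • h) * ww h = 4 * ∫⁻ h in ann n (2 * a) (2 * b), gg A h * ww h := by
  have hm : Measurable fun h => gg A h * ww h := (gg_measurable hA).mul ww_measurable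
  have := lint_smul (hm.indicator (ann_meas (n := n) (2 * a) (2 * b))) (c := 2) (by norm_num)
  rw [lintegral_indicator (ann_meas _ _)] at this
  rw [← this, ← mul_assoc, ← lintegral_const_mul' _ _ (by finiteness), ← lintegral_indicator (ann_meas _ _)]
  congr 1; ext h
  have hmem : (2 : ℝ) • h ∈ ann n (2 * a) (2 * b) ↔ h ∈ ann n a b := by
    simp only [ann, mem_ofPred_eq, norm_smul, Real.norm_ofNat]
    constructor <;> rintro ⟨h1, h2⟩ <;> constructor <;> linarith
  by_cases hh : h ∈ ann n a b
  · rw [indicator_of_mem hh, indicator_of_mem (hmem.2 hh), ← ww_smul (c := 2) (by norm_num) h]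
    rw [pow_add, ENNReal.ofReal_mul (by positivity)]
    have : ENNReal.ofReal (2 ^ 2) = 4 := by norm_num
    rw [this]; ring
  · rw [indicator_of_notMem hh, indicator_of_notMem (mt hmem.1 hh)]; simp

lemma J_le {A : Eu n → Eu m} {K : ℝ≥0} (hA : LipschitzWith K A) (hc : HasCompactSupport A)
    {a b : ℝ} (ha : 0 < a) (hb : 0 ≤ b) :
    ∫⁻ h in ann n a b, gg A h * ww h ≤
      ENNReal.ofReal ((b / a) ^ n) * volume (ball (0 : Eu n) 1) * gradL2 n m A ^ 2 := by
  calc ∫⁻ h in ann n a b, gg A h * ww h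
      ≤ ∫⁻ h in ann n a b, ENNReal.ofReal ((a ^ n)⁻¹) * gradL2 n m A ^ 2 := by
        apply setLIntegral_mono' (ann_meas _ _)
        intro h hh
        have h0 : 0 < ‖h‖ := ha.trans hh.1
        calc gg A h * ww h ≤ (ENNReal.ofReal (‖h‖ ^ 2) * gradL2 n m A ^ 2) * ww h := by
              gcongr; exact gg_le hA hc h
          _ = ENNReal.ofReal ((‖h‖ ^ n)⁻¹) * gradL2 n m A ^ 2 := by
              unfold ww
              rw [mul_right_comm, ← ENNReal.ofReal_mul (by positivity)]
              congr 2; field_simp; ring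
          _ ≤ _ := by
              gcongr
              exact hh.1.le
    _ = ENNReal.ofReal ((a ^ n)⁻¹) * gradL2 n m A ^ 2 * volume (ann n a b) := by
        simp
    _ ≤ ENNReal.ofReal ((a ^ n)⁻¹) * gradL2 n m A ^ 2 * volume (closedBall (0 : Eu n) b) := by
        gcongr
        intro h hh; simpa using hh.2
    _ = _ := by
        rw [Measure.addHaar_closedBall _ _ hb, finrank_euclideanSpace_fin, div_pow, div_eq_inv_mul,
          ENNReal.ofReal_mul (by positivity)]
        ring

/-- constant -/
def cQ (n : ℕ) : ℝ≥0∞ := 4 * (ENNReal.ofReal (2 ^ n) * volume (ball (0 : Eu n) 1))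

lemma cQ_lt_top (n : ℕ) : cQ n < ∞ := by
  unfold cQ
  have : volume (ball (0 : Eu n) 1) < ∞ := measure_ball_lt_top
  finiteness

lemma Q_ann {A : Eu n → Eu m} {K : ℝ≥0} (hA : LipschitzWith K A) (hc : HasCompactSupport A)
    {a b : ℝ} (ha : 0 < a) (hb : 0 ≤ b) :
    ∫⁻ h in ann n a b, q2 A h * ww h ≤ cQ n * gradL2 n m A ^ 2 := by
  have hcont := hA.continuous
  have hfin : ∀ a b : ℝ, 0 < a → 0 ≤ b → ∫⁻ h in ann n a b, gg A h * ww h ≠ ∞ := by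
    intro a b ha hb
    refine ((J_le hA hc ha hb).trans_lt ?_).ne
    have := gradL2_lt_top hA hc
    have : volume (ball (0 : Eu n) 1) < ∞ := measure_ball_lt_top
    exact ENNReal.mul_lt_top (ENNReal.mul_lt_top (by finiteness) this) ‹_›
  have hsum : (∫⁻ h in ann n a b, q2 A h * ww h) + 4 * ∫⁻ h in ann n (2 * a) (2 * b), gg A h * ww h
      = 4 * ∫⁻ h in ann n a b, gg A h * ww h := by
    rw [← ann_scale hcont, ← lintegral_add_left (show Measurable fun h => q2 A h * ww h from (q2_measurable hcont).mul ww_measurable),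
      ← lintegral_const_mul' _ _ (by simp)]
    congr 1; ext h
    rw [← add_mul, q2_add hcont, mul_assoc]
  have hsub : ann n a b ⊆ ann n a (2 * a) ∪ ann n (2 * a) (2 * b) := by
    rintro h ⟨h1, h2⟩
    by_cases h3 : ‖h‖ ≤ 2 * a
    · exact Or.inl ⟨h1, h3⟩
    · exact Or.inr ⟨not_le.1 h3, by linarith⟩
  have hle : ∫⁻ h in ann n a b, gg A h * ww h ≤ (∫⁻ h in ann n a (2 * a), gg A h * ww h) +
      ∫⁻ h in ann n (2 * a) (2 * b), gg A h * ww h :=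
    (lintegral_mono_set hsub).trans (lintegral_union_le _ _ _)
  have hmain : (∫⁻ h in ann n a b, q2 A h * ww h) ≤ 4 * ∫⁻ h in ann n a (2 * a), gg A h * ww h := by
    refine ENNReal.le_of_add_le_add_right (a := 4 * ∫⁻ h in ann n (2 * a) (2 * b), gg A h * ww h)
      (ENNReal.mul_ne_top (by simp) (hfin _ _ (by positivity) (by positivity))) ?_
    rw [hsum, ← mul_add]
    gcongr
  refine hmain.trans ?_
  unfold cQ
  rw [mul_assoc]
  gcongr
  have := J_le hA hc ha (b := 2 * a) (by positivity)
  rwa [mul_div_assoc, div_self ha.ne', mul_one] at this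

lemma q2_zero (A : Eu n → Eu m) : q2 A 0 = 0 := by
  have : ∀ x, DD A x 0 = 0 := by intro x; unfold DD; simp [two_smul]
  simp [q2, this]

lemma QQ_le {A : Eu n → Eu m} {K : ℝ≥0} (hA : LipschitzWith K A) (hc : HasCompactSupport A) :
    QQ A ≤ cQ n * gradL2 n m A ^ 2 := by
  have hU : (⋃ N : ℕ, ann n ((2 : ℝ) ^ N)⁻¹ (2 ^ N)) = {h : Eu n | h ≠ 0} := by
    ext h
    simp only [mem_iUnion, mem_ofPred_eq]
    constructor
    · rintro ⟨N, hN⟩ rfl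
      have := hN.1
      simp only [norm_zero] at this
      have h2 : (0 : ℝ) < ((2 : ℝ) ^ N)⁻¹ := by positivity
      linarith
    · intro hh
      have hpos := norm_pos_iff.2 hh
      obtain ⟨N, hN⟩ := pow_unbounded_of_one_lt (max ‖h‖ ‖h‖⁻¹) (by norm_num : (1 : ℝ) < 2)
      refine ⟨N, ?_, ?_⟩
      · have := (le_max_right _ _).trans_lt hN
        exact inv_lt_of_inv_lt₀ hpos this
      · exact ((le_max_left _ _).trans_lt hN).le
  have hdir : Directed (· ⊆ ·) (fun N : ℕ => ann n ((2 : ℝ) ^ N)⁻¹ (2 ^ N)) := by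
    apply Monotone.directed_le
    intro i j hij h hh
    have h2 : (2 : ℝ) ^ i ≤ 2 ^ j := pow_le_pow_right₀ (by norm_num) hij
    refine ⟨lt_of_le_of_lt ?_ hh.1, hh.2.trans h2⟩
    gcongr
  have : QQ A = ∫⁻ h in {h : Eu n | h ≠ 0}, q2 A h * ww h := by
    unfold QQ
    rw [← lintegral_indicator (by measurability)]
    congr 1; ext h
    by_cases hh : h = 0
    · subst hh; simp [q2_zero]
    · rw [indicator_of_mem (by exact hh)]
  rw [this, ← hU, setLIntegral_iUnion_of_directed _ hdir]
  exact iSup_le fun N => Q_ann hA hc (by positivity) (by positivity)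

end P2

section P3
open Filter Topology

variable {n m : ℕ}

lemma cs_lint {α : Type*} [MeasurableSpace α] {ν : Measure α} {f : α → ℝ≥0∞} (hf : AEMeasurable f ν) :
    (∫⁻ x, f x ∂ν) ^ 2 ≤ ν univ * ∫⁻ x, f x ^ 2 ∂ν := by
  have := ENNReal.lintegral_mul_le_Lp_mul_Lq ν (Real.HolderConjugate.two_two) hf
    (aemeasurable_const (b := (1 : ℝ≥0∞)))
  simp only [Pi.mul_apply, mul_one, ENNReal.one_rpow, lintegral_const, one_mul] at this
  calc (∫⁻ x, f x ∂ν) ^ 2 ≤ ((∫⁻ x, f x ^ (2 : ℝ) ∂ν) ^ (1 / (2 : ℝ)) * ν univ ^ (1 / (2 : ℝ))) ^ 2 := by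
        gcongr
    _ = _ := by
        rw [mul_pow, ← ENNReal.rpow_natCast, ← ENNReal.rpow_natCast, ← ENNReal.rpow_mul,
          ← ENNReal.rpow_mul, mul_comm]
        norm_num

lemma cs_set {α : Type*} [MeasurableSpace α] {ν : Measure α} {f : α → ℝ≥0∞} (hf : Measurable f)
    (S : Set α) : (∫⁻ x in S, f x ∂ν) ^ 2 ≤ ν S * ∫⁻ x in S, f x ^ 2 ∂ν := by
  have := cs_lint (ν := ν.restrict S) hf.aemeasurable
  simpa using this

lemma sq_add_le (a b : ℝ≥0∞) : (a + b) ^ 2 ≤ 4 * (a ^ 2 + b ^ 2) := by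
  rcases le_total a b with h | h
  · calc (a + b) ^ 2 ≤ (b + b) ^ 2 := by gcongr
      _ = 4 * b ^ 2 := by ring
      _ ≤ _ := by gcongr; exact le_add_self
  · calc (a + b) ^ 2 ≤ (a + a) ^ 2 := by gcongr
      _ = 4 * a ^ 2 := by ring
      _ ≤ _ := by gcongr; exact le_self_add

lemma symm_bound {f : Eu n → Eu m} (hf : Integrable f) :
    ‖∫ h, f h‖ₑ ≤ ∫⁻ h, ‖f h + f (-h)‖ₑ := by
  have h1 : ∫ h, f (-h) = ∫ h, f h := integral_neg_eq_self f volume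
  have h2 : ∫ h, (f h + f (-h)) = (2 : ℝ) • ∫ h, f h := by
    rw [integral_add hf hf.comp_neg, h1, two_smul]
  calc ‖∫ h, f h‖ₑ ≤ ‖(2 : ℝ) • ∫ h, f h‖ₑ := by
        rw [enorm_smul]
        have : ‖(2 : ℝ)‖ₑ = 2 := by rw [Real.enorm_eq_ofReal (by norm_num)]; simp
        rw [this, two_mul]
        exact le_self_add
    _ = ‖∫ h, (f h + f (-h))‖ₑ := by rw [h2]
    _ ≤ _ := enorm_integral_le_lintegral_enorm _

lemma norm_le_rho (A : Eu n → Eu m) (x h : Eu n) : ‖h‖ ≤ rho A x h := by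
  unfold rho
  apply Real.le_sqrt_of_sq_le
  nlinarith [sq_nonneg ‖A (x + h) - A x‖]

lemma rho_nonneg (A : Eu n → Eu m) (x h : Eu n) : 0 ≤ rho A x h := Real.sqrt_nonneg _

lemma rho_sq (A : Eu n → Eu m) (x h : Eu n) :
    rho A x h ^ 2 = ‖h‖ ^ 2 + ‖A (x + h) - A x‖ ^ 2 := by
  unfold rho; rw [Real.sq_sqrt (by positivity)]

lemma rho_continuous {A : Eu n → Eu m} (hA : Continuous A) :
    Continuous fun p : Eu n × Eu n => rho A p.1 p.2 := by
  unfold rho; fun_prop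

lemma rho_continuous' {A : Eu n → Eu m} (hA : Continuous A) (x : Eu n) : Continuous (rho A x) := by
  unfold rho; fun_prop

lemma DD_continuous' {A : Eu n → Eu m} (hA : Continuous A) (x : Eu n) : Continuous (DD A x) := by
  unfold DD; fun_prop

lemma DD_continuous {A : Eu n → Eu m} (hA : Continuous A) :
    Continuous fun p : Eu n × Eu n => DD A p.1 p.2 := by
  unfold DD; fun_prop

lemma int_of_bdd {f : Eu n → Eu m} (hf : AEStronglyMeasurable f) {M R : ℝ}
    (hM : ∀ h, ‖f h‖ ≤ M) (hR : ∀ h, R < ‖h‖ → f h = 0) : Integrable f := by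
  have h1 : IntegrableOn f (closedBall 0 R) := by
    apply Measure.integrableOn_of_bounded (M := M) measure_closedBall_lt_top.ne hf
    exact ae_of_all _ hM
  refine (integrableOn_iff_integrable_of_support_subset ?_).1 h1
  intro h hh
  by_contra hne
  exact hh (hR h (by simpa using hne))

lemma TT_int {A : Eu n → Eu m} {K : ℝ≥0} (hA : LipschitzWith K A) {φ : ℝ → ℝ} (hφ : Measurable φ)
    {M R : ℝ} (hM : ∀ r, |φ r| ≤ M) (hR : ∀ r, R < r → φ r = 0) (x : Eu n) :
    Integrable fun h => φ (rho A x h) • (A (x + h) - A x) := by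
  have hM0 : 0 ≤ M := (abs_nonneg _).trans (hM 0)
  refine int_of_bdd (M := M * (K * max R 0)) (R := max R 0) ?_ ?_ ?_
  · have c2 : Continuous fun h => A (x + h) - A x := by have := hA.continuous; fun_prop
    exact ((hφ.comp (rho_continuous' hA.continuous x).measurable).aestronglyMeasurable).smul
      c2.aestronglyMeasurable
  · intro h
    by_cases hh : R < rho A x h
    · rw [hR _ hh]; simp; positivity
    · have h1 : ‖h‖ ≤ max R 0 := (norm_le_rho A x h).trans ((not_lt.1 hh).trans (le_max_left _ _))
      have h2 := hA.norm_sub_le (x + h) x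
      rw [add_sub_cancel_left] at h2
      rw [norm_smul, Real.norm_eq_abs]
      have h3 : ‖A (x + h) - A x‖ ≤ K * max R 0 := h2.trans (by gcongr)
      exact mul_le_mul (hM _) h3 (norm_nonneg _) hM0
  · intro h hh
    rw [hR _ ((le_max_left R 0).trans_lt (hh.trans_le (norm_le_rho A x h)))]; simp

lemma sqrt_diff {r a b e : ℝ} (hr : 0 ≤ r) (he : 0 ≤ e) (ha : 0 ≤ a) (hb : 0 ≤ b)
    (ha' : a ≤ e * r) (hb' : b ≤ e * r) :
    |√(r ^ 2 + a ^ 2) - √(r ^ 2 + b ^ 2)| ≤ e * |a - b| := by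
  rcases hr.eq_or_lt with h0 | h0
  · subst h0
    have : a = 0 := by linarith
    have : b = 0 := by linarith
    subst_vars; simp
  have h1 : r ≤ √(r ^ 2 + a ^ 2) := Real.le_sqrt_of_sq_le (by nlinarith)
  have h2 : r ≤ √(r ^ 2 + b ^ 2) := Real.le_sqrt_of_sq_le (by nlinarith)
  have e1 := Real.sq_sqrt (show 0 ≤ r ^ 2 + a ^ 2 by positivity)
  have e2 := Real.sq_sqrt (show 0 ≤ r ^ 2 + b ^ 2 by positivity)
  set u := √(r ^ 2 + a ^ 2)
  set w := √(r ^ 2 + b ^ 2)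
  have h3 : |u - w| * (u + w) = |a - b| * (a + b) := by
    have h5 : |(u - w) * (u + w)| = |(a - b) * (a + b)| := by congr 1; nlinarith
    rwa [abs_mul, abs_mul, abs_of_nonneg (show 0 ≤ u + w by linarith),
      abs_of_nonneg (show 0 ≤ a + b by linarith)] at h5
  have h4 : |u - w| * (2 * r) ≤ (e * |a - b|) * (2 * r) := by
    calc |u - w| * (2 * r) ≤ |u - w| * (u + w) := by gcongr; linarith
      _ = |a - b| * (a + b) := h3
      _ ≤ |a - b| * (e * r + e * r) := by gcongr
      _ = _ := by ring
  exact le_of_mul_le_mul_right h4 (by positivity)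

lemma v_le {A : Eu n → Eu m} {K : ℝ≥0} (hA : LipschitzWith K A) (x h : Eu n) :
    ‖A (x + h) - A x‖ ≤ K * ‖h‖ := by
  have h2 := hA.norm_sub_le (x + h) x
  rwa [add_sub_cancel_left] at h2

lemma v_add (A : Eu n → Eu m) (x h : Eu n) :
    (A (x + h) - A x) + (A (x + -h) - A x) = DD A x h := by
  unfold DD; rw [← sub_eq_add_neg]; module

lemma rho_symm {A : Eu n → Eu m} {K : ℝ≥0} (hA : LipschitzWith K A) (x h : Eu n) :
    |rho A x h - rho A x (-h)| ≤ K * ‖DD A x h‖ := by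
  unfold rho
  rw [norm_neg]
  have h2 := v_le hA x (-h)
  rw [norm_neg] at h2
  refine (sqrt_diff (norm_nonneg h) K.2 (norm_nonneg _) (norm_nonneg _) (v_le hA x h) h2).trans ?_
  apply mul_le_mul_of_nonneg_left _ K.2
  rw [← v_add]
  have := abs_norm_sub_norm_le (A (x + h) - A x) (-(A (x + -h) - A x))
  rwa [norm_neg, sub_neg_eq_add] at this

lemma rho_sub_norm {A : Eu n → Eu m} {K : ℝ≥0} (hA : LipschitzWith K A) (x h : Eu n) :
    |rho A x h - ‖h‖| ≤ K * ‖h‖ := by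
  have h1 := norm_le_rho A x h
  have h2 := rho_sq A x h
  have h3 := v_le hA x h
  rw [abs_of_nonneg (by linarith)]
  have h4 : rho A x h ≤ ‖h‖ + ‖A (x + h) - A x‖ := by
    apply le_of_sq_le_sq _ (by positivity)
    rw [h2]; nlinarith [norm_nonneg h, norm_nonneg (A (x + h) - A x)]
  linarith

/-- Growth of rho along rays, for slope at most 1/4. -/
lemma rho_ray {A : Eu n → Eu m} (hA : LipschitzWith (1 / 4) A) (x h : Eu n) {s s' : ℝ}
    (hs : 0 ≤ s') (hss : s' ≤ s) :
    (s - s') * ‖h‖ ≤ 2 * |rho A x (s • h) - rho A x (s' • h)| := by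
  set r := ‖h‖ with hr
  have hr0 : 0 ≤ r := norm_nonneg h
  have e1 := rho_sq A x (s • h)
  have e2 := rho_sq A x (s' • h)
  have b1 := v_le hA x (s • h)
  have b2 := v_le hA x (s' • h)
  have b3 := hA.norm_sub_le (x + s • h) (x + s' • h)
  have b4 := norm_sub_norm_le (A (x + s • h) - A x) (A (x + s' • h) - A x)
  have b5 := norm_sub_norm_le (A (x + s' • h) - A x) (A (x + s • h) - A x)
  rw [sub_sub_sub_cancel_right] at b4 b5
  rw [norm_sub_rev (A (x + s' • h)) (A (x + s • h))] at b5
  rw [add_sub_add_left_eq_sub, ← sub_smul, norm_smul, Real.norm_of_nonneg (by linarith)] at b3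
  rw [norm_smul, Real.norm_of_nonneg (by linarith), ← hr] at b1 b2 e1 e2
  have u1 := rho_sub_norm hA x (s • h)
  have u2 := rho_sub_norm hA x (s' • h)
  rw [norm_smul, Real.norm_of_nonneg (by linarith), ← hr] at u1 u2
  rw [← hr] at b3
  push_cast at *
  have u1' := (abs_le.1 u1).2
  have u2' := (abs_le.1 u2).2
  set P := rho A x (s • h)
  set P' := rho A x (s' • h)
  have P0 : 0 ≤ P := rho_nonneg _ _ _
  have P0' : 0 ≤ P' := rho_nonneg _ _ _
  set a := ‖A (x + s • h) - A x‖
  set a' := ‖A (x + s' • h) - A x‖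
  have a0 : 0 ≤ a := norm_nonneg _
  have a0' : 0 ≤ a' := norm_nonneg _
  set d := (s - s') * r with hd
  have hd0 : 0 ≤ d := mul_nonneg (by linarith) hr0
  rcases (mul_nonneg (add_nonneg (hs.trans hss) hs) hr0 : 0 ≤ (s + s') * r).eq_or_lt with h0 | h0
  · have : d ≤ (s + s') * r := by rw [hd]; gcongr; linarith
    have := abs_nonneg (P - P')
    linarith
  have key : (P - P') * (P + P') ≥ (15 / 16) * d * ((s + s') * r) := by
    have q1 : (P - P') * (P + P') = d * ((s + s') * r) + (a - a') * (a + a') := by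
      have : (P - P') * (P + P') = P ^ 2 - P' ^ 2 := by ring
      rw [this, e1, e2, hd]; ring
    have q2 : -(1 / 16 * d * ((s + s') * r)) ≤ (a - a') * (a + a') := by
      have : a' - a ≤ 1 / 4 * d := by linarith
      have : a + a' ≤ 1 / 4 * ((s + s') * r) := by linarith
      have : (a' - a) * (a + a') ≤ (1 / 4 * d) * (1 / 4 * ((s + s') * r)) := by
        calc (a' - a) * (a + a') ≤ (1 / 4 * d) * (a + a') := by gcongr
          _ ≤ _ := by gcongr
      linarith
    linarith
  have PP : P + P' ≤ 5 / 4 * ((s + s') * r) := by linarith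
  have habs : (P - P') * (P + P') ≤ |P - P'| * (5 / 4 * ((s + s') * r)) := by
    calc (P - P') * (P + P') ≤ |P - P'| * (P + P') := by gcongr; exact le_abs_self _
      _ ≤ _ := by gcongr
  have : (15 / 16 * d) * ((s + s') * r) ≤ (5 / 4 * |P - P'|) * ((s + s') * r) := by linarith
  have := le_of_mul_le_mul_right this h0
  linarith

end P3

section P4
open Filter Topology

variable {n m : ℕ}

/-- Sharply truncated kernel. -/
def kap (n : ℕ) (t : ℝ) (r : ℝ) : ℝ := (Ioc t (2 * t)).indicator (fun r => (r ^ (n + 1))⁻¹) r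

lemma pow_inv_diff {t a b : ℝ} (k : ℕ) (ht : 0 < t) (ha : t ≤ a) (hb : t ≤ b) :
    |(a ^ k)⁻¹ - (b ^ k)⁻¹| ≤ k * (t ^ (k + 1))⁻¹ * |a - b| := by
  wlog hab : a ≤ b generalizing a b
  · have := this hb ha (not_le.1 hab).le
    rwa [abs_sub_comm, abs_sub_comm b a] at this
  have ha0 : 0 < a := ht.trans_le ha
  have hb0 : 0 < b := ht.trans_le hb
  have h1 : (b ^ k)⁻¹ ≤ (a ^ k)⁻¹ := by gcongr
  rw [abs_of_nonneg (by linarith), abs_of_nonpos (by linarith)]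
  have h2 : 1 + k * (a / b - 1) ≤ (a / b) ^ k := by
    have := one_add_mul_le_pow (a := a / b - 1) (by
      have : 0 ≤ a / b := by positivity
      linarith) k
    simpa using this
  have h3 : (a ^ k)⁻¹ - (b ^ k)⁻¹ = (a ^ k)⁻¹ * (1 - (a / b) ^ k) := by
    rw [div_pow]; field_simp
  rw [h3]
  calc (a ^ k)⁻¹ * (1 - (a / b) ^ k) ≤ (a ^ k)⁻¹ * (k * ((b - a) / b)) := by
        gcongr
        have : (b - a) / b = 1 - a / b := by field_simp
        rw [this]; linarith
    _ ≤ (t ^ k)⁻¹ * (k * ((b - a) / t)) := by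
        have : 0 ≤ b - a := by linarith
        gcongr
    _ = _ := by field_simp; ring

lemma kap_nonneg {t : ℝ} (ht : 0 < t) (r : ℝ) : 0 ≤ kap n t r := by
  unfold kap
  apply indicator_nonneg
  intro r hr
  have : 0 < r := ht.trans hr.1
  positivity

lemma kap_le {t : ℝ} (ht : 0 < t) (r : ℝ) : kap n t r ≤ (t ^ (n + 1))⁻¹ := by
  unfold kap
  by_cases hr : r ∈ Ioc t (2 * t)
  · rw [indicator_of_mem hr]
    have := hr.1
    gcongr
  · rw [indicator_of_notMem hr]; positivity

lemma kap_meas (t : ℝ) : Measurable (kap n t) := by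
  unfold kap
  exact Measurable.indicator (by fun_prop) measurableSet_Ioc

/-- size region -/
def UU (n : ℕ) (t : ℝ) : Set (Eu n) := {h | t / 2 ≤ ‖h‖ ∧ ‖h‖ ≤ 2 * t}

/-- bad set -/
def EE (A : Eu n → Eu m) (x : Eu n) (T : ℝ) : Set (Eu n) := {h | |rho A x h - T| ≤ ‖DD A x h‖ / 4}

lemma UU_meas (t : ℝ) : MeasurableSet (UU n t) := by
  unfold UU
  exact (measurableSet_le measurable_const measurable_norm).inter
    (measurableSet_le measurable_norm measurable_const)

lemma EE_meas {A : Eu n → Eu m} (hA : Continuous A) (x : Eu n) (T : ℝ) :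
    MeasurableSet (EE A x T) := by
  unfold EE
  have h1 := rho_continuous' hA x
  have h2 := DD_continuous' hA x
  exact (isClosed_le (by fun_prop) (by fun_prop)).measurableSet

lemma mem_UU {A : Eu n → Eu m} (hA : LipschitzWith (1 / 4) A) {x h : Eu n} {t : ℝ}
    (hh : rho A x h ∈ Ioc t (2 * t)) : h ∈ UU n t := by
  have h1 := norm_le_rho A x h
  have h2 := (abs_le.1 (rho_sub_norm hA x h)).2
  have h3 := norm_nonneg h
  push_cast at h2
  exact ⟨by linarith [hh.1], by linarith [hh.2]⟩

lemma kap_pointwise {A : Eu n → Eu m} (hA : LipschitzWith (1 / 4) A) (x h : Eu n) {t : ℝ} (ht : 0 < t) :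
    ‖kap n t (rho A x h) • (A (x + h) - A x) + kap n t (rho A x (-h)) • (A (x + -h) - A x)‖ₑ ≤
      (UU n t).indicator (fun h => ENNReal.ofReal ((2 * n + 3) / t ^ (n + 1)) * ‖DD A x h‖ₑ) h +
      (UU n t ∩ EE A x t).indicator (fun _ => ENNReal.ofReal (2 / t ^ n)) h +
      (UU n t ∩ EE A x (2 * t)).indicator (fun _ => ENNReal.ofReal (2 / t ^ n)) h := by
  have hs := rho_symm hA x h
  have v1 := v_le hA x h
  have v2 := v_le hA x (-h)
  rw [norm_neg] at v2
  push_cast at hs v1 v2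
  have hD0 := norm_nonneg (DD A x h)
  have hUneg : -h ∈ UU n t ↔ h ∈ UU n t := by simp [UU]
  have single : ∀ (a : ℝ) (v : Eu m), h ∈ UU n t → ‖v‖ ≤ 1 / 4 * ‖h‖ →
      ‖kap n t a • v‖ₑ ≤ ENNReal.ofReal (2 / t ^ n) := by
    intro a v hU hv
    rw [← ofReal_norm]
    apply ENNReal.ofReal_le_ofReal
    rw [norm_smul, Real.norm_of_nonneg (kap_nonneg ht _)]
    calc kap n t a * ‖v‖ ≤ (t ^ (n + 1))⁻¹ * (1 / 4 * (2 * t)) := by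
          gcongr
          · exact kap_le ht a
          · exact hv.trans (by gcongr; exact hU.2)
      _ ≤ 2 / t ^ n := by
          rw [pow_succ]; field_simp; norm_num
  by_cases h1 : rho A x h ∈ Ioc t (2 * t)
  · have hU := mem_UU hA h1
    by_cases h2 : rho A x (-h) ∈ Ioc t (2 * t)
    · rw [add_assoc]
      refine le_trans ?_ le_self_add
      rw [indicator_of_mem hU, ← ofReal_norm, ← ofReal_norm, ← ENNReal.ofReal_mul (by positivity)]
      apply ENNReal.ofReal_le_ofReal
      have e : kap n t (rho A x h) • (A (x + h) - A x) + kap n t (rho A x (-h)) • (A (x + -h) - A x)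
        = kap n t (rho A x h) • DD A x h + (kap n t (rho A x (-h)) - kap n t (rho A x h)) • (A (x + -h) - A x) := by
        rw [← v_add]; module
      rw [e]
      refine (norm_add_le _ _).trans ?_
      rw [norm_smul, norm_smul, Real.norm_of_nonneg (kap_nonneg ht _), Real.norm_eq_abs]
      have k1 : |kap n t (rho A x (-h)) - kap n t (rho A x h)| ≤
          (n + 1) * (t ^ (n + 2))⁻¹ * ((1 / 4) * ‖DD A x h‖) := by
        unfold kap
        rw [indicator_of_mem h1, indicator_of_mem h2]
        refine (pow_inv_diff (n + 1) ht h2.1.le h1.1.le).trans ?_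
        push_cast
        rw [abs_sub_comm]
        gcongr
      calc kap n t (rho A x h) * ‖DD A x h‖ + |kap n t (rho A x (-h)) - kap n t (rho A x h)| * ‖A (x + -h) - A x‖
          ≤ (t ^ (n + 1))⁻¹ * ‖DD A x h‖ + ((n + 1) * (t ^ (n + 2))⁻¹ * ((1 / 4) * ‖DD A x h‖)) * (1 / 4 * (2 * t)) := by
            gcongr
            · exact kap_le ht _
            · exact v2.trans (by gcongr; exact hU.2)
        _ = (1 + (n + 1) / 8) / t ^ (n + 1) * ‖DD A x h‖ := by
            rw [pow_succ t (n + 1)]; field_simp; ring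
        _ ≤ _ := by
            have h0 : (0 : ℝ) ≤ n := Nat.cast_nonneg n
            have h9 : (1 + ((n : ℝ) + 1) / 8) ≤ 2 * n + 3 := by linarith
            exact mul_le_mul_of_nonneg_right (div_le_div_of_nonneg_right h9 (by positivity)) hD0
    · have k2 : kap n t (rho A x (-h)) = 0 := indicator_of_notMem h2 _
      rw [k2, zero_smul, add_zero]
      have hor : h ∈ EE A x t ∨ h ∈ EE A x (2 * t) := by
        simp only [mem_Ioc, not_and_or, not_lt, not_le] at h2
        rw [abs_le] at hs
        rcases h2 with h2 | h2
        · left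
          simp only [EE, mem_ofPred_eq, abs_le]
          constructor <;> linarith [h1.1, h1.2]
        · right
          simp only [EE, mem_ofPred_eq, abs_le]
          constructor <;> linarith [h1.1, h1.2]
      refine (single _ _ hU v1).trans ?_
      rcases hor with hor | hor
      · have hm : h ∈ UU n t ∩ EE A x t := ⟨hU, hor⟩
        rw [indicator_of_mem hm]
        exact le_add_self.trans le_self_add
      · have hm : h ∈ UU n t ∩ EE A x (2 * t) := ⟨hU, hor⟩
        rw [indicator_of_mem hm]
        exact le_add_self
  · have k1 : kap n t (rho A x h) = 0 := indicator_of_notMem h1 _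
    rw [k1, zero_smul, zero_add]
    by_cases h2 : rho A x (-h) ∈ Ioc t (2 * t)
    · have hU := hUneg.1 (mem_UU hA h2)
      have hor : h ∈ EE A x t ∨ h ∈ EE A x (2 * t) := by
        simp only [mem_Ioc, not_and_or, not_lt, not_le] at h1
        rw [abs_le] at hs
        rcases h1 with h1 | h1
        · left
          simp only [EE, mem_ofPred_eq, abs_le]
          constructor <;> linarith [h2.1, h2.2]
        · right
          simp only [EE, mem_ofPred_eq, abs_le]
          constructor <;> linarith [h2.1, h2.2]
      refine (single _ _ hU v2).trans ?_
      rcases hor with hor | hor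
      · have hm : h ∈ UU n t ∩ EE A x t := ⟨hU, hor⟩
        rw [indicator_of_mem hm]
        exact le_add_self.trans le_self_add
      · have hm : h ∈ UU n t ∩ EE A x (2 * t) := ⟨hU, hor⟩
        rw [indicator_of_mem hm]
        exact le_add_self
    · have k2 : kap n t (rho A x (-h)) = 0 := indicator_of_notMem h2 _
      rw [k2, zero_smul]; simp

lemma TT_kap_int {A : Eu n → Eu m} {K : ℝ≥0} (hA : LipschitzWith K A) (x : Eu n) {t : ℝ} (ht : 0 < t) :
    Integrable fun h => kap n t (rho A x h) • (A (x + h) - A x) := by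
  refine TT_int hA (kap_meas t) (M := (t ^ (n + 1))⁻¹) (R := 2 * t) ?_ ?_ x
  · intro r; rw [abs_of_nonneg (kap_nonneg ht r)]; exact kap_le ht r
  · intro r hr; exact indicator_of_notMem (fun h => absurd h.2 (not_le.2 hr)) _

lemma TT_kap_bound {A : Eu n → Eu m} (hA : LipschitzWith (1 / 4) A) (x : Eu n) {t : ℝ} (ht : 0 < t) :
    ‖TT (kap n t) A x‖ₑ ≤
      (ENNReal.ofReal ((2 * n + 3) / t ^ (n + 1)) * ∫⁻ h in UU n t, ‖DD A x h‖ₑ) +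
      ENNReal.ofReal (2 / t ^ n) * volume (UU n t ∩ EE A x t) +
      ENNReal.ofReal (2 / t ^ n) * volume (UU n t ∩ EE A x (2 * t)) := by
  have hc := hA.continuous
  refine (symm_bound (TT_kap_int hA x ht)).trans ?_
  refine (lintegral_mono fun h => kap_pointwise hA x h ht).trans ?_
  have m1 : Measurable ((UU n t).indicator (fun h => ENNReal.ofReal ((2 * n + 3) / t ^ (n + 1)) * ‖DD A x h‖ₑ)) :=
    Measurable.indicator ((DD_continuous' hc x).enorm.measurable.const_mul _) (UU_meas t)
  have s2 := (UU_meas (n := n) t).inter (EE_meas hc x t)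
  have s3 := (UU_meas (n := n) t).inter (EE_meas hc x (2 * t))
  have m2 : Measurable ((UU n t ∩ EE A x t).indicator (fun _ => ENNReal.ofReal (2 / t ^ n))) :=
    measurable_const.indicator s2
  rw [lintegral_add_left (show Measurable fun h => (UU n t).indicator (fun h => ENNReal.ofReal ((2 * n + 3) / t ^ (n + 1)) * ‖DD A x h‖ₑ) h +
      (UU n t ∩ EE A x t).indicator (fun _ => ENNReal.ofReal (2 / t ^ n)) h from m1.add m2), lintegral_add_left m1, lintegral_indicator (UU_meas t),
    lintegral_indicator_const s2, lintegral_indicator_const s3, lintegral_const_mul' _ _ (by simp)]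

end P4

section P5
open Filter Topology

variable {n m : ℕ}

lemma DD_ray {A : Eu n → Eu m} (hA : LipschitzWith (1 / 4) A) (x h : Eu n) (s s' : ℝ) :
    ‖DD A x (s • h)‖ ≤ ‖DD A x (s' • h)‖ + 1 / 2 * (|s - s'| * ‖h‖) := by
  have h1 := hA.norm_sub_le (x + s • h) (x + s' • h)
  have h2 := hA.norm_sub_le (x - s • h) (x - s' • h)
  have e1 : ‖x + s • h - (x + s' • h)‖ = |s - s'| * ‖h‖ := by
    rw [← Real.norm_eq_abs, ← norm_smul]; congr 1; module
  have e2 : ‖x - s • h - (x - s' • h)‖ = |s - s'| * ‖h‖ := by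
    rw [← Real.norm_eq_abs, ← norm_smul, ← norm_neg]; congr 1; module
  rw [e1] at h1
  rw [e2] at h2
  push_cast at h1 h2
  have e : DD A x (s • h) = DD A x (s' • h) + (A (x + s • h) - A (x + s' • h)) +
      (A (x - s • h) - A (x - s' • h)) := by unfold DD; module
  rw [e]
  refine (norm_add₃_le).trans ?_
  linarith

lemma EE_len {A : Eu n → Eu m} (hA : LipschitzWith (1 / 4) A) (x : Eu n) {h : Eu n} (hh : h ≠ 0) {T s : ℝ}
    (hs : s ∈ Icc (1 : ℝ) 2) (hE : s • h ∈ EE A x T) :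
    volume {s' : ℝ | s' ∈ Icc (1 : ℝ) 2 ∧ s' • h ∈ EE A x T} ≤ ENNReal.ofReal (8 * ‖DD A x (s • h)‖ / ‖s • h‖) := by
  have hn : 0 < ‖h‖ := norm_pos_iff.2 hh
  have hs0 : 0 < s := by linarith [hs.1]
  calc volume {s' : ℝ | s' ∈ Icc (1 : ℝ) 2 ∧ s' • h ∈ EE A x T}
      ≤ volume (closedBall s (2 * ‖DD A x (s • h)‖ / ‖h‖)) := by
        apply measure_mono
        rintro s' ⟨h1, h2⟩
        rw [mem_closedBall, Real.dist_eq, le_div_iff₀ hn]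
        simp only [EE, mem_ofPred_eq] at hE h2
        have hD := DD_ray hA x h s' s
        have key : |s' - s| * ‖h‖ ≤ 2 * |rho A x (s' • h) - rho A x (s • h)| := by
          rcases le_total s s' with hle | hle
          · rw [abs_of_nonneg (by linarith)]
            exact rho_ray hA x h (by linarith) hle
          · rw [abs_sub_comm, abs_of_nonneg (by linarith), abs_sub_comm]
            exact rho_ray hA x h (by linarith [h1.1]) hle
        have tri : |rho A x (s' • h) - rho A x (s • h)| ≤ |rho A x (s' • h) - T| + |rho A x (s • h) - T| := by
          rw [abs_sub_comm (rho A x (s • h)) T]; exact abs_sub_le _ _ _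
        nlinarith [norm_nonneg (DD A x (s • h)), mul_nonneg (abs_nonneg (s' - s)) hn.le]
    _ = ENNReal.ofReal (4 * ‖DD A x (s • h)‖ / ‖h‖) := by
        rw [Real.volume_closedBall]; congr 1; ring
    _ ≤ _ := by
        apply ENNReal.ofReal_le_ofReal
        rw [norm_smul, Real.norm_of_nonneg hs0.le, div_le_div_iff₀ hn (by positivity)]
        have := hs.2
        have : 4 * s * (‖DD A x (s • h)‖ * ‖h‖) ≤ 8 * (‖DD A x (s • h)‖ * ‖h‖) := by
          gcongr; linarith
        nlinarith

lemma vol_bound {A : Eu n → Eu m} (hA : LipschitzWith (1 / 4) A) (x : Eu n) {t : ℝ} (ht : 0 < t) (T : ℝ) :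
    volume (UU n t ∩ EE A x T) ^ 2 ≤ ENNReal.ofReal (4 ^ n) * volume (closedBall (0 : Eu n) (2 * t)) *
      ∫⁻ h in UU n t ∩ EE A x T, ENNReal.ofReal (8 * ‖DD A x h‖ / ‖h‖) := by
  have hc := hA.continuous
  set S := UU n t ∩ EE A x T with hS
  have hSm : MeasurableSet S := (UU_meas t).inter (EE_meas hc x T)
  set χ : Eu n → ℝ≥0∞ := S.indicator 1 with hχ
  have hχm : Measurable χ := measurable_one.indicator hSm
  have hsm : Measurable fun p : ℝ × Eu n => p.1 • p.2 := by fun_prop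
  set len : Eu n → ℝ≥0∞ := fun h => ∫⁻ s in Icc (1 : ℝ) 2, χ (s • h) with hlen
  have hlenm : Measurable len := by
    have : Measurable fun p : Eu n × ℝ => χ (p.2 • p.1) := hχm.comp (by fun_prop)
    exact this.lintegral_prod_right'
  have hVs : ∀ s ∈ Icc (1 : ℝ) 2, volume S ≤ ENNReal.ofReal (2 ^ n) * ∫⁻ h, χ (s • h) := by
    intro s hs
    have hs0 : 0 < s := by linarith [hs.1]
    have := lint_smul hχm hs0
    rw [hχ, lintegral_indicator_one hSm] at this
    rw [← this, ← hχ]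
    gcongr
    exact hs.2
  have hI1 : volume (Icc (1 : ℝ) 2) = 1 := by simp; norm_num
  have hV : volume S ≤ ENNReal.ofReal (2 ^ n) * ∫⁻ h, len h := by
    calc volume S = ∫⁻ s in Icc (1 : ℝ) 2, volume S := by
          rw [setLIntegral_const, hI1, mul_one]
      _ ≤ ∫⁻ s in Icc (1 : ℝ) 2, ENNReal.ofReal (2 ^ n) * ∫⁻ h, χ (s • h) :=
          setLIntegral_mono' measurableSet_Icc hVs
      _ = ENNReal.ofReal (2 ^ n) * ∫⁻ s in Icc (1 : ℝ) 2, ∫⁻ h, χ (s • h) := by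
          rw [lintegral_const_mul' _ _ (by simp)]
      _ = _ := by
          congr 1
          exact lintegral_lintegral_swap (hχm.comp hsm).aemeasurable
  have hlen0 : ∀ h, h ∉ closedBall (0 : Eu n) (2 * t) → len h = 0 := by
    intro h hh
    simp only [hlen]
    rw [setLIntegral_congr_fun (g := fun _ => 0) measurableSet_Icc]
    · simp
    · intro s hs
      simp only
      rw [hχ, indicator_of_notMem]
      intro hmem
      have := hmem.1.2
      rw [norm_smul, Real.norm_of_nonneg (by linarith [hs.1])] at this
      apply hh
      rw [mem_closedBall_zero_iff]
      nlinarith [hs.1, norm_nonneg h]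
  have hlenS : ∫⁻ h, len h = ∫⁻ h in closedBall (0 : Eu n) (2 * t), len h := by
    rw [← lintegral_indicator measurableSet_closedBall]
    congr 1; ext h
    by_cases hh : h ∈ closedBall (0 : Eu n) (2 * t)
    · rw [indicator_of_mem hh]
    · rw [indicator_of_notMem hh, hlen0 h hh]
  set G : Eu n → ℝ≥0∞ := fun h => χ h * ENNReal.ofReal (8 * ‖DD A x h‖ / ‖h‖) with hG
  have hGm : Measurable G := by
    refine hχm.mul ?_
    have := (DD_continuous' hc x).measurable
    fun_prop
  have hlen2 : ∀ h, len h ^ 2 ≤ ∫⁻ s in Icc (1 : ℝ) 2, G (s • h) := by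
    intro h
    have e : len h ^ 2 = ∫⁻ s in Icc (1 : ℝ) 2, χ (s • h) * len h := by
      rw [lintegral_mul_const, sq]
      exact hχm.comp (by fun_prop)
    rw [e]
    apply setLIntegral_mono' measurableSet_Icc
    intro s hs
    by_cases hmem : s • h ∈ S
    · simp only [hG]
      gcongr
      have hh0 : h ≠ 0 := by
        rintro rfl
        have := hmem.1.1
        simp at this; linarith
      refine le_trans ?_ (EE_len hA x hh0 hs hmem.2)
      simp only [hlen]
      have hms : MeasurableSet {s' : ℝ | s' • h ∈ S} :=
        (show Measurable fun s' : ℝ => s' • h by fun_prop) hSm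
      have e2 : ∀ s' : ℝ, χ (s' • h) = {s' : ℝ | s' • h ∈ S}.indicator 1 s' := by
        intro s'
        simp only [hχ, indicator, mem_ofPred_eq]
        rfl
      simp only [e2]
      rw [lintegral_indicator_one hms, Measure.restrict_apply hms]
      apply measure_mono
      rintro s' ⟨h1, h2⟩
      exact ⟨h2, h1.2⟩
    · have : χ (s • h) = 0 := indicator_of_notMem hmem _
      rw [this, zero_mul]; exact zero_le
  have hfin : ∫⁻ h, len h ^ 2 ≤ ∫⁻ h, G h := by
    calc ∫⁻ h, len h ^ 2 ≤ ∫⁻ h, ∫⁻ s in Icc (1 : ℝ) 2, G (s • h) := lintegral_mono hlen2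
      _ = ∫⁻ s in Icc (1 : ℝ) 2, ∫⁻ h, G (s • h) :=
          (lintegral_lintegral_swap (f := fun (s : ℝ) (h : Eu n) => G (s • h)) (hGm.comp hsm).aemeasurable).symm
      _ ≤ ∫⁻ s in Icc (1 : ℝ) 2, ∫⁻ h, G h := by
          apply setLIntegral_mono' measurableSet_Icc
          intro s hs
          have hs0 : 0 < s := by linarith [hs.1]
          rw [← lint_smul hGm hs0]
          apply le_mul_of_one_le_left zero_le
          rw [← ENNReal.ofReal_one]
          apply ENNReal.ofReal_le_ofReal
          exact one_le_pow₀ hs.1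
      _ = _ := by rw [setLIntegral_const, hI1, mul_one]
  have hGS : ∫⁻ h, G h = ∫⁻ h in S, ENNReal.ofReal (8 * ‖DD A x h‖ / ‖h‖) := by
    rw [← lintegral_indicator hSm]
    congr 1; ext h
    simp only [hG, hχ, indicator]
    split_ifs <;> simp
  calc volume S ^ 2 ≤ (ENNReal.ofReal (2 ^ n) * ∫⁻ h in closedBall (0 : Eu n) (2 * t), len h) ^ 2 := by
        rw [← hlenS]; gcongr
    _ = ENNReal.ofReal (4 ^ n) * (∫⁻ h in closedBall (0 : Eu n) (2 * t), len h) ^ 2 := by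
        rw [mul_pow, ← ENNReal.ofReal_pow (by positivity), ← pow_mul, mul_comm n, pow_mul]; norm_num
    _ ≤ ENNReal.ofReal (4 ^ n) * (volume (closedBall (0 : Eu n) (2 * t)) * ∫⁻ h in closedBall (0 : Eu n) (2 * t), len h ^ 2) := by
        gcongr
        exact cs_set hlenm _
    _ ≤ ENNReal.ofReal (4 ^ n) * (volume (closedBall (0 : Eu n) (2 * t)) * ∫⁻ h, G h) := by
        have := (setLIntegral_le_lintegral (closedBall (0 : Eu n) (2 * t)) _).trans hfin
        gcongr
    _ = _ := by rw [hGS, mul_assoc]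

lemma swap_lemma (S : Set (ℝ × Eu n)) (hSm : MeasurableSet S) (hS : ∀ t h, (t, h) ∈ S → 0 < t ∧ h ∈ UU n t)
    (F L : Eu n → ℝ≥0∞) (hF : Measurable F) (hL : ∀ h, volume {t : ℝ | (t, h) ∈ S} ≤ L h) (k : ℕ) :
    ∫⁻ t in Ioi (0 : ℝ), ENNReal.ofReal ((t ^ k)⁻¹) * ∫⁻ h in {h | (t, h) ∈ S}, F h ≤
      ∫⁻ h, ENNReal.ofReal (2 ^ k * (‖h‖ ^ k)⁻¹) * F h * L h := by
  have hslice : ∀ t : ℝ, MeasurableSet {h : Eu n | (t, h) ∈ S} := fun t => measurable_prodMk_left hSm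
  have hslice2 : ∀ h : Eu n, MeasurableSet {t : ℝ | (t, h) ∈ S} := fun t => measurable_prodMk_right hSm
  have hFm : Measurable fun h : Eu n => ENNReal.ofReal (2 ^ k * (‖h‖ ^ k)⁻¹) * F h :=
    Measurable.mul (by fun_prop) hF
  calc ∫⁻ t in Ioi (0 : ℝ), ENNReal.ofReal ((t ^ k)⁻¹) * ∫⁻ h in {h | (t, h) ∈ S}, F h
      ≤ ∫⁻ t, ENNReal.ofReal ((t ^ k)⁻¹) * ∫⁻ h in {h | (t, h) ∈ S}, F h := setLIntegral_le_lintegral _ _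
    _ ≤ ∫⁻ t, ∫⁻ h, S.indicator (fun p => ENNReal.ofReal (2 ^ k * (‖p.2‖ ^ k)⁻¹) * F p.2) (t, h) := by
        apply lintegral_mono
        intro t
        simp only
        rw [← lintegral_const_mul' _ _ (by simp), ← lintegral_indicator (hslice t)]
        refine lintegral_mono fun h => ?_
        show _ ≤ S.indicator (fun p => ENNReal.ofReal (2 ^ k * (‖p.2‖ ^ k)⁻¹) * F p.2) (t, h)
        by_cases hm : (t, h) ∈ S
        · have hm' : h ∈ {h : Eu n | (t, h) ∈ S} := hm
          rw [indicator_of_mem hm, indicator_of_mem hm']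
          gcongr
          obtain ⟨h1, h2, h3⟩ := hS t h hm
          have h0 : 0 < ‖h‖ := by linarith
          rw [show (2 : ℝ) ^ k * (‖h‖ ^ k)⁻¹ = ((‖h‖ / 2) ^ k)⁻¹ by rw [div_pow]; field_simp]
          gcongr
          linarith
        · have hm' : h ∉ {h : Eu n | (t, h) ∈ S} := hm
          rw [indicator_of_notMem hm, indicator_of_notMem hm']
    _ = ∫⁻ h, ∫⁻ t, S.indicator (fun p => ENNReal.ofReal (2 ^ k * (‖p.2‖ ^ k)⁻¹) * F p.2) (t, h) := by
        apply lintegral_lintegral_swap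
        exact ((hFm.comp measurable_snd).indicator hSm).aemeasurable
    _ ≤ _ := by
        apply lintegral_mono
        intro h
        simp only
        have : ∀ t : ℝ, S.indicator (fun p => ENNReal.ofReal (2 ^ k * (‖p.2‖ ^ k)⁻¹) * F p.2) (t, h) =
          {t : ℝ | (t, h) ∈ S}.indicator (fun _ => ENNReal.ofReal (2 ^ k * (‖h‖ ^ k)⁻¹) * F h) t := by
          intro t; simp only [indicator, mem_ofPred_eq]
        simp only [this]
        rw [lintegral_indicator_const (hslice2 h)]
        gcongr
        exact hL h

lemma slice_meas (S : Set (ℝ × Eu n)) (hSm : MeasurableSet S) (F : Eu n → ℝ≥0∞) (hF : Measurable F) :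
    Measurable fun t : ℝ => ∫⁻ h in {h | (t, h) ∈ S}, F h := by
  have hslice : ∀ t : ℝ, MeasurableSet {h : Eu n | (t, h) ∈ S} := fun t => measurable_prodMk_left hSm
  have : ∀ t : ℝ, ∫⁻ h in {h | (t, h) ∈ S}, F h = ∫⁻ h, S.indicator (fun p => F p.2) (t, h) := by
    intro t
    rw [← lintegral_indicator (hslice t)]
    congr 1
  simp only [this]
  exact ((hF.comp measurable_snd).indicator hSm).lintegral_prod_right'

lemma sq_add3_le (a b c : ℝ≥0∞) : (a + b + c) ^ 2 ≤ 16 * (a ^ 2 + b ^ 2 + c ^ 2) := by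
  calc (a + b + c) ^ 2 ≤ 4 * ((a + b) ^ 2 + c ^ 2) := sq_add_le _ _
    _ ≤ 4 * (4 * (a ^ 2 + b ^ 2) + 4 * c ^ 2) := by
        gcongr
        · exact sq_add_le _ _
        · exact le_mul_of_one_le_left zero_le (by norm_num)
    _ = _ := by ring

lemma vol_cB {r : ℝ} (hr : 0 ≤ r) :
    volume (closedBall (0 : Eu n) r) = ENNReal.ofReal (r ^ n) * volume (closedBall (0 : Eu n) 1) := by
  have := Measure.addHaar_closedBall' (volume : Measure (Eu n)) 0 hr
  rwa [finrank_euclideanSpace_fin] at this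

/-- joint bad set -/
def SE (A : Eu n → Eu m) (x : Eu n) (α : ℝ) : Set (ℝ × Eu n) :=
  {p | 0 < p.1 ∧ (p.1 / 2 ≤ ‖p.2‖ ∧ ‖p.2‖ ≤ 2 * p.1) ∧ |rho A x p.2 - α * p.1| ≤ ‖DD A x p.2‖ / 4}

/-- joint good set -/
def SU (n : ℕ) : Set (ℝ × Eu n) :=
  {p | 0 < p.1 ∧ (p.1 / 2 ≤ ‖p.2‖ ∧ ‖p.2‖ ≤ 2 * p.1)}

lemma SU_meas : MeasurableSet (SU n) := by
  unfold SU
  have h1 : MeasurableSet {p : ℝ × Eu n | 0 < p.1} := measurableSet_lt measurable_const measurable_fst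
  have h2 : MeasurableSet {p : ℝ × Eu n | p.1 / 2 ≤ ‖p.2‖} := measurableSet_le (by fun_prop) (by fun_prop)
  have h3 : MeasurableSet {p : ℝ × Eu n | ‖p.2‖ ≤ 2 * p.1} := measurableSet_le (by fun_prop) (by fun_prop)
  exact h1.inter (h2.inter h3)

lemma SE_meas {A : Eu n → Eu m} (hA : Continuous A) (x : Eu n) (α : ℝ) : MeasurableSet (SE A x α) := by
  have h1 := (rho_continuous' hA x).comp (continuous_snd (X := ℝ))
  have h2 := (DD_continuous' hA x).comp (continuous_snd (X := ℝ))
  have h3 : IsClosed {p : ℝ × Eu n | |rho A x p.2 - α * p.1| ≤ ‖DD A x p.2‖ / 4} :=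
    isClosed_le (((h1.sub (continuous_const.mul continuous_fst))).abs) (h2.norm.div_const _)
  have : SE A x α = SU n ∩ {p : ℝ × Eu n | |rho A x p.2 - α * p.1| ≤ ‖DD A x p.2‖ / 4} := by
    ext p; simp only [SE, SU, mem_inter_iff, mem_ofPred_eq]; tauto
  rw [this]
  exact SU_meas.inter h3.measurableSet

/-- inner energy -/
def qx (A : Eu n → Eu m) (x : Eu n) : ℝ≥0∞ := ∫⁻ h, ‖DD A x h‖ₑ ^ 2 * ww h

lemma term1 {A : Eu n → Eu m} (hA : Continuous A) (x : Eu n) :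
    ∫⁻ t in Ioi (0 : ℝ), ENNReal.ofReal ((t ^ (n + 3))⁻¹) * ∫⁻ h in {h | (t, h) ∈ SU n}, ‖DD A x h‖ₑ ^ 2
      ≤ ENNReal.ofReal (2 ^ (n + 4)) * qx A x := by
  refine (swap_lemma (SU n) SU_meas (fun t h hm => hm) _ (fun h => ENNReal.ofReal (2 * ‖h‖))
    ((DD_continuous' hA x).enorm.measurable.pow_const 2) ?_ (n + 3)).trans ?_
  · intro h
    calc volume {t : ℝ | (t, h) ∈ SU n} ≤ volume (Icc 0 (2 * ‖h‖)) := by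
          apply measure_mono
          intro t ht
          obtain ⟨h1, h2, h3⟩ := ht
          simp only at h1 h2 h3
          exact ⟨h1.le, by linarith⟩
      _ = _ := by rw [Real.volume_Icc, sub_zero]
  · unfold qx
    rw [← lintegral_const_mul' _ _ (by simp)]
    apply lintegral_mono
    intro h
    simp only [ww]
    rw [mul_right_comm, ← ENNReal.ofReal_mul (p := 2 ^ (n + 3) * (‖h‖ ^ (n + 3))⁻¹) (by positivity), mul_comm (‖DD A x h‖ₑ ^ 2), ← mul_assoc (ENNReal.ofReal (2 ^ (n + 4))),
      ← ENNReal.ofReal_mul (p := 2 ^ (n + 4)) (by positivity)]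
    refine mul_le_mul_left (ENNReal.ofReal_le_ofReal ?_) _
    rcases eq_or_ne ‖h‖ 0 with h0 | h0
    · rw [h0]; simp
    · apply le_of_eq; field_simp; ring

lemma term2 {A : Eu n → Eu m} (hA : Continuous A) (x : Eu n) {α : ℝ} (hα : 1 ≤ α) :
    ∫⁻ t in Ioi (0 : ℝ), ENNReal.ofReal ((t ^ (n + 1))⁻¹) *
        ∫⁻ h in {h | (t, h) ∈ SE A x α}, ENNReal.ofReal (8 * ‖DD A x h‖ / ‖h‖)
      ≤ ENNReal.ofReal (2 ^ (n + 3)) * qx A x := by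
  refine (swap_lemma (SE A x α) (SE_meas hA x α) (fun t h hm => ⟨hm.1, hm.2.1⟩) _
    (fun h => ENNReal.ofReal (‖DD A x h‖ / 2)) ?_ ?_ (n + 1)).trans ?_
  · have := (DD_continuous' hA x).measurable
    fun_prop
  · intro h
    have hα0 : 0 < α := by linarith
    calc volume {t : ℝ | (t, h) ∈ SE A x α} ≤ volume (closedBall (rho A x h / α) (‖DD A x h‖ / 4)) := by
          apply measure_mono
          intro t ht
          have h3 : |rho A x h - α * t| ≤ ‖DD A x h‖ / 4 := ht.2.2
          rw [mem_closedBall, Real.dist_eq, abs_sub_comm]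
          refine le_trans ?_ h3
          have e : rho A x h - α * t = α * (rho A x h / α - t) := by field_simp
          rw [e, abs_mul, abs_of_pos hα0]
          exact le_mul_of_one_le_left (abs_nonneg _) hα
      _ = _ := by rw [Real.volume_closedBall]; congr 1; ring
  · unfold qx
    rw [← lintegral_const_mul' _ _ (by simp)]
    apply lintegral_mono
    intro h
    simp only [ww]
    rw [enorm_sq_ofReal, ← ENNReal.ofReal_mul (by positivity), ← ENNReal.ofReal_mul (by positivity), ← ENNReal.ofReal_mul (by positivity), ← ENNReal.ofReal_mul (by positivity)]
    refine ENNReal.ofReal_le_ofReal ?_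
    rcases eq_or_ne ‖h‖ 0 with h0 | h0
    · rw [h0]; simp
    · apply le_of_eq; field_simp; ring

/-- constant -/
def cS (n : ℕ) : ℝ≥0∞ := 16 * (ENNReal.ofReal ((2 * n + 3) ^ 2 * 2 ^ n) * volume (closedBall (0 : Eu n) 1) * ENNReal.ofReal (2 ^ (n + 4)) +
  ENNReal.ofReal (4 * 8 ^ n) * volume (closedBall (0 : Eu n) 1) * ENNReal.ofReal (2 ^ (n + 3)) +
  ENNReal.ofReal (4 * 8 ^ n) * volume (closedBall (0 : Eu n) 1) * ENNReal.ofReal (2 ^ (n + 3)))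

lemma cS_lt_top : cS n < ⊤ := by
  have h : volume (closedBall (0 : Eu n) 1) < ⊤ := measure_closedBall_lt_top
  unfold cS
  finiteness

lemma termE {A : Eu n → Eu m} (hA : LipschitzWith (1 / 4) A) (x : Eu n) {t α : ℝ} (ht : 0 < t) :
    (ENNReal.ofReal (2 / t ^ n) * volume (UU n t ∩ EE A x (α * t))) ^ 2 * ENNReal.ofReal t⁻¹ ≤
      ENNReal.ofReal (4 * 8 ^ n) * volume (closedBall (0 : Eu n) 1) *
      (ENNReal.ofReal ((t ^ (n + 1))⁻¹) *
        ∫⁻ h in {h | (t, h) ∈ SE A x α}, ENNReal.ofReal (8 * ‖DD A x h‖ / ‖h‖)) := by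
  have e : {h | (t, h) ∈ SE A x α} = UU n t ∩ EE A x (α * t) := by
    ext h; simp only [SE, UU, EE, mem_inter_iff, mem_ofPred_eq]; tauto
  rw [e]
  have h1 := vol_bound hA x ht (α * t)
  rw [vol_cB (by positivity)] at h1
  set I := ∫⁻ h in UU n t ∩ EE A x (α * t), ENNReal.ofReal (8 * ‖DD A x h‖ / ‖h‖)
  set V := volume (UU n t ∩ EE A x (α * t))
  set B := volume (closedBall (0 : Eu n) 1)
  calc (ENNReal.ofReal (2 / t ^ n) * V) ^ 2 * ENNReal.ofReal t⁻¹
      = ENNReal.ofReal ((2 / t ^ n) ^ 2) * ENNReal.ofReal t⁻¹ * V ^ 2 := by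
        rw [mul_pow, ENNReal.ofReal_pow (by positivity)]; ring
    _ ≤ ENNReal.ofReal ((2 / t ^ n) ^ 2) * ENNReal.ofReal t⁻¹ *
        (ENNReal.ofReal (4 ^ n) * (ENNReal.ofReal ((2 * t) ^ n) * B) * I) := by gcongr
    _ = (ENNReal.ofReal ((2 / t ^ n) ^ 2) * ENNReal.ofReal t⁻¹ * ENNReal.ofReal (4 ^ n) *
          ENNReal.ofReal ((2 * t) ^ n)) * B * I := by ring
    _ = (ENNReal.ofReal (4 * 8 ^ n) * ENNReal.ofReal ((t ^ (n + 1))⁻¹)) * B * I := by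
        congr 2
        rw [← ENNReal.ofReal_mul (by positivity), ← ENNReal.ofReal_mul (by positivity),
          ← ENNReal.ofReal_mul (by positivity), ← ENNReal.ofReal_mul (by positivity)]
        congr 1
        rw [show (8 : ℝ) = 4 * 2 by norm_num, mul_pow, mul_pow]
        field_simp
        ring
    _ = _ := by ring

lemma termU {A : Eu n → Eu m} (hA : LipschitzWith (1 / 4) A) (x : Eu n) {t : ℝ} (ht : 0 < t) :
    (ENNReal.ofReal ((2 * n + 3) / t ^ (n + 1)) * ∫⁻ h in UU n t, ‖DD A x h‖ₑ) ^ 2 * ENNReal.ofReal t⁻¹ ≤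
      ENNReal.ofReal ((2 * n + 3) ^ 2 * 2 ^ n) * volume (closedBall (0 : Eu n) 1) *
      (ENNReal.ofReal ((t ^ (n + 3))⁻¹) * ∫⁻ h in {h | (t, h) ∈ SU n}, ‖DD A x h‖ₑ ^ 2) := by
  have e : {h | (t, h) ∈ SU n} = UU n t := by
    ext h; simp only [SU, UU, mem_ofPred_eq]; tauto
  rw [e]
  have h1 := cs_set (ν := volume) (DD_continuous' hA.continuous x).enorm.measurable (UU n t)
  have h2 : volume (UU n t) ≤ ENNReal.ofReal ((2 * t) ^ n) * volume (closedBall (0 : Eu n) 1) := by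
    rw [← vol_cB (by positivity)]
    apply measure_mono
    intro h hh
    rw [mem_closedBall_zero_iff]; exact hh.2
  set I := ∫⁻ h in UU n t, ‖DD A x h‖ₑ ^ 2
  set J := ∫⁻ h in UU n t, ‖DD A x h‖ₑ
  set B := volume (closedBall (0 : Eu n) 1)
  calc (ENNReal.ofReal ((2 * n + 3) / t ^ (n + 1)) * J) ^ 2 * ENNReal.ofReal t⁻¹
      = ENNReal.ofReal (((2 * n + 3) / t ^ (n + 1)) ^ 2) * ENNReal.ofReal t⁻¹ * J ^ 2 := by
        rw [mul_pow, ENNReal.ofReal_pow (by positivity)]; ring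
    _ ≤ ENNReal.ofReal (((2 * n + 3) / t ^ (n + 1)) ^ 2) * ENNReal.ofReal t⁻¹ *
        ((ENNReal.ofReal ((2 * t) ^ n) * B) * I) := by
        have h3 := h1.trans (mul_le_mul_left h2 I)
        gcongr
    _ = (ENNReal.ofReal (((2 * n + 3) / t ^ (n + 1)) ^ 2) * ENNReal.ofReal t⁻¹ *
          ENNReal.ofReal ((2 * t) ^ n)) * B * I := by ring
    _ = (ENNReal.ofReal ((2 * n + 3) ^ 2 * 2 ^ n) * ENNReal.ofReal ((t ^ (n + 3))⁻¹)) * B * I := by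
        congr 2
        rw [← ENNReal.ofReal_mul (by positivity), ← ENNReal.ofReal_mul (by positivity),
          ← ENNReal.ofReal_mul (by positivity)]
        congr 1
        rw [mul_pow]
        field_simp
        ring
    _ = _ := by ring

lemma S_le {A : Eu n → Eu m} (hA : LipschitzWith (1 / 4) A) (x : Eu n) :
    ∫⁻ t in Ioi (0 : ℝ), ENNReal.ofReal (‖TT (kap n t) A x‖ ^ 2 / t) ≤ cS n * qx A x := by
  have hc := hA.continuous
  have hDm : Measurable fun h => ENNReal.ofReal (8 * ‖DD A x h‖ / ‖h‖) := by
    have := (DD_continuous' hc x).measurable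
    fun_prop
  set B := volume (closedBall (0 : Eu n) 1) with hB
  set c1 := ENNReal.ofReal ((2 * n + 3) ^ 2 * 2 ^ n) * B with hc1
  set c2 := ENNReal.ofReal (4 * 8 ^ n) * B with hc2
  set F1 : ℝ → ℝ≥0∞ := fun t => ENNReal.ofReal ((t ^ (n + 3))⁻¹) * ∫⁻ h in {h | (t, h) ∈ SU n}, ‖DD A x h‖ₑ ^ 2 with hF1
  set F2 : ℝ → ℝ → ℝ≥0∞ := fun α t => ENNReal.ofReal ((t ^ (n + 1))⁻¹) *
        ∫⁻ h in {h | (t, h) ∈ SE A x α}, ENNReal.ofReal (8 * ‖DD A x h‖ / ‖h‖) with hF2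
  have m1 : Measurable F1 := Measurable.mul (by fun_prop)
    (slice_meas _ SU_meas _ ((DD_continuous' hc x).enorm.measurable.pow_const 2))
  have m2 : ∀ α, Measurable (F2 α) := fun α => Measurable.mul (by fun_prop)
    (slice_meas _ (SE_meas hc x α) _ hDm)
  have key : ∀ t ∈ Ioi (0 : ℝ), ENNReal.ofReal (‖TT (kap n t) A x‖ ^ 2 / t) ≤
      16 * ((c1 * F1 t + c2 * F2 1 t) + c2 * F2 2 t) := by
    intro t ht
    have ht : 0 < t := ht
    rw [div_eq_mul_inv, ENNReal.ofReal_mul (by positivity), ← enorm_sq_ofReal]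
    have b := TT_kap_bound hA x ht
    have u := termU hA x ht
    have v1 := termE hA x (α := 1) ht
    have v2 := termE hA x (α := 2) ht
    rw [one_mul] at v1
    have b2 := (pow_le_pow_left₀ zero_le b 2).trans (sq_add3_le _ _ _)
    refine (mul_le_mul_left b2 (ENNReal.ofReal t⁻¹)).trans ?_
    rw [mul_assoc, add_mul, add_mul]
    exact mul_le_mul_right (add_le_add (add_le_add u v1) v2) 16
  refine (setLIntegral_mono' measurableSet_Ioi key).trans ?_
  have mm1 : Measurable fun t => c1 * F1 t := m1.const_mul _
  have mm2 : ∀ α, Measurable fun t => c2 * F2 α t := fun α => (m2 α).const_mul _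
  have mm3 : Measurable fun t => c1 * F1 t + c2 * F2 1 t := mm1.add (mm2 1)
  rw [lintegral_const_mul' _ _ (by simp), lintegral_add_left mm3, lintegral_add_left mm1,
    lintegral_const_mul _ m1, lintegral_const_mul _ (m2 1), lintegral_const_mul _ (m2 2)]
  have t1 := term1 hc x
  have t2 := term2 hc x (α := 1) le_rfl
  have t3 := term2 hc x (α := 2) (by norm_num)
  calc _ ≤ 16 * ((c1 * (ENNReal.ofReal (2 ^ (n + 4)) * qx A x) + c2 * (ENNReal.ofReal (2 ^ (n + 3)) * qx A x)) +
        c2 * (ENNReal.ofReal (2 ^ (n + 3)) * qx A x)) := by gcongr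
    _ = _ := by unfold cS; ring

lemma QQ_eq {A : Eu n → Eu m} (hA : Continuous A) : ∫⁻ x, qx A x = QQ A := by
  unfold qx QQ q2
  have hm : Measurable fun p : Eu n × Eu n => ‖DD A p.1 p.2‖ₑ ^ 2 * ww p.2 :=
    ((DD_continuous hA).enorm.measurable.pow_const 2).mul (ww_measurable.comp measurable_snd)
  rw [lintegral_lintegral_swap hm.aemeasurable]
  congr 1; ext h
  rw [lintegral_mul_const]
  have : Continuous fun x => DD A x h := by unfold DD; fun_prop
  exact this.enorm.measurable.pow_const 2

lemma S_le_grad {A : Eu n → Eu m} (hA : LipschitzWith (1 / 4) A) (hs : HasCompactSupport A) :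
    ∫⁻ x, ∫⁻ t in Ioi (0 : ℝ), ENNReal.ofReal (‖TT (kap n t) A x‖ ^ 2 / t) ≤
      cS n * cQ n * gradL2 n m A ^ 2 := by
  refine (lintegral_mono fun x => S_le hA x).trans ?_
  rw [lintegral_const_mul' _ _ cS_lt_top.ne, QQ_eq hA.continuous, mul_assoc]
  gcongr
  exact QQ_le hA hs

end P5

section P6
open Filter Topology

variable {n m : ℕ}

lemma overlap {a b y : ℝ} (ha : 0 < a) (N : ℕ) (hb : b < 2 ^ (N + 1) * a) :
    ∑' j : ℤ, (if a ≤ 2 ^ j * y ∧ 2 ^ j * y ≤ b then (1 : ℝ≥0∞) else 0) ≤ 2 * N + 1 := by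
  by_cases hex : ∃ j0 : ℤ, a ≤ 2 ^ j0 * y ∧ 2 ^ j0 * y ≤ b
  · obtain ⟨j0, h1, h2⟩ := hex
    have key : ∀ i j : ℤ, a ≤ 2 ^ i * y → 2 ^ j * y ≤ b → j - i ≤ N := by
      intro i j hi hj
      have hy : 0 < y := by
        have : 0 < (2 : ℝ) ^ i * y := ha.trans_le hi
        exact (mul_pos_iff_of_pos_left (by positivity)).1 this
      have h3 : (2 : ℝ) ^ j * y < (2 : ℝ) ^ (N + 1) * (2 ^ i * y) := hj.trans_lt (hb.trans_le (by gcongr))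
      have h4 : (2 : ℝ) ^ j < 2 ^ ((N : ℤ) + 1 + i) := by
        rw [← mul_assoc] at h3
        have := lt_of_mul_lt_mul_right h3 hy.le
        rwa [zpow_add₀ (by norm_num), ← Nat.cast_succ, zpow_natCast]
      have := (zpow_lt_zpow_iff_right₀ (by norm_num : (1 : ℝ) < 2)).1 h4
      omega
    rw [tsum_eq_sum (s := Finset.Icc (j0 - N) (j0 + N))]
    · calc _ ≤ ∑ j ∈ Finset.Icc (j0 - (N : ℤ)) (j0 + N), (1 : ℝ≥0∞) := by
            apply Finset.sum_le_sum
            intro j _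
            split_ifs <;> simp
        _ = _ := by
            have : (j0 + (N : ℤ) + 1 - (j0 - N)).toNat = 2 * N + 1 := by omega
            simp [this]
    · intro j hj
      rw [if_neg]
      rintro ⟨h3, h4⟩
      apply hj
      have := key j0 j h1 h4
      have := key j j0 h3 h2
      rw [Finset.mem_Icc]; omega
  · push Not at hex
    rw [ENNReal.tsum_eq_zero.2]
    · exact zero_le
    · intro j
      rw [if_neg]
      rintro ⟨h3, h4⟩
      exact absurd (hex j h3) (not_lt.2 h4)

/-- Admissible profile. -/
structure Prof (p : ℝ → ℝ) : Prop where
  smooth : ContDiff ℝ 1 p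
  anti : ∀ a b, 0 ≤ a → a ≤ b → p b ≤ p a
  one : ∀ s, |s| < 1 / 2 → p s = 1
  zero : ∀ s, 2 ≤ |s| → p s = 0

/-- smooth kernel -/
def phi (n : ℕ) (p : ℝ → ℝ) (r : ℝ) : ℝ := (p r - p (2 * r)) * (r ^ (n + 1))⁻¹

/-- rescaled smooth kernel -/
def phiS (n : ℕ) (p : ℝ → ℝ) (l : ℝ) (r : ℝ) : ℝ := l ^ (n + 1) * phi n p (l * r)

lemma phiS_eq (p : ℝ → ℝ) {l : ℝ} (hl : 0 < l) (r : ℝ) :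
    phiS n p l r = (p (l * r) - p (2 * (l * r))) * (r ^ (n + 1))⁻¹ := by
  unfold phiS phi
  rw [mul_pow, mul_inv]
  field_simp

lemma Prof.deriv_bdd {p : ℝ → ℝ} (hp : Prof p) : ∃ M : ℝ, 0 ≤ M ∧ ∀ s, |deriv p s| ≤ M := by
  have hc : Continuous (deriv p) := hp.smooth.continuous_deriv_one
  have hs : HasCompactSupport p := by
    apply HasCompactSupport.intro (isCompact_closedBall (0 : ℝ) 2)
    intro s hs
    apply hp.zero
    rw [mem_closedBall_zero_iff, Real.norm_eq_abs, not_le] at hs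
    exact hs.le
  obtain ⟨M, hM⟩ := hs.deriv.exists_bound_of_continuous hc
  exact ⟨M, (norm_nonneg _).trans (hM 0), hM⟩

lemma Prof.deriv_zero {p : ℝ → ℝ} (hp : Prof p) {s : ℝ} (hs : |s| < 1 / 2 ∨ 2 < |s|) : deriv p s = 0 := by
  rcases hs with hs | hs
  · have : p =ᶠ[𝓝 s] fun _ => 1 := by
      filter_upwards [(isOpen_lt continuous_abs continuous_const).mem_nhds hs] with u hu
      exact hp.one u hu
    rw [this.deriv_eq]; simp
  · have : p =ᶠ[𝓝 s] fun _ => 0 := by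
      filter_upwards [(isOpen_lt continuous_const continuous_abs).mem_nhds hs] with u hu
      exact hp.zero u hu.le
    rw [this.deriv_eq]; simp

lemma kap_swap {t r : ℝ} : kap n t r = (Ico (r / 2) r).indicator (fun _ => (r ^ (n + 1))⁻¹) t := by
  unfold kap
  by_cases h : r ∈ Ioc t (2 * t)
  · have h' : t ∈ Ico (r / 2) r := ⟨by linarith [h.2], h.1⟩
    rw [indicator_of_mem h, indicator_of_mem h']
  · have h' : t ∉ Ico (r / 2) r := fun h' => h ⟨h'.2, by linarith [h'.1]⟩
    rw [indicator_of_notMem h, indicator_of_notMem h']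

/-- integration range -/
def II (l : ℝ) : Set ℝ := Icc (1 / (4 * l)) (1 / l)

lemma II_meas (l : ℝ) : MeasurableSet (II l) := measurableSet_Icc

lemma phiS_rep {p : ℝ → ℝ} (hp : Prof p) {l : ℝ} (hl : 0 < l) {r : ℝ} (hr : 0 ≤ r) :
    phiS n p l r = ∫ t in II l, (-(2 * l) * deriv p (2 * l * t)) * kap n t r := by
  have hc : Continuous (deriv p) := hp.smooth.continuous_deriv_one
  have h1 : ∫ t in II l, (-(2 * l) * deriv p (2 * l * t)) * kap n t r =
      ∫ t, (-(2 * l) * deriv p (2 * l * t)) * kap n t r := by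
    rw [setIntegral_eq_integral_of_forall_compl_eq_zero]
    intro t ht
    by_cases hk : r ∈ Ioc t (2 * t)
    · have ht0 : 0 < t := by linarith [hk.1, hk.2]
      rw [hp.deriv_zero]
      · simp
      · rw [abs_of_pos (by positivity)]
        by_contra hcon
        push Not at hcon
        apply ht
        constructor
        · rw [div_le_iff₀ (by positivity)]; nlinarith [hcon.1]
        · rw [le_div_iff₀ hl]; nlinarith [hcon.2]
    · have : kap n t r = 0 := indicator_of_notMem hk _
      rw [this, mul_zero]
  rw [h1, phiS_eq p hl]
  have h2 : ∀ t, (-(2 * l) * deriv p (2 * l * t)) * kap n t r =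
      (Ico (r / 2) r).indicator (fun t => (-(2 * l) * deriv p (2 * l * t)) * (r ^ (n + 1))⁻¹) t := by
    intro t
    rw [kap_swap]
    by_cases h : t ∈ Ico (r / 2) r
    · rw [indicator_of_mem h, indicator_of_mem h]
    · rw [indicator_of_notMem h, indicator_of_notMem h, mul_zero]
  simp only [h2]
  rw [integral_indicator measurableSet_Ico, integral_mul_const, integral_Ico_eq_integral_Ioc,
    ← intervalIntegral.integral_of_le (by linarith)]
  congr 1
  have h3 : ∀ t, HasDerivAt (fun t => -p (2 * l * t)) (-(2 * l) * deriv p (2 * l * t)) t := by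
    intro t
    have a1 : HasDerivAt p (deriv p (2 * l * t)) (2 * l * t) :=
      (hp.smooth.differentiable one_ne_zero _).hasDerivAt
    have a2 : HasDerivAt (fun t : ℝ => 2 * l * t) (2 * l) t := by
      simpa using (hasDerivAt_id t).const_mul (2 * l)
    have := (a1.comp t a2).neg
    refine this.congr_deriv ?_
    ring
  rw [intervalIntegral.integral_eq_sub_of_hasDerivAt (fun t _ => h3 t)]
  · rw [show 2 * l * (r / 2) = l * r by ring, mul_assoc]; ring
  · apply Continuous.intervalIntegrable
    exact continuous_const.mul (hc.comp (by fun_prop))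

lemma kap_joint {A : Eu n → Eu m} (hA : Continuous A) (x : Eu n) :
    Measurable fun q : Eu n × ℝ => kap n q.2 (rho A x q.1) := by
  have hr : Measurable fun q : Eu n × ℝ => rho A x q.1 :=
    (rho_continuous' hA x).measurable.comp measurable_fst
  have e : (fun q : Eu n × ℝ => kap n q.2 (rho A x q.1)) =
    {q : Eu n × ℝ | q.2 < rho A x q.1 ∧ rho A x q.1 ≤ 2 * q.2}.indicator
      fun q => ((rho A x q.1) ^ (n + 1))⁻¹ := by
    ext q
    unfold kap indicator
    rfl
  rw [e]
  apply Measurable.indicator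
  · fun_prop
  · exact (measurableSet_lt measurable_snd hr).inter (measurableSet_le hr (by fun_prop))

lemma TT_phiS {A : Eu n → Eu m} {K : ℝ≥0} (hA : LipschitzWith K A) {p : ℝ → ℝ} (hp : Prof p) {l : ℝ} (hl : 0 < l)
    (x : Eu n) :
    TT (phiS n p l) A x = ∫ t in II l, (-(2 * l) * deriv p (2 * l * t)) • TT (kap n t) A x := by
  have hc : Continuous (deriv p) := hp.smooth.continuous_deriv_one
  obtain ⟨M, hM0, hM⟩ := hp.deriv_bdd
  have hcont := hA.continuous
  have hII : MeasurableSet (II l) := measurableSet_Icc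
  have e1 : ∀ h, phiS n p l (rho A x h) • (A (x + h) - A x) =
      ∫ t in II l, ((-(2 * l) * deriv p (2 * l * t)) * kap n t (rho A x h)) • (A (x + h) - A x) := by
    intro h
    rw [phiS_rep hp hl (rho_nonneg A x h), integral_smul_const]
  unfold TT
  simp only [e1]
  rw [integral_integral_swap]
  · congr 1; ext1 t
    rw [← integral_smul]
    congr 1; ext1 h
    rw [mul_smul]
  · set B : ℝ := 2 * l * M * ((1 / (4 * l)) ^ (n + 1))⁻¹ * (K * (2 / l)) with hB
    have hBi : Integrable (fun q : Eu n × ℝ => (closedBall (0 : Eu n) (2 / l) ×ˢ univ).indicator (fun _ => B) q)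
        (volume.prod (volume.restrict (II l))) := by
      refine (integrable_indicator_iff (measurableSet_closedBall.prod MeasurableSet.univ)).2 ?_
      refine integrableOn_const ?_ (by finiteness)
      rw [Measure.prod_prod]
      · have h1 : volume (closedBall (0 : Eu n) (2 / l)) < ⊤ := measure_closedBall_lt_top
        have h2 : volume (II l) < ⊤ := measure_Icc_lt_top
        simp only [Measure.restrict_apply MeasurableSet.univ, univ_inter]
        exact (ENNReal.mul_lt_top h1 h2).ne
    refine hBi.mono' ?_ ?_
    · apply Measurable.aestronglyMeasurable
      have k := kap_joint (n := n) hcont x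
      have k2 : Measurable fun q : Eu n × ℝ => -(2 * l) * deriv p (2 * l * q.2) := by
        have := hc.measurable
        fun_prop
      have k3 : Measurable fun q : Eu n × ℝ => A (x + q.1) - A x := by
        have := hcont.measurable
        fun_prop
      exact (k2.mul k).smul k3
    · have hae : ∀ᵐ q : Eu n × ℝ ∂(volume.prod (volume.restrict (II l))), q.2 ∈ II l := by
        have : ∀ᵐ t ∂(volume.restrict (II l)), t ∈ II l := ae_restrict_mem hII
        exact Measure.quasiMeasurePreserving_snd.ae this
      filter_upwards [hae] with q hq
      obtain ⟨h, t⟩ := q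
      simp only [Function.uncurry] at hq ⊢
      have ht : 0 < t := lt_of_lt_of_le (by positivity) hq.1
      by_cases hk : rho A x h ∈ Ioc t (2 * t)
      · have hh : ‖h‖ ≤ 2 / l := by
          calc ‖h‖ ≤ 2 * t := (norm_le_rho A x h).trans hk.2
            _ ≤ 2 * (1 / l) := by gcongr; exact hq.2
            _ = _ := by ring
        have hmem : (h, t) ∈ closedBall (0 : Eu n) (2 / l) ×ˢ (univ : Set ℝ) :=
          ⟨mem_closedBall_zero_iff.2 hh, mem_univ _⟩
        rw [indicator_of_mem hmem, norm_smul, norm_mul, norm_mul, Real.norm_eq_abs, Real.norm_eq_abs, abs_neg, abs_of_pos (by positivity : 0 < 2 * l),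
          Real.norm_of_nonneg (kap_nonneg ht _)]
        rw [hB]
        gcongr
        · exact kap_nonneg ht _
        · exact hM _
        · refine (kap_le ht _).trans ?_
          gcongr
          exact hq.1
        · refine (v_le hA x h).trans ?_
          gcongr
      · have : kap n t (rho A x h) = 0 := indicator_of_notMem hk _
        rw [this, mul_zero, zero_smul, norm_zero]
        apply indicator_nonneg
        intro _ _
        positivity

lemma TT_kap_meas {A : Eu n → Eu m} (hA : Continuous A) (x : Eu n) :
    Measurable fun t => TT (kap n t) A x := by
  unfold TT
  have k := kap_joint (n := n) hA x
  have k3 : Measurable fun q : Eu n × ℝ => A (x + q.1) - A x := by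
    have := hA.measurable
    fun_prop
  have : Measurable fun q : ℝ × Eu n => kap n q.1 (rho A x q.2) • (A (x + q.2) - A x) :=
    (k.smul k3).comp measurable_swap
  exact (this.stronglyMeasurable.integral_prod_right').measurable

lemma TT_phiS_le {A : Eu n → Eu m} {K : ℝ≥0} (hA : LipschitzWith K A) {p : ℝ → ℝ} (hp : Prof p) {M : ℝ} (hM : ∀ s, |deriv p s| ≤ M)
    {l : ℝ} (hl : 0 < l) (x : Eu n) :
    ‖TT (phiS n p l) A x‖ₑ ^ 2 ≤ ENNReal.ofReal (4 * M ^ 2) *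
      ∫⁻ t in II l, ENNReal.ofReal (‖TT (kap n t) A x‖ ^ 2 / t) := by
  have hM0 : 0 ≤ M := (abs_nonneg _).trans (hM 0)
  have hm := TT_kap_meas hA.continuous x
  have h1 : ‖TT (phiS n p l) A x‖ₑ ≤ ENNReal.ofReal (2 * l * M) * ∫⁻ t in II l, ‖TT (kap n t) A x‖ₑ := by
    rw [TT_phiS hA hp hl, ← lintegral_const_mul' _ _ (by simp)]
    refine (enorm_integral_le_lintegral_enorm _).trans ?_
    refine lintegral_mono fun t => ?_
    simp only [enorm_smul]
    gcongr
    rw [← ofReal_norm]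
    apply ENNReal.ofReal_le_ofReal
    rw [norm_mul, Real.norm_eq_abs, Real.norm_eq_abs, abs_neg, abs_of_pos (by positivity : 0 < 2 * l)]
    gcongr
    exact hM _
  have h2 := cs_set (ν := volume) hm.enorm (II l)
  have h3 : volume (II l) ≤ ENNReal.ofReal (1 / l) := by
    unfold II
    rw [Real.volume_Icc]
    apply ENNReal.ofReal_le_ofReal
    have : 0 < 1 / (4 * l) := by positivity
    linarith
  calc ‖TT (phiS n p l) A x‖ₑ ^ 2 ≤ (ENNReal.ofReal (2 * l * M) * ∫⁻ t in II l, ‖TT (kap n t) A x‖ₑ) ^ 2 := by gcongr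
    _ = ENNReal.ofReal (2 * l * M) ^ 2 * (∫⁻ t in II l, ‖TT (kap n t) A x‖ₑ) ^ 2 := by rw [mul_pow]
    _ ≤ ENNReal.ofReal (2 * l * M) ^ 2 * (volume (II l) * ∫⁻ t in II l, ‖TT (kap n t) A x‖ₑ ^ 2) := by gcongr
    _ ≤ ENNReal.ofReal (2 * l * M) ^ 2 * (ENNReal.ofReal (1 / l) * ∫⁻ t in II l, ‖TT (kap n t) A x‖ₑ ^ 2) := by gcongr
    _ = ENNReal.ofReal (4 * M ^ 2) * ∫⁻ t in II l, ENNReal.ofReal l * ‖TT (kap n t) A x‖ₑ ^ 2 := by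
        rw [lintegral_const_mul' _ _ (by simp), ← mul_assoc, ← mul_assoc]
        congr 1
        rw [← ENNReal.ofReal_pow (by positivity), ← ENNReal.ofReal_mul (by positivity), ← ENNReal.ofReal_mul (by positivity)]
        congr 1; field_simp; ring
    _ ≤ _ := by
        refine mul_le_mul_right ?_ _
        apply setLIntegral_mono' measurableSet_Icc
        intro t ht
        have ht0 : 0 < t := lt_of_lt_of_le (by positivity) ht.1
        rw [enorm_sq_ofReal, ← ENNReal.ofReal_mul hl.le]
        apply ENNReal.ofReal_le_ofReal
        rw [mul_comm, div_eq_mul_inv]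
        gcongr
        rw [le_inv_comm₀ hl ht0]
        simpa using ht.2

lemma sum_le_S {A : Eu n → Eu m} {K : ℝ≥0} (hA : LipschitzWith K A) {p : ℝ → ℝ} (hp : Prof p) {M : ℝ} (hM : ∀ s, |deriv p s| ≤ M)
    (x : Eu n) :
    ∑' j : ℤ, ‖TT (phiS n p (2 ^ j)) A x‖ₑ ^ 2 ≤ ENNReal.ofReal (4 * M ^ 2) * 5 *
      ∫⁻ t in Ioi (0 : ℝ), ENNReal.ofReal (‖TT (kap n t) A x‖ ^ 2 / t) := by
  have hm := TT_kap_meas hA.continuous x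
  have hFm : Measurable fun t => ENNReal.ofReal (‖TT (kap n t) A x‖ ^ 2 / t) := by fun_prop
  have hsub : ∀ j : ℤ, II (2 ^ j) ⊆ Ioi 0 := by
    intro j t ht
    exact lt_of_lt_of_le (by positivity) ht.1
  calc ∑' j : ℤ, ‖TT (phiS n p (2 ^ j)) A x‖ₑ ^ 2
      ≤ ∑' j : ℤ, ENNReal.ofReal (4 * M ^ 2) * ∫⁻ t in II (2 ^ j), ENNReal.ofReal (‖TT (kap n t) A x‖ ^ 2 / t) :=
        ENNReal.tsum_le_tsum fun j => TT_phiS_le hA hp hM (by positivity) x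
    _ = ENNReal.ofReal (4 * M ^ 2) * ∑' j : ℤ, ∫⁻ t in II (2 ^ j), ENNReal.ofReal (‖TT (kap n t) A x‖ ^ 2 / t) := ENNReal.tsum_mul_left
    _ = ENNReal.ofReal (4 * M ^ 2) * ∑' j : ℤ, ∫⁻ t in Ioi (0 : ℝ), (II (2 ^ j)).indicator (fun t => ENNReal.ofReal (‖TT (kap n t) A x‖ ^ 2 / t)) t := by
        congr 2; ext j
        rw [lintegral_indicator (II_meas _), Measure.restrict_restrict (II_meas _), inter_eq_left.2 (hsub j)]
    _ = ENNReal.ofReal (4 * M ^ 2) * ∫⁻ t in Ioi (0 : ℝ), ∑' j : ℤ, (II (2 ^ j)).indicator (fun t => ENNReal.ofReal (‖TT (kap n t) A x‖ ^ 2 / t)) t := by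
        rw [lintegral_tsum]
        intro j
        exact (hFm.indicator measurableSet_Icc).aemeasurable
    _ ≤ ENNReal.ofReal (4 * M ^ 2) * ∫⁻ t in Ioi (0 : ℝ), 5 * ENNReal.ofReal (‖TT (kap n t) A x‖ ^ 2 / t) := by
        gcongr with t
        calc ∑' j : ℤ, (II (2 ^ j)).indicator (fun t => ENNReal.ofReal (‖TT (kap n t) A x‖ ^ 2 / t)) t
            = ∑' j : ℤ, (if (1 / 4 : ℝ) ≤ 2 ^ j * t ∧ 2 ^ j * t ≤ 1 then (1 : ℝ≥0∞) else 0) * ENNReal.ofReal (‖TT (kap n t) A x‖ ^ 2 / t) := by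
              congr 1; ext j
              have hj : (0 : ℝ) < 2 ^ j := by positivity
              have : t ∈ II (2 ^ j) ↔ (1 / 4 : ℝ) ≤ 2 ^ j * t ∧ 2 ^ j * t ≤ 1 := by
                unfold II
                rw [mem_Icc, div_le_iff₀ (by positivity), le_div_iff₀ hj]
                constructor <;> rintro ⟨h1, h2⟩ <;> constructor <;> linarith
              by_cases ht : t ∈ II (2 ^ j)
              · rw [indicator_of_mem ht, if_pos (this.1 ht), one_mul]
              · rw [indicator_of_notMem ht, if_neg (mt this.2 ht), zero_mul]
          _ ≤ _ := by
              rw [ENNReal.tsum_mul_right]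
              gcongr
              refine (overlap (by norm_num) 2 (by norm_num)).trans ?_
              norm_num
    _ = _ := by rw [lintegral_const_mul' _ _ (by simp)]; ring

end P6

section P7
open Filter Topology

variable {n m : ℕ}

lemma phi_small {p : ℝ → ℝ} (hp : Prof p) {r : ℝ} (hr : |r| < 1 / 4) : phi n p r = 0 := by
  unfold phi
  rw [hp.one r (by linarith), hp.one (2 * r) (by rw [abs_mul, abs_two]; linarith)]; simp

lemma phi_large {p : ℝ → ℝ} (hp : Prof p) {r : ℝ} (hr : 2 ≤ |r|) : phi n p r = 0 := by
  unfold phi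
  rw [hp.zero r hr, hp.zero (2 * r) (by rw [abs_mul, abs_two]; linarith)]; simp

lemma phi_nonneg {p : ℝ → ℝ} (hp : Prof p) {r : ℝ} (hr : 0 ≤ r) : 0 ≤ phi n p r := by
  unfold phi
  have := hp.anti r (2 * r) hr (by linarith)
  exact mul_nonneg (by linarith) (by positivity)

lemma phi_smooth {p : ℝ → ℝ} (hp : Prof p) : ContDiff ℝ 1 (phi n p) := by
  rw [contDiff_iff_contDiffAt]
  intro r
  by_cases hr : r = 0
  · subst hr
    have : phi n p =ᶠ[𝓝 0] fun _ => 0 := by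
      have h0 : |(0 : ℝ)| < 1 / 4 := by norm_num
      filter_upwards [(isOpen_lt continuous_abs continuous_const).mem_nhds h0] with u hu
      exact phi_small hp hu
    exact contDiffAt_const.congr_of_eventuallyEq this
  · unfold phi
    refine ContDiffAt.mul ?_ ?_
    · have h1 := hp.smooth
      exact (h1.sub (h1.comp (contDiff_const.mul contDiff_id))).contDiffAt
    · exact ((contDiff_id.pow (n + 1)).contDiffAt).inv (pow_ne_zero _ hr)

lemma phi_supp {p : ℝ → ℝ} (hp : Prof p) : HasCompactSupport (phi n p) := by
  apply HasCompactSupport.intro (isCompact_closedBall (0 : ℝ) 2)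
  intro s hs
  apply phi_large hp
  rw [mem_closedBall_zero_iff, Real.norm_eq_abs, not_le] at hs
  exact hs.le

lemma phi_lip {p : ℝ → ℝ} (hp : Prof p) : ∃ Λ : ℝ≥0, LipschitzWith Λ (phi n p) :=
  (phi_smooth hp).lipschitzWith_of_hasCompactSupport (phi_supp hp) one_ne_zero

lemma phi_bdd {p : ℝ → ℝ} (hp : Prof p) : ∃ M : ℝ, ∀ r, |phi n p r| ≤ M :=
  (phi_supp hp).exists_bound_of_continuous (phi_smooth hp).continuous

lemma phiS_cont {p : ℝ → ℝ} (hp : Prof p) (l : ℝ) : Continuous (phiS n p l) :=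
  continuous_const.mul ((phi_smooth hp).continuous.comp (by fun_prop))

lemma phiS_int {A : Eu n → Eu m} {K : ℝ≥0} (hA : LipschitzWith K A) {p : ℝ → ℝ} (hp : Prof p) {l : ℝ}
    (hl : 0 < l) (x : Eu n) : Integrable fun h => phiS n p l (rho A x h) • (A (x + h) - A x) := by
  obtain ⟨M, hM⟩ := phi_bdd (n := n) hp
  refine TT_int hA (phiS_cont hp l).measurable (M := l ^ (n + 1) * M) (R := 2 / l) ?_ ?_ x
  · intro r
    unfold phiS
    rw [abs_mul, abs_of_pos (by positivity)]
    gcongr; exact hM _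
  · intro r hr
    unfold phiS
    have hr0 : 0 < r := lt_trans (by positivity) hr
    rw [phi_large hp, mul_zero]
    rw [abs_of_pos (by positivity)]
    rw [div_lt_iff₀ hl] at hr
    linarith

/-- linear model operator -/
def LL (φ : ℝ → ℝ) (A : Eu n → Eu m) (x : Eu n) : Eu m := ∫ h, φ ‖h‖ • (A (x + h) - A x)

lemma LL_int {A : Eu n → Eu m} {K : ℝ≥0} (hA : LipschitzWith K A) {p : ℝ → ℝ} (hp : Prof p) {l : ℝ}
    (hl : 0 < l) (x : Eu n) : Integrable fun h => phiS n p l ‖h‖ • (A (x + h) - A x) := by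
  have hc : Continuous fun h => phiS n p l ‖h‖ • (A (x + h) - A x) := by
    have h1 := phiS_cont (n := n) hp l
    have h2 := hA.continuous
    fun_prop
  apply hc.integrable_of_hasCompactSupport
  apply HasCompactSupport.intro (isCompact_closedBall (0 : Eu n) (2 / l))
  intro h hh
  rw [mem_closedBall_zero_iff, not_le, div_lt_iff₀ hl] at hh
  unfold phiS
  rw [phi_large hp, mul_zero, zero_smul]
  rw [abs_of_nonneg (by positivity)]
  linarith

/-- region -/
def WW (n : ℕ) (l : ℝ) : Set (Eu n) := {h | 1 / 8 ≤ l * ‖h‖ ∧ l * ‖h‖ ≤ 2}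

lemma WW_meas (l : ℝ) : MeasurableSet (WW n l) := by
  unfold WW
  have h2 : MeasurableSet {h : Eu n | 1 / 8 ≤ l * ‖h‖} := measurableSet_le (by fun_prop) (by fun_prop)
  have h3 : MeasurableSet {h : Eu n | l * ‖h‖ ≤ 2} := measurableSet_le (by fun_prop) (by fun_prop)
  exact h2.inter h3

lemma phiS_lip {p : ℝ → ℝ} {Λ : ℝ≥0} (hΛ : LipschitzWith Λ (phi n p)) {l : ℝ} (hl : 0 < l) (a b : ℝ) :
    |phiS n p l a - phiS n p l b| ≤ Λ * l ^ (n + 2) * |a - b| := by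
  unfold phiS
  have := hΛ.dist_le_mul (l * a) (l * b)
  rw [Real.dist_eq, Real.dist_eq, ← mul_sub, abs_mul, abs_of_pos hl] at this
  rw [← mul_sub, abs_mul, abs_of_pos (by positivity)]
  calc l ^ (n + 1) * |phi n p (l * a) - phi n p (l * b)| ≤ l ^ (n + 1) * (Λ * (l * |a - b|)) := by gcongr
    _ = _ := by ring

lemma err_pt {A : Eu n → Eu m} {K : ℝ≥0} (hK : K ≤ 1 / 4) (hA : LipschitzWith K A) {p : ℝ → ℝ} (hp : Prof p)
    {Λ : ℝ≥0} (hΛ : LipschitzWith Λ (phi n p)) {l : ℝ} (hl : 0 < l) (x h : Eu n) :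
    ‖((phiS n p l (rho A x h) - phiS n p l ‖h‖) • (A (x + h) - A x)) +
      ((phiS n p l (rho A x (-h)) - phiS n p l ‖-h‖) • (A (x + -h) - A x))‖ₑ ≤
    (WW n l).indicator (fun h => ENNReal.ofReal (4 * Λ * K * l ^ (n + 1)) * ‖DD A x h‖ₑ) h := by
  have hK' : (K : ℝ) ≤ 1 / 4 := by exact_mod_cast hK
  have hn0 := norm_nonneg h
  have r1 := abs_le.1 (rho_sub_norm hA x h)
  have r2 := abs_le.1 (rho_sub_norm hA x (-h))
  have r3 := norm_le_rho A x h
  have r4 := norm_le_rho A x (-h)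
  rw [norm_neg] at r2 r4
  have hKh : (K : ℝ) * ‖h‖ ≤ 1 / 4 * ‖h‖ := by gcongr
  by_cases hW : h ∈ WW n l
  · rw [indicator_of_mem hW, ← ofReal_norm, ← ofReal_norm, ← ENNReal.ofReal_mul (by positivity)]
    apply ENNReal.ofReal_le_ofReal
    rw [norm_neg]
    have e : ((phiS n p l (rho A x h) - phiS n p l ‖h‖) • (A (x + h) - A x)) +
      ((phiS n p l (rho A x (-h)) - phiS n p l ‖h‖) • (A (x + -h) - A x)) =
      (phiS n p l (rho A x h) - phiS n p l ‖h‖) • DD A x h +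
      (phiS n p l (rho A x (-h)) - phiS n p l (rho A x h)) • (A (x + -h) - A x) := by
      rw [← v_add]; module
    rw [e]
    refine (norm_add_le _ _).trans ?_
    rw [norm_smul, norm_smul, Real.norm_eq_abs, Real.norm_eq_abs]
    have v2 := v_le hA x (-h)
    rw [norm_neg] at v2
    have s := rho_symm hA x h
    have q1 := phiS_lip hΛ hl (rho A x h) ‖h‖
    have q2 := phiS_lip hΛ hl (rho A x (-h)) (rho A x h)
    rw [abs_sub_comm (rho A x (-h))] at q2
    have q3 := rho_sub_norm hA x h
    calc _ ≤ (Λ * l ^ (n + 2) * (K * ‖h‖)) * ‖DD A x h‖ + (Λ * l ^ (n + 2) * (K * ‖DD A x h‖)) * (K * ‖h‖) := by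
          gcongr
          · exact q1.trans (by gcongr)
          · exact q2.trans (by gcongr)
      _ = (1 + K) * (Λ * K * l ^ (n + 1) * ‖DD A x h‖) * (l * ‖h‖) := by ring
      _ ≤ 2 * (Λ * K * l ^ (n + 1) * ‖DD A x h‖) * 2 := by
          gcongr
          · linarith
          · exact hW.2
      _ = _ := by ring
  · have hz : ∀ r, ‖h‖ ≤ r → r ≤ 5 / 4 * ‖h‖ → phiS n p l r = 0 := by
      intro r h1 h2
      unfold phiS
      have hr0 : 0 ≤ r := hn0.trans h1
      by_cases h3 : 1 / 8 ≤ l * ‖h‖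
      · rw [phi_large hp, mul_zero]
        rw [abs_of_nonneg (by positivity)]
        have : ¬ l * ‖h‖ ≤ 2 := fun h4 => hW ⟨h3, h4⟩
        nlinarith
      · rw [phi_small hp, mul_zero]
        rw [abs_of_nonneg (by positivity)]
        nlinarith
    rw [indicator_of_notMem hW, norm_neg, hz _ r3 (by linarith), hz _ r4 (by linarith), hz ‖h‖ le_rfl (by linarith)]
    simp

/-- constant -/
def cP (n : ℕ) (Λ : ℝ≥0) : ℝ≥0∞ :=
  9 * (ENNReal.ofReal (64 * 4 ^ n * Λ ^ 2) * volume (closedBall (0 : Eu n) 1))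

lemma cP_lt_top (Λ : ℝ≥0) : cP n Λ < ⊤ := by
  have h : volume (closedBall (0 : Eu n) 1) < ⊤ := measure_closedBall_lt_top
  unfold cP
  finiteness

lemma err_le {A : Eu n → Eu m} {K : ℝ≥0} (hK : K ≤ 1 / 4) (hA : LipschitzWith K A) {p : ℝ → ℝ} (hp : Prof p)
    {Λ : ℝ≥0} (hΛ : LipschitzWith Λ (phi n p)) {l : ℝ} (hl : 0 < l) (x : Eu n) :
    ‖TT (phiS n p l) A x - LL (phiS n p l) A x‖ₑ ^ 2 ≤
      ENNReal.ofReal (K ^ 2) * (ENNReal.ofReal (64 * 4 ^ n * Λ ^ 2) * volume (closedBall (0 : Eu n) 1)) *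
      ∫⁻ h in WW n l, ‖DD A x h‖ₑ ^ 2 * ww h := by
  have i1 := phiS_int hA hp hl x
  have i2 := LL_int hA hp hl x
  have hDm := (DD_continuous' hA.continuous x).enorm.measurable
  have h1 : ‖TT (phiS n p l) A x - LL (phiS n p l) A x‖ₑ ≤
      ENNReal.ofReal (4 * Λ * K * l ^ (n + 1)) * ∫⁻ h in WW n l, ‖DD A x h‖ₑ := by
    unfold TT LL
    rw [← integral_sub i1 i2]
    have e : ∀ h, phiS n p l (rho A x h) • (A (x + h) - A x) - phiS n p l ‖h‖ • (A (x + h) - A x) =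
      (phiS n p l (rho A x h) - phiS n p l ‖h‖) • (A (x + h) - A x) := fun h => by rw [sub_smul]
    have i3 := i1.sub i2
    have i4 : Integrable fun h => (phiS n p l (rho A x h) - phiS n p l ‖h‖) • (A (x + h) - A x) :=
      i3.congr (ae_of_all _ e)
    simp only [e]
    refine (symm_bound i4).trans ?_
    refine (lintegral_mono fun h => err_pt hK hA hp hΛ hl x h).trans ?_
    rw [lintegral_indicator (WW_meas l), lintegral_const_mul' _ _ (by simp)]
  have h2 := cs_set (ν := volume) hDm (WW n l)
  have h3 : volume (WW n l) ≤ ENNReal.ofReal ((2 / l) ^ n) * volume (closedBall (0 : Eu n) 1) := by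
    rw [← vol_cB (by positivity)]
    apply measure_mono
    intro h hh
    rw [mem_closedBall_zero_iff, le_div_iff₀ hl, mul_comm]; exact hh.2
  have h4 : ENNReal.ofReal (l ^ (n + 2)) * ∫⁻ h in WW n l, ‖DD A x h‖ₑ ^ 2 ≤
      ENNReal.ofReal (2 ^ (n + 2)) * ∫⁻ h in WW n l, ‖DD A x h‖ₑ ^ 2 * ww h := by
    rw [← lintegral_const_mul' _ _ (by simp), ← lintegral_const_mul' _ _ (by simp)]
    apply setLIntegral_mono' (WW_meas l)
    intro h hh
    rw [mul_comm (‖DD A x h‖ₑ ^ 2), ← mul_assoc]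
    refine mul_le_mul_left ?_ _
    unfold ww
    rw [← ENNReal.ofReal_mul (by positivity)]
    apply ENNReal.ofReal_le_ofReal
    have h0 : 0 < ‖h‖ := by
      by_contra hcon
      have : ‖h‖ = 0 := le_antisymm (not_lt.1 hcon) (norm_nonneg _)
      have h9 := hh.1
      rw [this] at h9; norm_num at h9
    rw [← div_eq_mul_inv, ← div_pow]
    gcongr
    rw [le_div_iff₀ h0]; exact hh.2
  set B := volume (closedBall (0 : Eu n) 1)
  set I := ∫⁻ h in WW n l, ‖DD A x h‖ₑ ^ 2
  set J := ∫⁻ h in WW n l, ‖DD A x h‖ₑ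
  calc ‖TT (phiS n p l) A x - LL (phiS n p l) A x‖ₑ ^ 2
      ≤ (ENNReal.ofReal (4 * Λ * K * l ^ (n + 1)) * J) ^ 2 := by gcongr
    _ = ENNReal.ofReal ((4 * Λ * K * l ^ (n + 1)) ^ 2) * J ^ 2 := by
        rw [mul_pow, ENNReal.ofReal_pow (by positivity)]
    _ ≤ ENNReal.ofReal ((4 * Λ * K * l ^ (n + 1)) ^ 2) * (ENNReal.ofReal ((2 / l) ^ n) * B * I) := by
        have := h2.trans (mul_le_mul_left h3 I)
        gcongr
    _ = (ENNReal.ofReal ((4 * Λ * K * l ^ (n + 1)) ^ 2) * ENNReal.ofReal ((2 / l) ^ n)) * B * I := by ring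
    _ = (ENNReal.ofReal (K ^ 2) * ENNReal.ofReal (16 * Λ ^ 2 * 2 ^ n) * ENNReal.ofReal (l ^ (n + 2))) * B * I := by
        congr 2
        rw [← ENNReal.ofReal_mul (by positivity), ← ENNReal.ofReal_mul (by positivity), ← ENNReal.ofReal_mul (by positivity)]
        congr 1
        rw [div_pow]
        field_simp
        ring
    _ = ENNReal.ofReal (K ^ 2) * ENNReal.ofReal (16 * Λ ^ 2 * 2 ^ n) * B * (ENNReal.ofReal (l ^ (n + 2)) * I) := by ring
    _ ≤ ENNReal.ofReal (K ^ 2) * ENNReal.ofReal (16 * Λ ^ 2 * 2 ^ n) * B *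
        (ENNReal.ofReal (2 ^ (n + 2)) * ∫⁻ h in WW n l, ‖DD A x h‖ₑ ^ 2 * ww h) := mul_le_mul_right h4 _
    _ = ENNReal.ofReal (K ^ 2) * ((ENNReal.ofReal (16 * Λ ^ 2 * 2 ^ n) * ENNReal.ofReal (2 ^ (n + 2))) * B) *
        ∫⁻ h in WW n l, ‖DD A x h‖ₑ ^ 2 * ww h := by ring
    _ = _ := by
        congr 3
        rw [← ENNReal.ofReal_mul (by positivity)]
        congr 1
        rw [show (4 : ℝ) = 2 * 2 by norm_num, mul_pow]; ring

lemma err_sum {A : Eu n → Eu m} {K : ℝ≥0} (hK : K ≤ 1 / 4) (hA : LipschitzWith K A) {p : ℝ → ℝ} (hp : Prof p)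
    {Λ : ℝ≥0} (hΛ : LipschitzWith Λ (phi n p)) (x : Eu n) :
    ∑' j : ℤ, ‖TT (phiS n p (2 ^ j)) A x - LL (phiS n p (2 ^ j)) A x‖ₑ ^ 2 ≤
      ENNReal.ofReal (K ^ 2) * cP n Λ * qx A x := by
  have hDm := (DD_continuous' hA.continuous x).enorm.measurable
  have hGm : Measurable fun h => ‖DD A x h‖ₑ ^ 2 * ww h := (hDm.pow_const 2).mul ww_measurable
  refine (ENNReal.tsum_le_tsum fun j => err_le hK hA hp hΛ (by positivity) x).trans ?_
  rw [ENNReal.tsum_mul_left]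
  have key : ∑' j : ℤ, ∫⁻ h in WW n (2 ^ j), ‖DD A x h‖ₑ ^ 2 * ww h ≤ 9 * qx A x := by
    have e1 : ∀ j : ℤ, ∫⁻ h in WW n (2 ^ j), ‖DD A x h‖ₑ ^ 2 * ww h =
        ∫⁻ h, (WW n (2 ^ j)).indicator (fun h => ‖DD A x h‖ₑ ^ 2 * ww h) h := fun j => by
      rw [lintegral_indicator (WW_meas _)]
    simp only [e1]
    rw [← lintegral_tsum fun j => (hGm.indicator (WW_meas _)).aemeasurable]
    unfold qx
    rw [← lintegral_const_mul' _ _ (by simp)]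
    refine lintegral_mono fun h => ?_
    have e2 : ∀ j : ℤ, (WW n (2 ^ j)).indicator (fun h => ‖DD A x h‖ₑ ^ 2 * ww h) h =
        (if (1 / 8 : ℝ) ≤ 2 ^ j * ‖h‖ ∧ 2 ^ j * ‖h‖ ≤ 2 then (1 : ℝ≥0∞) else 0) * (‖DD A x h‖ₑ ^ 2 * ww h) := by
      intro j
      have : h ∈ WW n (2 ^ j) ↔ (1 / 8 : ℝ) ≤ 2 ^ j * ‖h‖ ∧ 2 ^ j * ‖h‖ ≤ 2 := Iff.rfl
      by_cases ht : h ∈ WW n (2 ^ j)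
      · rw [indicator_of_mem ht, if_pos (this.1 ht), one_mul]
      · rw [indicator_of_notMem ht, if_neg (mt this.2 ht), zero_mul]
    simp only [e2]
    rw [ENNReal.tsum_mul_right]
    gcongr
    refine (overlap (by norm_num) 4 (by norm_num)).trans ?_
    norm_num
  refine (mul_le_mul_right key _).trans (le_of_eq ?_)
  unfold cP
  ring

end P7

section P8
open Filter Topology
open scoped FourierTransform SchwartzMap

variable {n m : ℕ}

/-- Complex Euclidean space. -/
abbrev Ec (m : ℕ) := EuclideanSpace ℂ (Fin m)

lemma flip_id (g : 𝓢(Eu n, ℂ)) {f : Eu n → Ec m} (hf : Integrable f) :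
    ∫ x, (𝓕 g) x • f x = ∫ x, g x • 𝓕 f x := by
  have := VectorFourier.integral_fourierIntegral_smul_eq_flip (e := Real.fourierChar)
    (μ := (volume : Measure (Eu n))) (ν := (volume : Measure (Eu n))) (L := innerₗ (Eu n))
    (f := g) (g := f) Real.continuous_fourierChar continuous_inner g.integrable hf
  rw [flip_innerₗ] at this
  exact this

lemma plancherel {f : Eu n → Ec m} (hf : Continuous f) (hc : HasCompactSupport f) :
    ∫⁻ ξ, ‖𝓕 f ξ‖ₑ ^ 2 = ∫⁻ x, ‖f x‖ₑ ^ 2 := by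
  have h1 : Integrable f := hf.integrable_of_hasCompactSupport hc
  have h2 : MemLp f 2 := hf.memLp_of_hasCompactSupport hc
  set u := h2.toLp f with hu
  have hFc : Continuous (𝓕 f) :=
    VectorFourier.fourierIntegral_continuous Real.continuous_fourierChar continuous_inner h1
  have hae : ∀ᵐ x, (𝓕 u : Lp (Ec m) 2 (volume : Measure (Eu n))) x = 𝓕 f x := by
    apply ae_eq_of_integral_contDiff_smul_eq
    · exact (Lp.memLp (𝓕 u)).locallyIntegrable (by norm_num)
    · exact hFc.locallyIntegrable
    intro g hg hgc
    have hgC : ContDiff ℝ (⊤ : ℕ∞) (fun x => (g x : ℂ)) := Complex.ofRealCLM.contDiff.comp hg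
    have hgCc : HasCompactSupport (fun x => (g x : ℂ)) :=
      hgc.comp_left (g := fun x : ℝ => (x : ℂ)) (by simp)
    set G : 𝓢(Eu n, ℂ) := hgCc.toSchwartzMap hgC with hG
    have e1 := Lp.toTemperedDistribution_apply (𝓕 u) G
    rw [← Lp.fourier_toTemperedDistribution_eq, TemperedDistribution.fourier_apply,
      Lp.toTemperedDistribution_apply] at e1
    have e2 : ∫ x, (𝓕 G) x • u x = ∫ x, (𝓕 G) x • f x := by
      apply integral_congr_ae
      filter_upwards [h2.coeFn_toLp] with x hx
      rw [hx]
    rw [e2, flip_id G h1] at e1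
    have e3 : ∀ v : Ec m, ∀ x, G x • v = g x • v := by
      intro v x
      have : G x = (g x : ℂ) := rfl
      rw [this]
      exact Complex.coe_smul _ _
    simp only [e3] at e1
    exact e1.symm
  have hn : ‖𝓕 u‖ₑ = ‖u‖ₑ := by
    rw [← ofReal_norm, ← ofReal_norm, Lp.norm_fourier_eq]
  have key : ∀ v : Lp (Ec m) 2 (volume : Measure (Eu n)), ‖v‖ₑ ^ 2 = ∫⁻ x, ‖v x‖ₑ ^ 2 := by
    intro v
    rw [Lp.enorm_def]
    have := eLpNorm_nnreal_pow_eq_lintegral (f := v) (μ := volume) (p := 2) (by norm_num)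
    simpa using this
  have : ‖𝓕 u‖ₑ ^ 2 = ‖u‖ₑ ^ 2 := by rw [hn]
  rw [key, key] at this
  calc _ = ∫⁻ x, ‖(𝓕 u : Lp (Ec m) 2 (volume : Measure (Eu n))) x‖ₑ ^ 2 := by
        apply lintegral_congr_ae
        filter_upwards [hae] with x hx
        rw [hx]
    _ = _ := this
    _ = _ := by
        apply lintegral_congr_ae
        filter_upwards [h2.coeFn_toLp] with x hx
        rw [hx]
end P8

section P9
open Filter Topology
open scoped FourierTransform SchwartzMap

variable {n m : ℕ}

/-- integrand of the linear operator -/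
def GW {V : Type*} [NormedAddCommGroup V] [NormedSpace ℝ V] (w : Eu n → ℝ) (f : Eu n → V)
    (q : Eu n × Eu n) : V := w q.2 • (f (q.1 + q.2) - f q.1)

lemma GW_cont {V : Type*} [NormedAddCommGroup V] [NormedSpace ℝ V] {w : Eu n → ℝ} {f : Eu n → V}
    (hw : Continuous w) (hf : Continuous f) : Continuous (GW w f) := by
  unfold GW; fun_prop

lemma supp_ball {V : Type*} [NormedAddCommGroup V] {f : Eu n → V} (hc : HasCompactSupport f) :
    ∃ R : ℝ, 0 < R ∧ ∀ x, R < ‖x‖ → f x = 0 := by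
  obtain ⟨R, hR⟩ := hc.isCompact.isBounded.subset_closedBall 0
  refine ⟨max R 1, by positivity, fun x hx => ?_⟩
  by_contra hne
  have : x ∈ closedBall (0 : Eu n) R := hR (subset_tsupport _ hne)
  simp at this
  have := le_max_left R 1
  linarith

lemma GW_zero {V : Type*} [NormedAddCommGroup V] [NormedSpace ℝ V] {w : Eu n → ℝ} {f : Eu n → V}
    (hwc : HasCompactSupport w) (hc : HasCompactSupport f) :
    ∃ R : ℝ, 0 < R ∧ ∀ x h, (R < ‖x‖ ∨ R < ‖h‖) → GW w f (x, h) = 0 := by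
  obtain ⟨R1, h1, hR1⟩ := supp_ball hwc
  obtain ⟨R2, h2, hR2⟩ := supp_ball hc
  refine ⟨R1 + R2, by positivity, fun x h hxh => ?_⟩
  unfold GW
  by_cases hh : R1 < ‖h‖
  · simp [hR1 h hh]
  · push Not at hh
    rcases hxh with hx | hx
    · have : ‖x‖ ≤ ‖x + h‖ + ‖h‖ := by
        have := norm_sub_le (x + h) h
        simpa using this
      simp [hR2 x (by linarith), hR2 (x + h) (by linarith)]
    · linarith

lemma GW_supp {V : Type*} [NormedAddCommGroup V] [NormedSpace ℝ V] {w : Eu n → ℝ} {f : Eu n → V}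
    (hwc : HasCompactSupport w) (hc : HasCompactSupport f) : HasCompactSupport (GW w f) := by
  obtain ⟨R, hR, h⟩ := GW_zero hwc hc
  apply HasCompactSupport.intro ((isCompact_closedBall (0 : Eu n) R).prod (isCompact_closedBall (0 : Eu n) R))
  rintro ⟨x, y⟩ hq
  apply h
  by_contra hcon
  push Not at hcon
  exact hq ⟨by simpa using hcon.1, by simpa using hcon.2⟩

/-- linear operator -/
def LW {V : Type*} [NormedAddCommGroup V] [NormedSpace ℝ V] (w : Eu n → ℝ) (f : Eu n → V)
    (x : Eu n) : V := ∫ h, GW w f (x, h)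

lemma LW_supp {V : Type*} [NormedAddCommGroup V] [NormedSpace ℝ V] {w : Eu n → ℝ} {f : Eu n → V}
    (hwc : HasCompactSupport w) (hc : HasCompactSupport f) : HasCompactSupport (LW w f) := by
  obtain ⟨R, hR, h⟩ := GW_zero hwc hc
  apply HasCompactSupport.intro (isCompact_closedBall (0 : Eu n) R)
  intro x hx
  have hx' : R < ‖x‖ := by simpa using hx
  unfold LW
  simp [fun y => h x y (Or.inl hx')]

lemma LW_cont {V : Type*} [NormedAddCommGroup V] [NormedSpace ℝ V] {w : Eu n → ℝ} {f : Eu n → V}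
    (hw : Continuous w) (hf : Continuous f)
    (hwc : HasCompactSupport w) (hc : HasCompactSupport f) : Continuous (LW w f) := by
  obtain ⟨R, hR, h⟩ := GW_zero hwc hc
  obtain ⟨M, hM⟩ := (GW_supp hwc hc).exists_bound_of_continuous (GW_cont hw hf)
  have hG := GW_cont hw hf
  refine continuous_of_dominated (bound := (closedBall (0 : Eu n) R).indicator fun _ => M) ?_ ?_ ?_ ?_
  · intro x; exact (by fun_prop : Continuous fun h => GW w f (x, h)).aestronglyMeasurable
  · intro x
    refine Eventually.of_forall fun y => ?_
    by_cases hy : y ∈ closedBall (0 : Eu n) R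
    · rw [indicator_of_mem hy]; exact hM _
    · rw [indicator_of_notMem hy, h x y (Or.inr (by simpa using hy))]; simp
  · exact (integrable_indicator_iff measurableSet_closedBall).2
      (integrableOn_const (hs := (isCompact_closedBall _ _).measure_lt_top.ne))
  · exact Eventually.of_forall fun y => by fun_prop

/-- multiplier -/
def MW (w : Eu n → ℝ) (ξ : Eu n) : ℂ := ∫ h, (w h : ℂ) * ((Real.fourierChar (inner ℝ h ξ) : ℂ) - 1)

lemma fourier_shift {f : Eu n → Ec m} (hf : Continuous f) (hc : HasCompactSupport f) (h ξ : Eu n) :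
    𝓕 (fun x => f (x + h) - f x) ξ = ((Real.fourierChar (inner ℝ h ξ) : ℂ) - 1) • 𝓕 f ξ := by
  have h1 : Integrable f := hf.integrable_of_hasCompactSupport hc
  have h2 : Integrable fun x => f (x + h) := h1.comp_add_right h
  have e := congrFun (VectorFourier.fourierIntegral_comp_add_right Real.fourierChar
    (volume : Measure (Eu n)) (innerₗ (Eu n)) f h) ξ
  have e' : 𝓕 (fun x => f (x + h)) ξ = Real.fourierChar (inner ℝ h ξ) • 𝓕 f ξ := e
  have i1 := (Real.fourierIntegral_convergent_iff (μ := volume) ξ).2 h1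
  have i2 := (Real.fourierIntegral_convergent_iff (μ := volume) ξ).2 h2
  rw [sub_smul, one_smul, ← Circle.smul_def, ← e', Real.fourier_eq, Real.fourier_eq, Real.fourier_eq,
    ← integral_sub i2 i1]
  simp only [smul_sub]

lemma fourier_LW {w : Eu n → ℝ} {f : Eu n → Ec m}
    (hw : Continuous w) (hf : Continuous f)
    (hwc : HasCompactSupport w) (hc : HasCompactSupport f) (ξ : Eu n) :
    𝓕 (LW w f) ξ = MW w ξ • 𝓕 f ξ := by
  have hG := GW_cont hw hf
  have hI : Integrable (fun q : Eu n × Eu n => Real.fourierChar (-(inner ℝ q.1 ξ)) • GW w f q)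
      (volume.prod volume) := by
    have c : Continuous (fun q : Eu n × Eu n => Real.fourierChar (-(inner ℝ q.1 ξ)) • GW w f q) := by
      have := Real.continuous_fourierChar
      fun_prop
    apply c.integrable_of_hasCompactSupport
    refine (GW_supp hwc hc).mono fun q hq => ?_
    rw [Function.mem_support] at hq ⊢
    intro h0
    exact hq (by rw [h0, smul_zero])
  calc 𝓕 (LW w f) ξ = ∫ x, ∫ h, Real.fourierChar (-(inner ℝ x ξ)) • GW w f (x, h) := by
        rw [Real.fourier_eq]
        congr 1 with x
        unfold LW
        simp only [Circle.smul_def, integral_smul]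
    _ = ∫ h, ∫ x, Real.fourierChar (-(inner ℝ x ξ)) • GW w f (x, h) := integral_integral_swap hI
    _ = ∫ h, ((w h : ℂ) * ((Real.fourierChar (inner ℝ h ξ) : ℂ) - 1)) • 𝓕 f ξ := by
        refine integral_congr_ae (Eventually.of_forall fun h => ?_)
        beta_reduce
        rw [mul_smul, ← fourier_shift hf hc, Real.fourier_eq, ← integral_smul]
        refine integral_congr_ae (Eventually.of_forall fun x => ?_)
        show Real.fourierChar (-(inner ℝ x ξ)) • (w h • (f (x + h) - f x)) = _
        rw [smul_comm]
        exact (Complex.coe_smul _ _).symm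
    _ = _ := by
        rw [integral_smul_const]; rfl

end P9

section P10
open Filter Topology
open scoped FourierTransform SchwartzMap

variable {n m : ℕ}

/-- real part of the multiplier -/
def BB (w : Eu n → ℝ) (ξ : Eu n) : ℝ := ∫ h, w h * (1 - Real.cos (2 * Real.pi * inner ℝ h ξ))

lemma BB_le {w : Eu n → ℝ} (hw : Continuous w) (hwc : HasCompactSupport w) (ξ : Eu n) :
    BB w ξ ≤ ‖MW w ξ‖ := by
  have c : Continuous fun h : Eu n => (w h : ℂ) * ((Real.fourierChar (inner ℝ h ξ) : ℂ) - 1) := by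
    have := Real.continuous_fourierChar
    fun_prop
  have hi : Integrable fun h : Eu n => (w h : ℂ) * ((Real.fourierChar (inner ℝ h ξ) : ℂ) - 1) := by
    apply c.integrable_of_hasCompactSupport
    refine hwc.mono fun q hq => ?_
    rw [Function.mem_support] at hq ⊢
    intro h0
    exact hq (by rw [h0]; simp)
  have e : (MW w ξ).re = - BB w ξ := by
    have := Complex.reCLM.integral_comp_comm hi
    unfold MW BB
    rw [← Complex.reCLM_apply, ← this, ← integral_neg]
    refine integral_congr_ae (Eventually.of_forall fun h => ?_)
    beta_reduce
    rw [Complex.reCLM_apply, Complex.re_ofReal_mul, Real.fourierChar_apply, Complex.sub_re,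
      Complex.exp_ofReal_mul_I_re, Complex.one_re]
    ring
  calc BB w ξ = -(MW w ξ).re := by rw [e]; ring
    _ ≤ |(MW w ξ).re| := neg_le_abs _
    _ ≤ _ := Complex.abs_re_le_norm _

lemma phi_norm_supp {p : ℝ → ℝ} (hp : Prof p) : HasCompactSupport fun h : Eu n => phi n p ‖h‖ := by
  apply HasCompactSupport.intro (isCompact_closedBall (0 : Eu n) 2)
  intro h hh
  rw [mem_closedBall_zero_iff, not_le] at hh
  exact phi_large hp (by rw [abs_of_nonneg (norm_nonneg _)]; exact hh.le)

lemma phiS_norm_supp {p : ℝ → ℝ} (hp : Prof p) {l : ℝ} (hl : 0 < l) :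
    HasCompactSupport fun h : Eu n => phiS n p l ‖h‖ := by
  apply HasCompactSupport.intro (isCompact_closedBall (0 : Eu n) (2 / l))
  intro h hh
  rw [mem_closedBall_zero_iff, not_le, div_lt_iff₀ hl] at hh
  unfold phiS
  rw [phi_large hp (by rw [abs_of_nonneg (by positivity)]; linarith), mul_zero]

lemma phiS_norm_cont {p : ℝ → ℝ} (hp : Prof p) {l : ℝ} :
    Continuous fun h : Eu n => phiS n p l ‖h‖ := (phiS_cont hp l).comp continuous_norm

lemma BB_scale (p : ℝ → ℝ) {l : ℝ} (hl : 0 < l) (ξ : Eu n) :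
    BB (fun h => phiS n p l ‖h‖) ξ = l * BB (fun h => phi n p ‖h‖) (l⁻¹ • ξ) := by
  unfold BB
  have := Measure.integral_comp_smul (volume : Measure (Eu n))
    (fun u => phi n p ‖u‖ * (1 - Real.cos (2 * Real.pi * inner ℝ u (l⁻¹ • ξ)))) l
  have e : ∀ h : Eu n, phiS n p l ‖h‖ * (1 - Real.cos (2 * Real.pi * inner ℝ h ξ)) =
     l ^ (n + 1) * (phi n p ‖l • h‖ * (1 - Real.cos (2 * Real.pi * inner ℝ (l • h) (l⁻¹ • ξ)))) := by
    intro h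
    rw [norm_smul, Real.norm_of_nonneg hl.le, real_inner_smul_left, real_inner_smul_right,
      ← mul_assoc l, mul_inv_cancel₀ hl.ne', one_mul]
    unfold phiS; ring
  simp only [e]
  rw [integral_const_mul, this, finrank_euclideanSpace, Fintype.card_fin, abs_of_pos (by positivity),
    smul_eq_mul, pow_succ]
  field_simp

lemma phi_pos {p : ℝ → ℝ} (hp : Prof p) : ∃ s, 0 < s ∧ s ≤ 1 ∧ 0 < phi n p s := by
  have h1 : p (1 / 4) = 1 := hp.one _ (by rw [abs_of_pos] <;> norm_num)
  have h2 : p 2 = 0 := hp.zero _ (by norm_num)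
  have key : ∀ s, 0 < s → p (2 * s) < p s → 0 < phi n p s := by
    intro s hs h
    unfold phi
    exact mul_pos (by linarith) (by positivity)
  by_cases a : p (2 * (1 / 4)) < p (1 / 4)
  · exact ⟨1 / 4, by norm_num, by norm_num, key _ (by norm_num) a⟩
  by_cases b : p (2 * (1 / 2)) < p (1 / 2)
  · exact ⟨1 / 2, by norm_num, by norm_num, key _ (by norm_num) b⟩
  refine ⟨1, by norm_num, by norm_num, key _ (by norm_num) ?_⟩
  norm_num at a b ⊢
  norm_num at h1
  linarith

lemma BB_lower {p : ℝ → ℝ} (hp : Prof p) : ∃ c : ℝ, 0 < c ∧ ∀ η : Eu n, 1 / 16 ≤ ‖η‖ → ‖η‖ ≤ 1 / 8 →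
    c ≤ BB (fun h => phi n p ‖h‖) η := by
  have hcont := (phi_smooth (n := n) hp).continuous
  have hsupp := phi_norm_supp (n := n) hp
  have hK : IsCompact (closedBall (0 : Eu n) (1 / 8) ∩ {η | 1 / 16 ≤ ‖η‖}) :=
    (isCompact_closedBall _ _).inter_right (isClosed_le continuous_const continuous_norm)
  have hB : Continuous (BB fun h : Eu n => phi n p ‖h‖) := by
    unfold BB
    refine continuous_of_dominated (bound := fun h => 2 * ‖phi n p ‖h‖‖) ?_ ?_ ?_ ?_
    · intro x; exact (by fun_prop : Continuous _).aestronglyMeasurable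
    · intro x
      refine Eventually.of_forall fun h => ?_
      rw [norm_mul, mul_comm]
      gcongr
      rw [Real.norm_eq_abs, abs_le]
      constructor <;> nlinarith [Real.cos_le_one (2 * Real.pi * inner ℝ h x), Real.neg_one_le_cos (2 * Real.pi * inner ℝ h x)]
    · apply Integrable.const_mul
      apply Integrable.norm
      exact (hcont.comp continuous_norm).integrable_of_hasCompactSupport hsupp
    · exact Eventually.of_forall fun y => by fun_prop
  obtain ⟨c, hc, h⟩ := hK.exists_forall_le' hB.continuousOn (a := 0) (by
    rintro η ⟨h1, h2⟩
    rw [mem_closedBall_zero_iff] at h1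
    have h2' : 1 / 16 ≤ ‖η‖ := h2
    obtain ⟨s, hs0, hs1, hs⟩ := phi_pos (n := n) hp
    have hη : 0 < ‖η‖ := by linarith
    unfold BB
    refine Continuous.integral_pos_of_hasCompactSupport_nonneg_nonzero (x := (s * ‖η‖⁻¹) • η) ?_ ?_ ?_ ?_
    · fun_prop
    · exact hsupp.mul_right
    · intro h
      exact mul_nonneg (phi_nonneg hp (norm_nonneg _)) (by linarith [Real.cos_le_one (2 * Real.pi * inner ℝ h η)])
    · have e1 : ‖(s * ‖η‖⁻¹) • η‖ = s := by
        rw [norm_smul, Real.norm_of_nonneg (by positivity)]; field_simp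
      have e2 : inner ℝ ((s * ‖η‖⁻¹) • η) η = s * ‖η‖ := by
        rw [real_inner_smul_left, real_inner_self_eq_norm_sq]; field_simp
      beta_reduce
      rw [e1, e2]
      refine (mul_pos hs ?_).ne'
      have hpi := Real.pi_pos
      have hx : 0 < s * ‖η‖ := by positivity
      have hx2 : s * ‖η‖ ≤ 1 / 8 := by nlinarith
      have := Real.cos_lt_cos_of_nonneg_of_le_pi (x := 0) (y := 2 * Real.pi * (s * ‖η‖)) le_rfl (by nlinarith) (by positivity)
      rw [Real.cos_zero] at this
      linarith)
  exact ⟨c, hc, fun η h1 h2 => h η ⟨by simpa using h2, h1⟩⟩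

lemma MW_lower {p : ℝ → ℝ} (hp : Prof p) : ∃ c : ℝ, 0 < c ∧ ∀ ξ : Eu n,
    ∃ j : ℤ, c * ‖ξ‖ ≤ ‖MW (fun h => phiS n p ((2 : ℝ) ^ j) ‖h‖) ξ‖ := by
  obtain ⟨c, hc, h⟩ := BB_lower (n := n) hp
  refine ⟨c, hc, fun ξ => ?_⟩
  by_cases hξ : ξ = 0
  · exact ⟨0, by simp [hξ]⟩
  have hξ' : 0 < ‖ξ‖ := norm_pos_iff.2 hξ
  obtain ⟨k, hk1, hk2⟩ := exists_mem_Ico_zpow (x := 8 * ‖ξ‖) (y := (2 : ℝ)) (by positivity) (by norm_num)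
  refine ⟨k + 1, ?_⟩
  set l : ℝ := 2 ^ (k + 1) with hl
  have hl0 : 0 < l := by positivity
  have hl2 : l = 2 * 2 ^ k := by rw [hl, zpow_add_one₀ (by norm_num)]; ring
  have hn : ‖l⁻¹ • ξ‖ = ‖ξ‖ / l := by rw [norm_smul, Real.norm_of_nonneg (by positivity)]; field_simp
  have := h (l⁻¹ • ξ) (by rw [hn, div_le_div_iff₀ (by norm_num) hl0]; linarith)
    (by rw [hn, div_le_div_iff₀ hl0 (by norm_num)]; linarith)
  calc c * ‖ξ‖ ≤ l * c := by nlinarith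
    _ ≤ l * BB (fun h => phi n p ‖h‖) (l⁻¹ • ξ) := by gcongr
    _ = _ := (BB_scale p hl0 ξ).symm
    _ ≤ _ := BB_le (phiS_norm_cont hp) (phiS_norm_supp hp hl0) ξ

lemma fourier_cont {f : Eu n → Ec m} (hf : Continuous f) (hc : HasCompactSupport f) :
    Continuous (𝓕 f) :=
  VectorFourier.fourierIntegral_continuous Real.continuous_fourierChar continuous_inner
    (hf.integrable_of_hasCompactSupport hc)

lemma sum_lower {p : ℝ → ℝ} (hp : Prof p) : ∃ c : ℝ, 0 < c ∧ ∀ f : Eu n → Ec m, Continuous f →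
    HasCompactSupport f → ENNReal.ofReal c * ∫⁻ ξ, ENNReal.ofReal (‖ξ‖ ^ 2) * ‖𝓕 f ξ‖ₑ ^ 2 ≤
      ∑' j : ℤ, ∫⁻ x, ‖LW (fun h => phiS n p ((2 : ℝ) ^ j) ‖h‖) f x‖ₑ ^ 2 := by
  obtain ⟨c, hc, h⟩ := MW_lower (n := n) hp
  refine ⟨c ^ 2, by positivity, fun f hf hfc => ?_⟩
  have hw : ∀ j : ℤ, Continuous fun h : Eu n => phiS n p ((2 : ℝ) ^ j) ‖h‖ := fun j => phiS_norm_cont hp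
  have hwc : ∀ j : ℤ, HasCompactSupport fun h : Eu n => phiS n p ((2 : ℝ) ^ j) ‖h‖ :=
    fun j => phiS_norm_supp hp (by positivity)
  have e : ∀ j : ℤ, ∫⁻ x, ‖LW (fun h => phiS n p ((2 : ℝ) ^ j) ‖h‖) f x‖ₑ ^ 2 =
      ∫⁻ ξ, ‖𝓕 (LW (fun h => phiS n p ((2 : ℝ) ^ j) ‖h‖) f) ξ‖ₑ ^ 2 := fun j =>
    (plancherel (LW_cont (hw j) hf (hwc j) hfc) (LW_supp (hwc j) hfc)).symm
  simp only [e]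
  rw [← lintegral_tsum (fun j => ((fourier_cont (LW_cont (hw j) hf (hwc j) hfc)
    (LW_supp (hwc j) hfc)).enorm.measurable.pow_const 2).aemeasurable),
    ← lintegral_const_mul' _ _ ENNReal.ofReal_ne_top]
  refine lintegral_mono fun ξ => ?_
  beta_reduce
  obtain ⟨j, hj⟩ := h ξ
  refine le_trans ?_ (ENNReal.le_tsum j)
  rw [fourier_LW (hw j) hf (hwc j) hfc, enorm_smul, mul_pow, ← mul_assoc]
  refine mul_le_mul_left ?_ _
  rw [← ENNReal.ofReal_mul (by positivity), ← ofReal_norm, ← ENNReal.ofReal_pow (norm_nonneg _)]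
  apply ENNReal.ofReal_le_ofReal
  calc c ^ 2 * ‖ξ‖ ^ 2 = (c * ‖ξ‖) ^ 2 := by ring
    _ ≤ _ := by gcongr

/-- complexification -/
def cplx (m : ℕ) : Eu m →ₗᵢ[ℝ] Ec m where
  toFun v := WithLp.toLp 2 fun i => (v i : ℂ)
  map_add' u v := by ext i; simp
  map_smul' r v := by ext i; simp
  norm_map' v := by
    simp [EuclideanSpace.norm_eq]

lemma cplx_LL {A : Eu n → Eu m} {K : ℝ≥0} (hA : LipschitzWith K A) {p : ℝ → ℝ} (hp : Prof p) {l : ℝ}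
    (hl : 0 < l) (x : Eu n) :
    ‖LW (fun h => phiS n p l ‖h‖) (cplx m ∘ A) x‖ₑ = ‖LL (phiS n p l) A x‖ₑ := by
  have := (cplx m).toContinuousLinearMap.integral_comp_comm (LL_int hA hp hl x)
  have e : LW (fun h => phiS n p l ‖h‖) (cplx m ∘ A) x = cplx m (LL (phiS n p l) A x) := by
    unfold LW GW LL
    refine Eq.trans ?_ this
    refine integral_congr_ae (Eventually.of_forall fun h => ?_)
    simp
  rw [e, ← ofReal_norm, (cplx m).norm_map, ofReal_norm]

lemma gg_fourier {A : Eu n → Eu m} {K : ℝ≥0} (hA : LipschitzWith K A) (hc : HasCompactSupport A)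
    (h : Eu n) : gg A h ≤ ENNReal.ofReal ((2 * Real.pi * ‖h‖) ^ 2) *
      ∫⁻ ξ, ENNReal.ofReal (‖ξ‖ ^ 2) * ‖𝓕 (cplx m ∘ A) ξ‖ₑ ^ 2 := by
  set f := cplx m ∘ A with hf
  have hfC : Continuous f := (cplx m).continuous.comp hA.continuous
  have hfc : HasCompactSupport f := hc.comp_left (map_zero _)
  have e : gg A h = ∫⁻ x, ‖(fun x => f (x + h) - f x) x‖ₑ ^ 2 := by
    unfold gg
    refine lintegral_congr fun x => ?_
    congr 1
    show _ = ‖cplx m _ - cplx m _‖ₑ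
    rw [← map_sub, ← ofReal_norm, ← ofReal_norm, (cplx m).norm_map]
  have c1 : Continuous fun x => f (x + h) - f x := by fun_prop
  have s1 : HasCompactSupport fun x => f (x + h) - f x :=
    (hfc.comp_homeomorph (Homeomorph.addRight h)).sub hfc
  rw [e, ← plancherel c1 s1, ← lintegral_const_mul' _ _ ENNReal.ofReal_ne_top]
  refine lintegral_mono fun ξ => ?_
  beta_reduce
  rw [fourier_shift hfC hfc, enorm_smul, mul_pow, ← mul_assoc]
  refine mul_le_mul_left ?_ _
  rw [← ENNReal.ofReal_mul (by positivity), ← ofReal_norm, ← ENNReal.ofReal_pow (norm_nonneg _)]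
  apply ENNReal.ofReal_le_ofReal
  rw [← mul_pow]
  gcongr
  rw [Real.fourierChar_apply, mul_comm _ Complex.I]
  refine (Real.norm_exp_I_mul_ofReal_sub_one_le).trans ?_
  rw [norm_mul, Real.norm_of_nonneg (by positivity), mul_assoc (2 * Real.pi)]
  gcongr
  exact norm_inner_le_norm _ _

lemma op_le (L : Eu n →L[ℝ] Eu m) : ‖L‖ ^ 2 ≤ n * ∑ i, ‖L (EuclideanSpace.single i 1)‖ ^ 2 := by
  have h1 : ‖L‖ ≤ ∑ i, ‖L (EuclideanSpace.single i 1)‖ := by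
    refine L.opNorm_le_bound (Finset.sum_nonneg fun _ _ => norm_nonneg _) fun x => ?_
    have hx : x = ∑ i, x i • EuclideanSpace.single i (1 : ℝ) := by
      ext j; simp [Finset.sum_apply, Pi.single_apply]
    conv_lhs => rw [hx]
    rw [map_sum, Finset.sum_mul]
    refine (norm_sum_le _ _).trans (Finset.sum_le_sum fun i _ => ?_)
    rw [map_smul, norm_smul, mul_comm]
    gcongr
    exact PiLp.norm_apply_le x i
  calc ‖L‖ ^ 2 ≤ (∑ i, ‖L (EuclideanSpace.single i 1)‖) ^ 2 := by gcongr
    _ ≤ _ := by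
      have := sq_sum_le_card_mul_sum_sq (s := Finset.univ) (f := fun i : Fin n => ‖L (EuclideanSpace.single i 1)‖)
      simpa using this

lemma grad_fourier {A : Eu n → Eu m} {K : ℝ≥0} (hA : LipschitzWith K A) (hc : HasCompactSupport A) :
    gradL2 n m A ^ 2 ≤ ENNReal.ofReal (n * n * (2 * Real.pi) ^ 2) *
      ∫⁻ ξ, ENNReal.ofReal (‖ξ‖ ^ 2) * ‖𝓕 (cplx m ∘ A) ξ‖ₑ ^ 2 := by
  set X := ∫⁻ ξ, ENNReal.ofReal (‖ξ‖ ^ 2) * ‖𝓕 (cplx m ∘ A) ξ‖ₑ ^ 2 with hX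
  have h1 : ∀ i : Fin n, ∫⁻ x, ‖fderiv ℝ A x (EuclideanSpace.single i 1)‖ₑ ^ 2 ≤
      ENNReal.ofReal ((2 * Real.pi) ^ 2) * X := by
    intro i
    refine le_of_tendsto' (gg_tendsto hA hc (EuclideanSpace.single i 1)) fun N => ?_
    refine (mul_le_mul_right (gg_fourier hA hc _) _).trans ?_
    rw [← mul_assoc]
    refine mul_le_mul_left ?_ _
    rw [← ENNReal.ofReal_natCast, ← ENNReal.ofReal_pow (by positivity), ← ENNReal.ofReal_mul (by positivity)]
    apply ENNReal.ofReal_le_ofReal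
    rw [norm_smul, PiLp.norm_single, Real.norm_of_nonneg (by positivity), norm_one]
    apply le_of_eq
    have : ((N + 1 : ℕ) : ℝ) ≠ 0 := by positivity
    field_simp
  have hm : ∀ i : Fin n, Measurable fun x => ‖fderiv ℝ A x (EuclideanSpace.single i 1)‖ₑ ^ 2 := fun i =>
    (measurable_fderiv_apply_const ℝ A _).enorm.pow_const 2
  rw [gradL2_sq]
  calc ∫⁻ x, ‖fderiv ℝ A x‖ₑ ^ 2
      ≤ ∫⁻ x, (n : ℝ≥0∞) * ∑ i, ‖fderiv ℝ A x (EuclideanSpace.single i 1)‖ₑ ^ 2 := by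
        refine lintegral_mono fun x => ?_
        beta_reduce
        simp only [enorm_sq_ofReal]
        rw [← ofReal_norm (fderiv ℝ A x), ← ENNReal.ofReal_pow (norm_nonneg _), ← ENNReal.ofReal_natCast, ← ENNReal.ofReal_sum_of_nonneg (fun _ _ => by positivity),
          ← ENNReal.ofReal_mul (by positivity)]
        exact ENNReal.ofReal_le_ofReal (op_le _)
    _ = n * ∑ i : Fin n, ∫⁻ x, ‖fderiv ℝ A x (EuclideanSpace.single i 1)‖ₑ ^ 2 := by
        rw [lintegral_const_mul' _ _ (by simp), lintegral_finsetSum _ (fun i _ => hm i)]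
    _ ≤ n * ∑ i : Fin n, ENNReal.ofReal ((2 * Real.pi) ^ 2) * X := by
        refine mul_le_mul_right ?_ _
        exact Finset.sum_le_sum fun i _ => h1 i
    _ = _ := by
        rw [Finset.sum_const, Finset.card_univ, Fintype.card_fin, nsmul_eq_mul, ← mul_assoc, ← mul_assoc,
          ENNReal.ofReal_mul (by positivity), ENNReal.ofReal_mul (by positivity), ENNReal.ofReal_natCast]

lemma lin_lower (hn : 0 < n) {p : ℝ → ℝ} (hp : Prof p) : ∃ c : ℝ, 0 < c ∧ ∀ (A : Eu n → Eu m) (K : ℝ≥0),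
    LipschitzWith K A → HasCompactSupport A → ENNReal.ofReal c * gradL2 n m A ^ 2 ≤
      ∑' j : ℤ, ∫⁻ x, ‖LL (phiS n p ((2 : ℝ) ^ j)) A x‖ₑ ^ 2 := by
  obtain ⟨c, hc, h⟩ := sum_lower (n := n) (m := m) hp
  have hn' : (0 : ℝ) < n := by exact_mod_cast hn
  have hpi := Real.pi_pos
  have hD : 0 < (n * n * (2 * Real.pi) ^ 2 : ℝ) := by positivity
  refine ⟨c / (n * n * (2 * Real.pi) ^ 2), by positivity, fun A K hA hAc => ?_⟩
  have hh := h (cplx m ∘ A) ((cplx m).continuous.comp hA.continuous) (hAc.comp_left (map_zero _))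
  have e : ∀ (j : ℤ) x, ‖LW (fun h => phiS n p ((2 : ℝ) ^ j) ‖h‖) (cplx m ∘ A) x‖ₑ =
    ‖LL (phiS n p ((2 : ℝ) ^ j)) A x‖ₑ := fun j x => cplx_LL hA hp (by positivity) x
  simp only [e] at hh
  refine le_trans ?_ hh
  refine (mul_le_mul_right (grad_fourier hA hAc) _).trans ?_
  rw [← mul_assoc, ← ENNReal.ofReal_mul (by positivity), div_mul_cancel₀ _ hD.ne']

end P10

section P11
open Filter Topology

variable {n m : ℕ}

/-- discrete square function energy -/
def TS (p : ℝ → ℝ) (A : Eu n → Eu m) : ℝ≥0∞ :=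
  ∑' j : ℤ, ∫⁻ x, ‖TT (phiS n p ((2 : ℝ) ^ j)) A x‖ₑ ^ 2

/-- continuous square function energy -/
def SS (A : Eu n → Eu m) : ℝ≥0∞ :=
  ∫⁻ x, ∫⁻ t in Ioi (0 : ℝ), ENNReal.ofReal (‖TT (kap n t) A x‖ ^ 2 / t)

lemma TT_meas {A : Eu n → Eu m} (hA : Continuous A) {φ : ℝ → ℝ} (hφ : Continuous φ) :
    Measurable fun x => TT φ A x := by
  have h := rho_continuous hA
  have hc : Continuous (Function.uncurry fun x h => φ (rho A x h) • (A (x + h) - A x)) := by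
    unfold Function.uncurry
    fun_prop
  exact hc.stronglyMeasurable.integral_prod_right.measurable

lemma LL_meas {A : Eu n → Eu m} (hA : Continuous A) {φ : ℝ → ℝ} (hφ : Continuous φ) :
    Measurable fun x => LL φ A x := by
  have hc : Continuous (Function.uncurry fun x h => φ ‖h‖ • (A (x + h) - A x)) := by
    unfold Function.uncurry
    fun_prop
  exact hc.stronglyMeasurable.integral_prod_right.measurable

lemma TS_le_SS {A : Eu n → Eu m} {K : ℝ≥0} (hA : LipschitzWith K A) {p : ℝ → ℝ} (hp : Prof p) {M : ℝ}
    (hM : ∀ s, |deriv p s| ≤ M) : TS p A ≤ ENNReal.ofReal (4 * M ^ 2) * 5 * SS A := by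
  unfold TS SS
  rw [← lintegral_tsum (fun j => ((TT_meas hA.continuous (phiS_cont hp _)).enorm.pow_const 2).aemeasurable),
    ← lintegral_const_mul' _ _ (ENNReal.mul_ne_top ENNReal.ofReal_ne_top (by norm_num))]
  exact lintegral_mono fun x => sum_le_S hA hp hM x

lemma LS_le {A : Eu n → Eu m} {K : ℝ≥0} (hK : K ≤ 1 / 4) (hA : LipschitzWith K A) (hs : HasCompactSupport A)
    {p : ℝ → ℝ} (hp : Prof p) {Λ : ℝ≥0} (hΛ : LipschitzWith Λ (phi n p)) :
    ∑' j : ℤ, ∫⁻ x, ‖LL (phiS n p ((2 : ℝ) ^ j)) A x‖ₑ ^ 2 ≤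
      4 * (TS p A + ENNReal.ofReal (K ^ 2) * (cP n Λ * cQ n) * gradL2 n m A ^ 2) := by
  have m1 : ∀ j : ℤ, Measurable fun x => TT (phiS n p ((2 : ℝ) ^ j)) A x := fun j =>
    TT_meas hA.continuous (phiS_cont hp _)
  have m2 : ∀ j : ℤ, Measurable fun x => LL (phiS n p ((2 : ℝ) ^ j)) A x := fun j =>
    LL_meas hA.continuous (phiS_cont hp _)
  have e1 : ∑' j : ℤ, ∫⁻ x, ‖TT (phiS n p ((2 : ℝ) ^ j)) A x - LL (phiS n p ((2 : ℝ) ^ j)) A x‖ₑ ^ 2 ≤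
      ENNReal.ofReal (K ^ 2) * (cP n Λ * cQ n) * gradL2 n m A ^ 2 := by
    have m3 : ∀ j : ℤ, AEMeasurable (fun x => ‖TT (phiS n p ((2 : ℝ) ^ j)) A x -
        LL (phiS n p ((2 : ℝ) ^ j)) A x‖ₑ ^ 2) volume := fun j =>
      (((m1 j).sub (m2 j)).enorm.pow_const 2).aemeasurable
    rw [← lintegral_tsum m3]
    refine (lintegral_mono fun x => err_sum hK hA hp hΛ x).trans ?_
    rw [lintegral_const_mul' _ _ (ENNReal.mul_ne_top ENNReal.ofReal_ne_top (cP_lt_top _).ne),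
      QQ_eq hA.continuous, ← mul_assoc, mul_assoc (_ * _) (cQ n)]
    exact mul_le_mul_right (QQ_le hA hs) _
  refine le_trans ?_ (mul_le_mul_right (add_le_add le_rfl e1) _)
  unfold TS
  rw [← ENNReal.tsum_add, ← ENNReal.tsum_mul_left]
  refine ENNReal.tsum_le_tsum fun j => ?_
  rw [← lintegral_add_left ((m1 j).enorm.pow_const 2), ← lintegral_const_mul' _ _ (by norm_num)]
  refine lintegral_mono fun x => ?_
  beta_reduce
  refine le_trans ?_ (sq_add_le _ _)
  refine pow_le_pow_left' ?_ 2
  have : LL (phiS n p ((2 : ℝ) ^ j)) A x = TT (phiS n p ((2 : ℝ) ^ j)) A x -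
      (TT (phiS n p ((2 : ℝ) ^ j)) A x - LL (phiS n p ((2 : ℝ) ^ j)) A x) := by abel
  conv_lhs => rw [this]
  exact enorm_sub_le

lemma to_real_const {a : ℝ≥0∞} (ha : a < ⊤) : ∃ r : ℝ, 1 ≤ r ∧ a ≤ ENNReal.ofReal r :=
  ⟨max a.toReal 1, le_max_right _ _, by
    rw [← ENNReal.ofReal_toReal ha.ne]
    exact ENNReal.ofReal_le_ofReal (by simp)⟩

lemma main_an (hn : 0 < n) {p : ℝ → ℝ} (hp : Prof p) : ∃ ε c C : ℝ, 0 < ε ∧ 0 < c ∧ 0 < C ∧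
    ∀ A : Eu n → Eu m, HasCompactSupport A → LipschitzWith (Real.toNNReal ε) A →
      (ENNReal.ofReal c * TS p A ≤ SS A ∧ SS A ≤ ENNReal.ofReal C * TS p A ∧
        ENNReal.ofReal c * gradL2 n m A ^ 2 ≤ TS p A ∧ TS p A ≤ ENNReal.ofReal C * gradL2 n m A ^ 2) := by
  obtain ⟨M, hM0, hM⟩ := hp.deriv_bdd
  obtain ⟨Λ, hΛ⟩ := phi_lip (n := n) hp
  obtain ⟨c0, hc0, hlow⟩ := lin_lower (n := n) (m := m) hn hp
  obtain ⟨a, ha1, ha⟩ := to_real_const (a := ENNReal.ofReal (4 * M ^ 2) * 5)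
    (ENNReal.mul_lt_top ENNReal.ofReal_lt_top (by norm_num))
  obtain ⟨b, hb1, hb⟩ := to_real_const (a := cS n * cQ n) (ENNReal.mul_lt_top cS_lt_top (cQ_lt_top n))
  obtain ⟨e, he1, he⟩ := to_real_const (a := cP n Λ * cQ n) (ENNReal.mul_lt_top (cP_lt_top _) (cQ_lt_top n))
  have ha0 : 0 < a := by linarith
  have hb0 : 0 < b := by linarith
  have he0 : 0 < e := by linarith
  set ε : ℝ := min (1 / 4) (c0 / (8 * e)) with hε
  have hε0 : 0 < ε := by rw [hε]; exact lt_min (by norm_num) (by positivity)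
  have hε1 : ε ≤ 1 / 4 := min_le_left _ _
  have hε2 : ε * (8 * e) ≤ c0 := by
    rw [← le_div_iff₀ (by positivity)]; exact min_le_right _ _
  have hεε : 4 * (ε ^ 2 * e) ≤ c0 / 2 := by nlinarith [mul_pos hε0 he0]
  refine ⟨ε, min (1 / a) (c0 / 8), max (b * (8 / c0)) (a * b), hε0, lt_min (by positivity) (by positivity),
    lt_max_of_lt_right (by positivity), fun A hs hA => ?_⟩
  have hK : Real.toNNReal ε ≤ 1 / 4 := by
    rw [Real.toNNReal_le_iff_le_coe]; simpa using hε1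
  have hA4 : LipschitzWith (1 / 4) A := hA.weaken hK
  set g := gradL2 n m A ^ 2 with hg
  have hgt : g < ⊤ := gradL2_lt_top hA hs
  have k1 : TS p A ≤ ENNReal.ofReal a * SS A :=
    (TS_le_SS hA hp hM).trans (mul_le_mul_left ha _)
  have k2 : SS A ≤ ENNReal.ofReal b * g := (S_le_grad hA4 hs).trans (mul_le_mul_left hb _)
  have k3 : ENNReal.ofReal (c0 / 8) * g ≤ TS p A := by
    have h1 := (hlow A _ hA hs).trans (LS_le hK hA hs hp hΛ)
    rw [Real.coe_toNNReal _ hε0.le] at h1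
    have h2 : 4 * (TS p A + ENNReal.ofReal (ε ^ 2) * (cP n Λ * cQ n) * g) ≤
        4 * TS p A + ENNReal.ofReal (c0 / 2) * g := by
      rw [mul_add]
      refine add_le_add le_rfl ?_
      rw [← mul_assoc]
      refine mul_le_mul_left ?_ _
      calc 4 * (ENNReal.ofReal (ε ^ 2) * (cP n Λ * cQ n))
          ≤ 4 * (ENNReal.ofReal (ε ^ 2) * ENNReal.ofReal e) :=
            mul_le_mul_right (mul_le_mul_right he _) _
        _ = ENNReal.ofReal (4 * (ε ^ 2 * e)) := by
            rw [ENNReal.ofReal_mul (by norm_num), ENNReal.ofReal_mul (by positivity)]; simp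
        _ ≤ _ := ENNReal.ofReal_le_ofReal hεε
    have h3 := h1.trans h2
    have h4 : ENNReal.ofReal c0 * g = ENNReal.ofReal (c0 / 2) * g + ENNReal.ofReal (c0 / 2) * g := by
      rw [← add_mul, ← ENNReal.ofReal_add (by positivity) (by positivity), add_halves]
    rw [h4] at h3
    have h5 := (ENNReal.add_le_add_iff_right (ENNReal.mul_ne_top ENNReal.ofReal_ne_top hgt.ne)).1 h3
    have h6 : 4 * (ENNReal.ofReal (c0 / 8) * g) ≤ 4 * TS p A := by
      refine le_trans (le_of_eq ?_) h5
      rw [← mul_assoc]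
      congr 1
      rw [show c0 / 2 = 4 * (c0 / 8) by ring, ENNReal.ofReal_mul (by norm_num)]; simp
    exact (ENNReal.mul_le_mul_iff_right (by norm_num) (by norm_num)).1 h6
  refine ⟨?_, ?_, ?_, ?_⟩
  · calc ENNReal.ofReal (min (1 / a) (c0 / 8)) * TS p A ≤ ENNReal.ofReal (1 / a) * (ENNReal.ofReal a * SS A) :=
        mul_le_mul' (ENNReal.ofReal_le_ofReal (min_le_left _ _)) k1
      _ = SS A := by
        rw [← mul_assoc, ← ENNReal.ofReal_mul (by positivity), one_div_mul_cancel ha0.ne']; simp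
  · calc SS A ≤ ENNReal.ofReal b * g := k2
      _ = ENNReal.ofReal (b * (8 / c0)) * (ENNReal.ofReal (c0 / 8) * g) := by
        rw [← mul_assoc, ← ENNReal.ofReal_mul (by positivity)]
        congr 2
        field_simp
      _ ≤ _ := mul_le_mul' (ENNReal.ofReal_le_ofReal (le_max_left _ _)) k3
  · exact (mul_le_mul_left (ENNReal.ofReal_le_ofReal (min_le_right _ _)) _).trans k3
  · calc TS p A ≤ ENNReal.ofReal a * (ENNReal.ofReal b * g) := k1.trans (mul_le_mul_right k2 _)
      _ = ENNReal.ofReal (a * b) * g := by rw [← mul_assoc, ← ENNReal.ofReal_mul (by positivity)]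
      _ ≤ _ := mul_le_mul_left (ENNReal.ofReal_le_ofReal (le_max_right _ _)) _

end P11

section P12
open Filter Topology

variable {n d : ℕ}

lemma sum_split (hnd : n ≤ d) (F : Fin d → ℝ) : ∑ i, F i =
    ∑ i : Fin n, F ⟨i, i.isLt.trans_le hnd⟩ +
    ∑ k : Fin (d - n), F ⟨n + k, by have := k.isLt; omega⟩ := by
  have h : n + (d - n) = d := by omega
  rw [← Fin.sum_congr' F h, Fin.sum_univ_add]
  rfl

/-- last coordinates -/
def tailL (hnd : n ≤ d) : Eu d →ₗ[ℝ] Eu (d - n) where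
  toFun v := WithLp.toLp 2 fun k => v ⟨n + k, by have := k.isLt; omega⟩
  map_add' u v := by ext i; simp
  map_smul' r v := by ext i; simp

/-- last coordinates, continuous version -/
def tailC (hnd : n ≤ d) : Eu d →L[ℝ] Eu (d - n) := LinearMap.toContinuousLinearMap (tailL hnd)

lemma tailC_apply (hnd : n ≤ d) (v : Eu d) (k : Fin (d - n)) :
    tailC hnd v k = v ⟨n + k, by have := k.isLt; omega⟩ := rfl

lemma norm_projPerp (hnd : n ≤ d) (v : Eu d) : ‖projPerp n d v‖ = ‖tailC hnd v‖ := by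
  rw [EuclideanSpace.norm_eq, EuclideanSpace.norm_eq, sum_split hnd]
  congr 1
  have h1 : ∀ i : Fin n, projPerp n d v ⟨i, i.isLt.trans_le hnd⟩ = 0 := by
    intro i; simp [projPerp]
  have h2 : ∀ k : Fin (d - n), projPerp n d v ⟨n + k, by have := k.isLt; omega⟩ = tailC hnd v k := by
    intro i; rw [tailC_apply]; simp [projPerp]
  simp only [h1, h2]
  simp

lemma graph_lo (hnd : n ≤ d) (A : Eu n → Eu (d - n)) (x : Eu n) (i : Fin n) :
    graphMap n d hnd A x ⟨i, i.isLt.trans_le hnd⟩ = x i := by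
  simp [graphMap]

lemma graph_hi (hnd : n ≤ d) (A : Eu n → Eu (d - n)) (x : Eu n) (k : Fin (d - n)) :
    graphMap n d hnd A x ⟨n + k, by have := k.isLt; omega⟩ = A x k := by
  simp [graphMap]

lemma tail_graph (hnd : n ≤ d) (A : Eu n → Eu (d - n)) (x : Eu n) :
    tailC hnd (graphMap n d hnd A x) = A x := by
  ext k
  rw [tailC_apply, graph_hi]

lemma norm_graph (hnd : n ≤ d) (A : Eu n → Eu (d - n)) (x h : Eu n) :
    ‖graphMap n d hnd A x - graphMap n d hnd A (x + h)‖ = rho A x h := by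
  unfold rho
  rw [← norm_neg h, ← norm_neg (A (x + h) - A x), EuclideanSpace.norm_eq, sum_split hnd]
  congr 1
  rw [EuclideanSpace.norm_sq_eq, EuclideanSpace.norm_sq_eq]
  congr 1
  · refine Finset.sum_congr rfl fun i _ => ?_
    rw [PiLp.sub_apply, graph_lo, graph_lo]
    simp
  · refine Finset.sum_congr rfl fun i _ => ?_
    rw [PiLp.sub_apply, graph_hi, graph_hi]
    simp

lemma graph_cont (hnd : n ≤ d) {A : Eu n → Eu (d - n)} (hA : Continuous A) :
    Continuous (graphMap n d hnd A) := by
  refine (PiLp.continuous_toLp 2 _).comp (continuous_pi fun i => ?_)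
  by_cases h : (i : ℕ) < n
  · simp only [h, dite_true]; fun_prop
  · simp only [h, dite_false]; fun_prop

lemma graph_emb (hnd : n ≤ d) {A : Eu n → Eu (d - n)} (hA : Continuous A) :
    MeasurableEmbedding (graphMap n d hnd A) := by
  refine (graph_cont hnd hA).measurableEmbedding fun x y h => ?_
  ext i
  rw [← graph_lo hnd A x i, ← graph_lo hnd A y i, h]

/-- graph transform -/
def TG (hnd : n ≤ d) (φ : ℝ → ℝ) (A : Eu n → Eu (d - n)) (x : Eu n) : Eu d :=
  ∫ h, φ (rho A x h) • (graphMap n d hnd A x - graphMap n d hnd A (x + h))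

lemma TG_int (hnd : n ≤ d) {A : Eu n → Eu (d - n)} (hA : Continuous A) {φ : ℝ → ℝ} (hφ : Measurable φ)
    {M R : ℝ} (hM : ∀ r, |φ r| ≤ M) (hR : ∀ r, R < r → φ r = 0) (x : Eu n) :
    Integrable fun h => φ (rho A x h) • (graphMap n d hnd A x - graphMap n d hnd A (x + h)) := by
  have hM0 : 0 ≤ M := (abs_nonneg _).trans (hM 0)
  refine int_of_bdd (M := M * max R 0) (R := max R 0) ?_ ?_ ?_
  · have c2 : Continuous fun h => graphMap n d hnd A x - graphMap n d hnd A (x + h) := by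
      have := graph_cont hnd hA; fun_prop
    exact ((hφ.comp (rho_continuous' hA x).measurable).aestronglyMeasurable).smul
      c2.aestronglyMeasurable
  · intro h
    by_cases hh : R < rho A x h
    · rw [hR _ hh]; simp; positivity
    · rw [norm_smul, Real.norm_eq_abs, norm_graph]
      exact mul_le_mul (hM _) ((not_lt.1 hh).trans (le_max_left _ _)) (rho_nonneg _ _ _) hM0
  · intro h hh
    rw [hR _ (lt_of_lt_of_le ((le_max_left _ _).trans_lt hh) (norm_le_rho A x h)), zero_smul]

lemma norm_TG (hnd : n ≤ d) {A : Eu n → Eu (d - n)} (hA : Continuous A) {φ : ℝ → ℝ} (hφ : Measurable φ)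
    {M R : ℝ} (hM : ∀ r, |φ r| ≤ M) (hR : ∀ r, R < r → φ r = 0) (x : Eu n) :
    ‖projPerp n d (TG hnd φ A x)‖ = ‖TT φ A x‖ := by
  rw [norm_projPerp hnd, ← norm_neg]
  congr 1
  unfold TG TT
  rw [← (tailC hnd).integral_comp_comm (TG_int hnd hA hφ hM hR x), ← integral_neg]
  refine integral_congr_ae (Eventually.of_forall fun h => ?_)
  beta_reduce
  rw [map_smul, map_sub, tail_graph, tail_graph, ← smul_neg, neg_sub]

lemma riesz_rho (hnd : n ≤ d) (A : Eu n → Eu (d - n)) (x h : Eu n) :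
    rieszKernel d n (graphMap n d hnd A x) (graphMap n d hnd A (x + h)) =
      ((rho A x h) ^ (n + 1))⁻¹ • (graphMap n d hnd A x - graphMap n d hnd A (x + h)) := by
  unfold rieszKernel
  rw [norm_graph, Real.rpow_neg (rho_nonneg _ _ _)]
  congr 2
  exact_mod_cast Real.rpow_natCast (rho A x h) (n + 1)

lemma trunc_eq (hnd : n ≤ d) {A : Eu n → Eu (d - n)} (hA : Continuous A) (x : Eu n) (t : ℝ) :
    truncRiesz d n (Measure.map (graphMap n d hnd A) volume) (graphMap n d hnd A x) t (2 * t) =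
      TG hnd (kap n t) A x := by
  unfold truncRiesz TG
  have hS : MeasurableSet {y | t < dist (graphMap n d hnd A x) y ∧ dist (graphMap n d hnd A x) y ≤ 2 * t} := by
    have hm : Measurable fun y => dist (graphMap n d hnd A x) y := by fun_prop
    exact (measurableSet_lt measurable_const hm).inter (measurableSet_le hm measurable_const)
  rw [← integral_indicator hS, (graph_emb hnd hA).integral_map, ← integral_add_left_eq_self _ x]
  refine integral_congr_ae (Eventually.of_forall fun h => ?_)
  beta_reduce
  have hd : dist (graphMap n d hnd A x) (graphMap n d hnd A (x + h)) = rho A x h := by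
    rw [dist_eq_norm, norm_graph]
  by_cases hr : rho A x h ∈ Ioc t (2 * t)
  · have hm : graphMap n d hnd A (x + h) ∈
      {y | t < dist (graphMap n d hnd A x) y ∧ dist (graphMap n d hnd A x) y ≤ 2 * t} := by
      show _ ∧ _
      rw [hd]; exact hr
    rw [indicator_of_mem hm, riesz_rho]
    unfold kap
    rw [indicator_of_mem hr]
  · have hm : graphMap n d hnd A (x + h) ∉
      {y | t < dist (graphMap n d hnd A x) y ∧ dist (graphMap n d hnd A x) y ≤ 2 * t} := by
      intro hh
      have hh' : _ ∧ _ := hh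
      rw [hd] at hh'; exact hr hh'
    rw [indicator_of_notMem hm]
    unfold kap
    rw [indicator_of_notMem hr, zero_smul]

lemma smooth_eq (hnd : n ≤ d) {A : Eu n → Eu (d - n)} (hA : Continuous A) (x : Eu n) (j : ℤ)
    {ψ : Eu d → ℝ} {p : ℝ → ℝ} (hψ : ∀ z, ψ z = p ‖z‖) :
    smoothTrunc n d ψ j (Measure.map (graphMap n d hnd A) volume) (graphMap n d hnd A x) =
      TG hnd (phiS n p ((2 : ℝ) ^ j)) A x := by
  unfold smoothTrunc TG
  have hl : (0 : ℝ) < 2 ^ j := by positivity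
  have hl' : (0 : ℝ) < 2 ^ (j + 1) := by positivity
  rw [(graph_emb hnd hA).integral_map, ← integral_add_left_eq_self _ x]
  refine integral_congr_ae (Eventually.of_forall fun h => ?_)
  beta_reduce
  rw [riesz_rho, hψ, hψ, norm_smul, norm_smul, norm_graph, Real.norm_of_nonneg hl.le,
    Real.norm_of_nonneg hl'.le, smul_smul, phiS_eq p hl, zpow_add_one₀ (by norm_num)]
  congr 4
  ring

lemma norm_trunc (hnd : n ≤ d) {A : Eu n → Eu (d - n)} (hA : Continuous A) (x : Eu n) {t : ℝ} (ht : 0 < t) :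
    ‖projPerp n d (truncRiesz d n (Measure.map (graphMap n d hnd A) volume) (graphMap n d hnd A x) t (2 * t))‖ =
      ‖TT (kap n t) A x‖ := by
  rw [trunc_eq hnd hA]
  refine norm_TG hnd hA (kap_meas t) (M := (t ^ (n + 1))⁻¹) (R := 2 * t) ?_ ?_ x
  · intro r; rw [abs_of_nonneg (kap_nonneg ht r)]; exact kap_le ht r
  · intro r hr; exact indicator_of_notMem (fun h => absurd h.2 (not_le.2 hr)) _

lemma norm_smooth (hnd : n ≤ d) {A : Eu n → Eu (d - n)} (hA : Continuous A) (x : Eu n) (j : ℤ)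
    {ψ : Eu d → ℝ} {p : ℝ → ℝ} (hp : Prof p) (hψ : ∀ z, ψ z = p ‖z‖) :
    ‖projPerp n d (smoothTrunc n d ψ j (Measure.map (graphMap n d hnd A) volume) (graphMap n d hnd A x))‖ =
      ‖TT (phiS n p ((2 : ℝ) ^ j)) A x‖ := by
  rw [smooth_eq hnd hA x j hψ]
  have hl : (0 : ℝ) < 2 ^ j := by positivity
  set l : ℝ := 2 ^ j
  obtain ⟨M, hM⟩ := phi_bdd (n := n) hp
  refine norm_TG hnd hA (phiS_cont hp l).measurable (M := l ^ (n + 1) * M) (R := 2 / l) ?_ ?_ x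
  · intro r
    unfold phiS
    rw [abs_mul, abs_of_pos (by positivity)]
    gcongr; exact hM _
  · intro r hr
    unfold phiS
    have hr0 : 0 < r := lt_trans (by positivity) hr
    rw [phi_large hp, mul_zero]
    rw [abs_of_pos (by positivity)]
    rw [div_lt_iff₀ hl] at hr
    linarith

lemma SS_eq (hnd : n ≤ d) {A : Eu n → Eu (d - n)} (hA : Continuous A) :
    ∫⁻ x, (sqFnPerp n d (Measure.map (graphMap n d hnd A) volume) x) ^ 2
      ∂(Measure.map (graphMap n d hnd A) volume) = SS A := by
  rw [(graph_emb hnd hA).lintegral_map]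
  unfold SS
  refine lintegral_congr fun x => ?_
  unfold sqFnPerp
  rw [← ENNReal.rpow_natCast, ← ENNReal.rpow_mul]
  norm_num
  refine setLIntegral_congr_fun measurableSet_Ioi fun t ht => ?_
  beta_reduce
  rw [norm_trunc hnd hA x ht]

lemma TS_eq (hnd : n ≤ d) {A : Eu n → Eu (d - n)} (hA : Continuous A)
    {ψ : Eu d → ℝ} {p : ℝ → ℝ} (hp : Prof p) (hψ : ∀ z, ψ z = p ‖z‖) :
    ∑' j : ℤ, ∫⁻ x, ENNReal.ofReal (‖projPerp n d (smoothTrunc n d ψ j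
      (Measure.map (graphMap n d hnd A) volume) x)‖ ^ 2)
      ∂(Measure.map (graphMap n d hnd A) volume) = TS p A := by
  unfold TS
  refine tsum_congr fun j => ?_
  rw [(graph_emb hnd hA).lintegral_map]
  refine lintegral_congr fun x => ?_
  rw [norm_smooth hnd hA x j hp hψ, enorm_sq_ofReal]

end P12

theorem stmt6 (n d : ℕ) (hn : 0 < n) (hnd : n ≤ d)
    (ψ0 : EuclideanSpace ℝ (Fin d) → ℝ)
    (hψsmooth : ContDiff ℝ (⊤ : ℕ∞) ψ0)
    (hψradial : ∀ z w : EuclideanSpace ℝ (Fin d), ‖z‖ ≤ ‖w‖ → ψ0 w ≤ ψ0 z)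
    (hψ0 : ∀ z, 0 ≤ ψ0 z) (hψ1 : ∀ z, ψ0 z ≤ 1)
    (hψin : ∀ z : EuclideanSpace ℝ (Fin d), ‖z‖ < 1/2 → ψ0 z = 1)
    (hψout : ∀ z : EuclideanSpace ℝ (Fin d), 2 ≤ ‖z‖ → ψ0 z = 0) :
    ∃ ε₀ c C : ℝ, 0 < ε₀ ∧ 0 < c ∧ 0 < C ∧
      ∀ A : EuclideanSpace ℝ (Fin n) → EuclideanSpace ℝ (Fin (d - n)),
        HasCompactSupport A →
        LipschitzWith (Real.toNNReal ε₀) A →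
        -- `μ₀ = Ã_♯(Lebesgue)`, so that `Π_♯ μ₀` is Lebesgue measure on `ℝ^n`
        (ENNReal.ofReal c *
            (∑' j : ℤ, ∫⁻ x, ENNReal.ofReal
              (‖projPerp n d (smoothTrunc n d ψ0 j
                  (Measure.map (graphMap n d hnd A) volume) x)‖^2)
              ∂(Measure.map (graphMap n d hnd A) volume))
          ≤ ∫⁻ x, (sqFnPerp n d (Measure.map (graphMap n d hnd A) volume) x)^2
              ∂(Measure.map (graphMap n d hnd A) volume) ∧
        (∫⁻ x, (sqFnPerp n d (Measure.map (graphMap n d hnd A) volume) x)^2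
              ∂(Measure.map (graphMap n d hnd A) volume))
          ≤ ENNReal.ofReal C *
            (∑' j : ℤ, ∫⁻ x, ENNReal.ofReal
              (‖projPerp n d (smoothTrunc n d ψ0 j
                  (Measure.map (graphMap n d hnd A) volume) x)‖^2)
              ∂(Measure.map (graphMap n d hnd A) volume)) ∧
        ENNReal.ofReal c * (gradL2 n (d - n) A)^2
          ≤ (∑' j : ℤ, ∫⁻ x, ENNReal.ofReal
              (‖projPerp n d (smoothTrunc n d ψ0 j
                  (Measure.map (graphMap n d hnd A) volume) x)‖^2)
              ∂(Measure.map (graphMap n d hnd A) volume)) ∧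
        (∑' j : ℤ, ∫⁻ x, ENNReal.ofReal
              (‖projPerp n d (smoothTrunc n d ψ0 j
                  (Measure.map (graphMap n d hnd A) volume) x)‖^2)
              ∂(Measure.map (graphMap n d hnd A) volume))
          ≤ ENNReal.ofReal C * (gradL2 n (d - n) A)^2) := by
  set e : EuclideanSpace ℝ (Fin d) := EuclideanSpace.single ⟨0, hn.trans_le hnd⟩ 1 with he
  have he1 : ‖e‖ = 1 := by rw [he, PiLp.norm_single, norm_one]
  have hs : ∀ s : ℝ, ‖s • e‖ = |s| := fun s => by rw [norm_smul, he1, mul_one, Real.norm_eq_abs]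
  have hp : Prof (fun s : ℝ => ψ0 (s • e)) := by
    refine ⟨?_, ?_, ?_, ?_⟩
    · have h1 : ContDiff ℝ 1 ψ0 := hψsmooth.of_le (by exact_mod_cast le_top)
      exact h1.comp (by fun_prop)
    · intro a b ha hab
      apply hψradial
      rw [hs, hs, abs_of_nonneg ha, abs_of_nonneg (ha.trans hab)]
      exact hab
    · intro s h; exact hψin _ (by rw [hs]; exact h)
    · intro s h; exact hψout _ (by rw [hs]; exact h)
  have hψ : ∀ z, ψ0 z = (fun s : ℝ => ψ0 (s • e)) ‖z‖ := by
    intro z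
    have : ‖‖z‖ • e‖ = ‖z‖ := by rw [hs, abs_of_nonneg (norm_nonneg _)]
    exact le_antisymm (hψradial _ _ this.le) (hψradial _ _ this.ge)
  obtain ⟨ε, c, C, h1, h2, h3, h⟩ := main_an (n := n) (m := d - n) hn hp
  refine ⟨ε, c, C, h1, h2, h3, fun A hAc hA => ?_⟩
  rw [SS_eq hnd hA.continuous, TS_eq hnd hA.continuous hp hψ]
  exact h A hAc hA
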